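/- Suppose G is a multigraph with no isolated vertices and |V(G)| ≥ 2. Then the following statements are equivalent: (1) G is 4-edge-connected; (2) there exists a vertex r of G such that G has a chain decomposition rooted at r; (3) for every vertex r of G, G has a chain decomposition rooted at r; (4) there exists a vertex r of G such that G has four edge-independent spanning trees rooted at r; (5) for every vertex r of G, G has four edge-independent spanning trees rooted at r. -/

import Mathlib

set_option autoImplicit false

/-- A multigraph: a type of vertices, a type of edges, and a map assigning to each
edge its unordered pair of endpoints (a loop has endpoints `s(v, v)`). -/
structure MG : Type 1 where
  V : Type
  E : Type
  ends : E → Sym2 V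

namespace MG

variable (G : MG)

/-- The set of vertices covered by a set `F` of edges. -/
def vertsOf (F : Set G.E) : Set G.V := {v | ∃ e ∈ F, v ∈ G.ends e}

/-- The degree of a vertex `v` with respect to a set `F` of edges;
a loop contributes two to the degree. -/
noncomputable def deg (F : Set G.E) (v : G.V) : ℕ :=
  {e ∈ F | v ∈ G.ends e}.ncard + {e ∈ F | G.ends e = s(v, v)}.ncard

/-- `G` has no isolated vertices. -/
def NoIsolated : Prop := ∀ v : G.V, ∃ e : G.E, v ∈ G.ends e

/-- `IsLink vs es`: the edge list `es` successively links the consecutive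
vertices of the vertex list `vs`. -/
def IsLink : List G.V → List G.E → Prop
  | [_], [] => True
  | a :: b :: vs, e :: es => G.ends e = s(a, b) ∧ IsLink (b :: vs) es
  | _, _ => False

/-- `vs, es` form a (simple) path: distinct vertices, distinct edges, consecutive linking. -/
def IsPath (vs : List G.V) (es : List G.E) : Prop :=
  vs.Nodup ∧ es.Nodup ∧ G.IsLink vs es

/-- `v :: vs, es` form a (simple) cycle through the basepoint `v`:
the distinct vertices `v :: vs` are linked cyclically by the distinct edges `es`.
A loop gives a cycle of length one and two parallel edges give a cycle of length two. -/
def IsCycle (v : G.V) (vs : List G.V) (es : List G.E) : Prop :=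
  (v :: vs).Nodup ∧ es.Nodup ∧ es ≠ [] ∧ G.IsLink (v :: (vs ++ [v])) es

/-- Reachability using only edges from `F`. -/
def Reach (F : Set G.E) : G.V → G.V → Prop :=
  Relation.ReflTransGen (fun a b => ∃ e ∈ F, G.ends e = s(a, b))

/-- `G` with edge set restricted to `F` is connected as a graph on all of `G.V`. -/
def ConnectedOn (F : Set G.E) : Prop := ∀ a b : G.V, G.Reach F a b

/-- The subgraph formed by the edge set `F` together with the vertices it covers
is connected. -/
def ConnectedWithin (F : Set G.E) : Prop :=
  ∀ a ∈ G.vertsOf F, ∀ b ∈ G.vertsOf F, G.Reach F a b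

/-- `G` is 4-edge-connected: at least two vertices, and deleting any set of fewer
than four edges leaves the graph connected. -/
def FourEdgeConnected : Prop :=
  2 ≤ Nat.card G.V ∧ ∀ S : Set G.E, S.Finite → S.ncard < 4 → G.ConnectedOn Sᶜ

/-- `e` is a cut edge of the subgraph formed by the edge set `F`: removing `e`
disconnects two vertices of that subgraph. -/
def IsCutEdge (F : Set G.E) (e : G.E) : Prop :=
  e ∈ F ∧ ∃ a ∈ G.vertsOf F, ∃ b ∈ G.vertsOf F, ¬ G.Reach (F \ {e}) a b

/-! ### Chains -/

/-- An open up chain with respect to `(H, Hb)`, rooted at `r`: a path with at least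
one edge, edge-disjoint from `H` and `Hb`, in which every vertex is `r` or has degree
at least two in `Hb`, and whose ends are `r` or lie in `H`. -/
def IsOpenUpChain (r : G.V) (H Hb C : Set G.E) : Prop :=
  Disjoint C H ∧ Disjoint C Hb ∧
  ∃ vs es, G.IsPath vs es ∧ es ≠ [] ∧ C = {e | e ∈ es} ∧
    (∀ v ∈ vs, v = r ∨ 2 ≤ G.deg Hb v) ∧
    (∀ v, vs.head? = some v → v = r ∨ v ∈ G.vertsOf H) ∧
    (∀ v, vs.getLast? = some v → v = r ∨ v ∈ G.vertsOf H)

/-- A closed up chain with respect to `(H, Hb)`, rooted at `r`, with common end `v`: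
a cycle through `v`, edge-disjoint from `H` and `Hb`, in which every vertex is `r` or
has degree at least two in `Hb`, and the end `v` is `r` or has degree at least two in `H`. -/
def IsClosedUpChain (r : G.V) (H Hb C : Set G.E) (v : G.V) : Prop :=
  Disjoint C H ∧ Disjoint C Hb ∧
  ∃ vs es, G.IsCycle v vs es ∧ C = {e | e ∈ es} ∧
    (∀ u ∈ v :: vs, u = r ∨ 2 ≤ G.deg Hb u) ∧
    (v = r ∨ 2 ≤ G.deg H v)

/-- An up chain with respect to `(H, Hb)`. -/
def IsUpChain (r : G.V) (H Hb C : Set G.E) : Prop :=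
  G.IsOpenUpChain r H Hb C ∨ ∃ v, G.IsClosedUpChain r H Hb C v

/-- A down chain with respect to `(H, Hb)` is an up chain with respect to `(Hb, H)`. -/
def IsDownChain (r : G.V) (H Hb C : Set G.E) : Prop := G.IsUpChain r Hb H C

/-- A closed down chain with respect to `(H, Hb)` with common end `v`. -/
def IsClosedDownChain (r : G.V) (H Hb C : Set G.E) (v : G.V) : Prop :=
  G.IsClosedUpChain r Hb H C v

/-- A one-way chain with respect to `(H, Hb)`, with tail `u` and head `v`:
a single edge `e ∉ H ∪ Hb` with ends `u` and `v`, where the tail `u` is `r` or has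
degree at least two in `H`, and the head `v` is `r` or has degree at least two in `Hb`. -/
def IsOneWayChainAt (r : G.V) (H Hb C : Set G.E) (u v : G.V) : Prop :=
  ∃ e, e ∉ H ∧ e ∉ Hb ∧ C = {e} ∧ G.ends e = s(u, v) ∧
    (u = r ∨ 2 ≤ G.deg H u) ∧ (v = r ∨ 2 ≤ G.deg Hb v)

/-- A one-way chain with respect to `(H, Hb)`. -/
def IsOneWayChain (r : G.V) (H Hb C : Set G.E) : Prop :=
  ∃ u v, G.IsOneWayChainAt r H Hb C u v

/-- A chain with respect to `(H, Hb)`: an up chain, a down chain, or a one-way chain. -/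
def IsChain (r : G.V) (H Hb C : Set G.E) : Prop :=
  G.IsUpChain r H Hb C ∨ G.IsDownChain r H Hb C ∨ G.IsOneWayChain r H Hb C

/-- `H_i`: the union of the chains with index `< i`. -/
def before {n : ℕ} (Gs : Fin n → Set G.E) (i : Fin n) : Set G.E :=
  {e | ∃ j, j < i ∧ e ∈ Gs j}

/-- `Hbar_i`: the union of the chains with index `> i`. -/
def after {n : ℕ} (Gs : Fin n → Set G.E) (i : Fin n) : Set G.E :=
  {e | ∃ j, i < j ∧ e ∈ Gs j}

/-- `Gs` is a chain decomposition, rooted at `r`, of the part of `G` with edge set `F`: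
the `Gs i` partition `F`, and each `Gs i` is an up chain, a down chain or a one-way
chain with respect to `(H_i, Hbar_i)`. -/
def IsChainDecompOn (F : Set G.E) (r : G.V) {n : ℕ} (Gs : Fin n → Set G.E) : Prop :=
  (∀ i j, i ≠ j → Disjoint (Gs i) (Gs j)) ∧ (⋃ i, Gs i) = F ∧
  ∀ i, G.IsChain r (G.before Gs i) (G.after Gs i) (Gs i)

/-- `Gs` is a chain decomposition of `G` rooted at `r`. -/
def IsChainDecomp (r : G.V) {n : ℕ} (Gs : Fin n → Set G.E) : Prop :=
  G.IsChainDecompOn Set.univ r Gs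

/-- `G` has a chain decomposition rooted at `r`. -/
def HasChainDecomp (r : G.V) : Prop :=
  ∃ (m : ℕ) (Gs : Fin (m + 1) → Set G.E), G.IsChainDecomp r Gs

/-- A minimal open up chain: an open up chain none of whose internal vertices
lies in `{r} ∪ V(H)`. -/
def IsMinimalOpenUpChain (r : G.V) (H Hb C : Set G.E) : Prop :=
  Disjoint C H ∧ Disjoint C Hb ∧
  ∃ vs es, G.IsPath vs es ∧ es ≠ [] ∧ C = {e | e ∈ es} ∧
    (∀ v ∈ vs, v = r ∨ 2 ≤ G.deg Hb v) ∧
    (∀ v, vs.head? = some v → v = r ∨ v ∈ G.vertsOf H) ∧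
    (∀ v, vs.getLast? = some v → v = r ∨ v ∈ G.vertsOf H) ∧
    (∀ v ∈ vs, vs.head? ≠ some v → vs.getLast? ≠ some v → v ≠ r ∧ v ∉ G.vertsOf H)

/-- A minimal up chain: an up chain none of whose internal vertices lies in
`{r} ∪ V(H)`. -/
def IsMinimalUpChain (r : G.V) (H Hb C : Set G.E) : Prop :=
  G.IsMinimalOpenUpChain r H Hb C ∨
  ∃ v, G.IsClosedUpChain r H Hb C v ∧
    ∀ u ∈ G.vertsOf C, u ≠ v → u ≠ r ∧ u ∉ G.vertsOf H

/-- A minimal down chain: a down chain none of whose internal vertices lies in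
`{r} ∪ V(Hb)`. -/
def IsMinimalDownChain (r : G.V) (H Hb C : Set G.E) : Prop :=
  G.IsMinimalUpChain r Hb H C

/-- A minimal chain decomposition (of the part of `G` with edge set `F`):
a chain decomposition all of whose up chains and down chains are minimal. -/
def IsMinimalChainDecompOn (F : Set G.E) (r : G.V) {n : ℕ} (Gs : Fin n → Set G.E) : Prop :=
  G.IsChainDecompOn F r Gs ∧
  ∀ i, G.IsMinimalUpChain r (G.before Gs i) (G.after Gs i) (Gs i) ∨
       G.IsMinimalDownChain r (G.before Gs i) (G.after Gs i) (Gs i) ∨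
       G.IsOneWayChain r (G.before Gs i) (G.after Gs i) (Gs i)

/-- A minimal chain decomposition of `G` rooted at `r`. -/
def IsMinimalChainDecomp (r : G.V) {n : ℕ} (Gs : Fin n → Set G.E) : Prop :=
  G.IsMinimalChainDecompOn Set.univ r Gs

/-! ### Subgraphs, trees and edge-independence -/

/-- A subgraph of `G`: a set of vertices together with a set of edges all of whose
endpoints lie in the vertex set. -/
structure Sub (G : MG) where
  verts : Set G.V
  edges : Set G.E
  valid : ∀ e ∈ edges, ∀ v ∈ G.ends e, v ∈ verts

/-- A subgraph is connected. -/
def Sub.Connected {G : MG} (T : Sub G) : Prop :=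
  T.verts.Nonempty ∧ ∀ a ∈ T.verts, ∀ b ∈ T.verts,
    Relation.ReflTransGen (fun x y => ∃ e ∈ T.edges, G.ends e = s(x, y)) a b

/-- A subgraph is a tree: connected and containing no cycle. -/
def Sub.IsTree {G : MG} (T : Sub G) : Prop :=
  T.Connected ∧ ¬ ∃ v vs es, G.IsCycle v vs es ∧ ∀ e ∈ es, e ∈ T.edges

/-- A subgraph is spanning. -/
def Sub.Spanning {G : MG} (T : Sub G) : Prop := T.verts = Set.univ

/-- `vs, es` is a path from `a` to `b` all of whose edges lie in the subgraph `T`. -/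
def Sub.PathIn {G : MG} (T : Sub G) (a b : G.V) (vs : List G.V) (es : List G.E) : Prop :=
  G.IsPath vs es ∧ vs.head? = some a ∧ vs.getLast? = some b ∧ ∀ e ∈ es, e ∈ T.edges

/-- Two subtrees of `G` are edge-independent with root `r`: each contains `r`, and for
every common vertex `v`, the path between `r` and `v` in one tree is edge-disjoint from
the path between `r` and `v` in the other. -/
def EdgeIndependent (r : G.V) (T₁ T₂ : Sub G) : Prop :=
  r ∈ T₁.verts ∧ r ∈ T₂.verts ∧
  ∀ v ∈ T₁.verts ∩ T₂.verts, ∀ vs₁ es₁ vs₂ es₂,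
    T₁.PathIn r v vs₁ es₁ → T₂.PathIn r v vs₂ es₂ → ∀ e ∈ es₁, e ∉ es₂

/-- `G` has a set of four edge-independent spanning trees rooted at `r`. -/
def HasFourEIST (r : G.V) : Prop :=
  ∃ T : Fin 4 → Sub G, (∀ i, (T i).IsTree ∧ (T i).Spanning) ∧
    ∀ i j, i ≠ j → G.EdgeIndependent r (T i) (T j)

/-! ### Mader operations -/

/-- Add to `G` a new edge with the (not necessarily distinct) endpoints `p`. -/
def addEdge (p : Sym2 G.V) : MG :=
  ⟨G.V, Option G.E, fun e => e.elim p G.ends⟩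

/-- Pinch the two distinct edges `e₁` (with ends `x`, `y`) and `e₂` (with ends `z`, `w`):
delete `e₁` and `e₂`, add a new vertex (`none`), and add four new edges joining the new
vertex to `x`, `y`, `z`, `w` respectively. -/
def pinch (e₁ e₂ : G.E) (x y z w : G.V) : MG where
  V := Option G.V
  E := {e : G.E // e ≠ e₁ ∧ e ≠ e₂} ⊕ Fin 4
  ends := fun e =>
    Sum.elim (fun e' => (G.ends e'.1).map some)
      (fun i =>
        if i = 0 then s((none : Option G.V), some x)
        else if i = 1 then s((none : Option G.V), some y)
        else if i = 2 then s((none : Option G.V), some z)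
        else s((none : Option G.V), some w)) e

end MG

/-- A multigraph with a distinguished root vertex. -/
structure PMG : Type 1 where
  G : MG
  r : G.V

/-- A single Mader operation on a rooted multigraph: either add an edge, or pinch two
distinct edges. -/
inductive MaderStep : PMG → PMG → Prop
  | addEdge (P : PMG) (p : Sym2 P.G.V) : MaderStep P ⟨P.G.addEdge p, P.r⟩
  | pinch (P : PMG) (e₁ e₂ : P.G.E) (x y z w : P.G.V) (hne : e₁ ≠ e₂)
      (h₁ : P.G.ends e₁ = s(x, y)) (h₂ : P.G.ends e₂ = s(z, w)) :
      MaderStep P ⟨P.G.pinch e₁ e₂ x y z w, some P.r⟩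

/-- The starting graph `G⁰` of the Mader construction: two vertices joined by four
parallel edges, rooted at one of them. -/
def basePMG : PMG :=
  ⟨⟨Bool, Fin 4, fun _ => s(false, true)⟩, false⟩

/-- An isomorphism of rooted multigraphs: bijections on vertices and edges commuting
with the endpoint maps and sending root to root. -/
def PIso (P Q : PMG) : Prop :=
  ∃ (fV : P.G.V ≃ Q.G.V) (fE : P.G.E ≃ Q.G.E),
    (∀ e, Q.G.ends (fE e) = (P.G.ends e).map fV) ∧ fV P.r = Q.r

/-- `G`, rooted at `r`, can be built from `basePMG` by repeatedly performing
Mader operations. -/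
def MaderConstructible (G : MG) (r : G.V) : Prop :=
  ∃ Q : PMG, Relation.ReflTransGen MaderStep basePMG Q ∧ PIso Q ⟨G, r⟩

namespace Chains

variable {V : Type*}

/-- The edges traversed by a walk. -/
def walkEdges : List V → List (Sym2 V)
  | a :: b :: l => s(a, b) :: walkEdges (b :: l)
  | _ => []

@[simp] lemma walkEdges_nil : walkEdges ([] : List V) = [] := rfl
@[simp] lemma walkEdges_single (a : V) : walkEdges [a] = [] := rfl
@[simp] lemma walkEdges_cons_cons (a b : V) (l : List V) :
    walkEdges (a :: b :: l) = s(a, b) :: walkEdges (b :: l) := rfl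

lemma walkEdges_append (l₁ : List V) (x : V) (l₂ : List V) :
    walkEdges (l₁ ++ x :: l₂) = walkEdges (l₁ ++ [x]) ++ walkEdges (x :: l₂) := by
  induction l₁ with
  | nil => simp
  | cons a l ih => cases l <;> simp_all

lemma walkEdges_append_cons_cons (l₁ : List V) (x y : V) (l₂ : List V) :
    walkEdges (l₁ ++ x :: y :: l₂) =
      walkEdges (l₁ ++ [x]) ++ s(x, y) :: walkEdges (y :: l₂) := by
  rw [walkEdges_append]; rfl

lemma walkEdges_reverse (l : List V) : walkEdges l.reverse = (walkEdges l).reverse := by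
  induction l with
  | nil => simp
  | cons a l ih =>
    cases l with
    | nil => simp
    | cons b l =>
      simp only [List.reverse_cons, walkEdges_cons_cons] at ih ⊢
      rw [List.append_assoc, List.singleton_append, walkEdges_append, ih]
      simp [Sym2.eq_swap]

lemma mem_of_mem_walkEdges {l : List V} {e : Sym2 V} (he : e ∈ walkEdges l) {v : V}
    (hv : v ∈ e) : v ∈ l := by
  induction l with
  | nil => simp at he
  | cons a l ih =>
    cases l with
    | nil => simp at he
    | cons b l =>
      simp only [walkEdges_cons_cons, List.mem_cons] at he
      rcases he with rfl | he
      · simp at hv; rcases hv with rfl | rfl <;> simp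
      · exact List.mem_cons_of_mem _ (ih he)

lemma exists_split_of_mem_walkEdges {l : List V} {e : Sym2 V} (he : e ∈ walkEdges l) :
    ∃ l₁ x y l₂, l = l₁ ++ x :: y :: l₂ ∧ e = s(x, y) := by
  induction l with
  | nil => simp at he
  | cons a l ih =>
    cases l with
    | nil => simp at he
    | cons b l =>
      simp only [walkEdges_cons_cons, List.mem_cons] at he
      rcases he with rfl | he
      · exact ⟨[], a, b, l, rfl, rfl⟩
      · obtain ⟨l₁, x, y, l₂, h, rfl⟩ := ih he
        exact ⟨a :: l₁, x, y, l₂, by simp [h], rfl⟩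

/-- A chain given by the vertices it traverses. -/
inductive Chain (V : Type*)
  | up (l : List V)
  | down (l : List V)
  | oneWay (u v : V)

namespace Chain

/-- The vertices of a chain. -/
def verts : Chain V → List V
  | up l => l
  | down l => l
  | oneWay u v => [u, v]

/-- The edges of a chain. -/
def edges : Chain V → List (Sym2 V)
  | up l => walkEdges l
  | down l => walkEdges l
  | oneWay u v => [s(u, v)]

/-- Exchange the roles of up and down. -/
def flip : Chain V → Chain V
  | up l => down l
  | down l => up l
  | oneWay u v => oneWay v u

/-- Validity of a chain with respect to degree functions below (`h`) and above (`b`). -/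
def Ok (h b : V → ℕ) : Chain V → Prop
  | up l => l.Nodup ∧ (∀ v ∈ l, 2 ≤ b v) ∧ (∀ v ∈ l.head?, 1 ≤ h v) ∧ ∀ v ∈ l.getLast?, 1 ≤ h v
  | down l => l.Nodup ∧ (∀ v ∈ l, 2 ≤ h v) ∧ (∀ v ∈ l.head?, 1 ≤ b v) ∧ ∀ v ∈ l.getLast?, 1 ≤ b v
  | oneWay u v => 2 ≤ h u ∧ 2 ≤ b v

@[simp] lemma edges_up (l : List V) : (up l).edges = walkEdges l := rfl
@[simp] lemma edges_down (l : List V) : (down l).edges = walkEdges l := rfl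
@[simp] lemma edges_oneWay (u v : V) : (oneWay u v).edges = [s(u, v)] := rfl
@[simp] lemma verts_up (l : List V) : (up l).verts = l := rfl
@[simp] lemma verts_down (l : List V) : (down l).verts = l := rfl
@[simp] lemma verts_oneWay (u v : V) : (oneWay u v).verts = [u, v] := rfl

@[simp] lemma flip_flip (c : Chain V) : c.flip.flip = c := by cases c <;> rfl

@[simp] lemma edges_flip (c : Chain V) : c.flip.edges = c.edges := by
  cases c <;> simp [flip, edges, Sym2.eq_swap]

lemma mem_verts_flip (c : Chain V) (v : V) : v ∈ c.flip.verts ↔ v ∈ c.verts := by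
  cases c <;> simp [flip, verts, or_comm]

lemma ok_up_reverse {h b : V → ℕ} {l : List V} : (up l.reverse).Ok h b ↔ (up l).Ok h b := by
  simp [Ok, and_comm]

lemma ok_flip {h b : V → ℕ} {c : Chain V} : c.flip.Ok b h ↔ c.Ok h b := by
  cases c <;> simp [flip, Ok, and_comm]

lemma mem_verts_of_mem_edges {c : Chain V} {e : Sym2 V} (he : e ∈ c.edges) {v : V}
    (hv : v ∈ e) : v ∈ c.verts := by
  cases c with
  | up l => exact mem_of_mem_walkEdges he hv
  | down l => exact mem_of_mem_walkEdges he hv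
  | oneWay a b => simp_all

lemma Ok.mono {h b h' b' : V → ℕ} {c : Chain V} (hc : c.Ok h b)
    (hh : ∀ v ∈ c.verts, min 2 (h v) ≤ h' v) (hb : ∀ v ∈ c.verts, min 2 (b v) ≤ b' v) :
    c.Ok h' b' := by
  cases c with
  | up l =>
    obtain ⟨h1, h2, h3, h4⟩ := hc
    refine ⟨h1, fun v hv => ?_, fun v hv => ?_, fun v hv => ?_⟩
    · have := h2 v hv; have := hb v hv; omega
    · have := h3 v hv; have := hh v (List.mem_of_mem_head? hv); omega
    · have := h4 v hv; have := hh v (List.mem_of_mem_getLast? hv); omega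
  | down l =>
    obtain ⟨h1, h2, h3, h4⟩ := hc
    refine ⟨h1, fun v hv => ?_, fun v hv => ?_, fun v hv => ?_⟩
    · have := h2 v hv; have := hh v hv; omega
    · have := h3 v hv; have := hb v (List.mem_of_mem_head? hv); omega
    · have := h4 v hv; have := hb v (List.mem_of_mem_getLast? hv); omega
  | oneWay u w =>
    obtain ⟨h1, h2⟩ := hc
    have := hh u (by simp); have := hb w (by simp)
    exact ⟨by omega, by omega⟩

end Chain

open Chain

/-- The multiset of all edges of a list of chains. -/
def total : List (Chain V) → Multiset (Sym2 V)
  | [] => 0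
  | c :: D => (c.edges : Multiset (Sym2 V)) + total D

@[simp] lemma total_nil : total ([] : List (Chain V)) = 0 := rfl
@[simp] lemma total_cons (c : Chain V) (D : List (Chain V)) :
    total (c :: D) = (c.edges : Multiset (Sym2 V)) + total D := rfl
@[simp] lemma total_append (D E : List (Chain V)) : total (D ++ E) = total D + total E := by
  induction D with
  | nil => simp
  | cons c D ih => simp [ih, add_assoc]

lemma mem_total {D : List (Chain V)} {e : Sym2 V} : e ∈ total D ↔ ∃ c ∈ D, e ∈ c.edges := by
  induction D with
  | nil => simp
  | cons c D ih => simp [ih]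

/-- Reverse a list of chains, exchanging up and down. -/
def flips (D : List (Chain V)) : List (Chain V) := (D.map Chain.flip).reverse

@[simp] lemma flips_cons (c : Chain V) (D : List (Chain V)) :
    flips (c :: D) = flips D ++ [c.flip] := by simp [flips]
@[simp] lemma flips_append (D E : List (Chain V)) : flips (D ++ E) = flips E ++ flips D := by
  simp [flips]
@[simp] lemma flips_nil : flips ([] : List (Chain V)) = [] := rfl
@[simp] lemma flips_flips (D : List (Chain V)) : flips (flips D) = D := by
  simp [flips, List.map_reverse, Function.comp_def]

@[simp] lemma total_flips (D : List (Chain V)) : total (flips D) = total D := by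
  induction D with
  | nil => simp
  | cons c D ih => simp [ih, add_comm]

/-- The vertex `t` does not occur in `D`. -/
def Fresh (t : V) (D : List (Chain V)) : Prop := ∀ c ∈ D, t ∉ c.verts

@[simp] lemma fresh_nil (t : V) : Fresh t [] := by simp [Fresh]
@[simp] lemma fresh_cons {t : V} {c : Chain V} {D : List (Chain V)} :
    Fresh t (c :: D) ↔ t ∉ c.verts ∧ Fresh t D := by simp [Fresh]
@[simp] lemma fresh_append {t : V} {D E : List (Chain V)} :
    Fresh t (D ++ E) ↔ Fresh t D ∧ Fresh t E := by
  simp [Fresh, or_imp, forall_and]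
@[simp] lemma fresh_flips {t : V} {D : List (Chain V)} : Fresh t (flips D) ↔ Fresh t D := by
  simp [Fresh, flips, mem_verts_flip]

/-- The two edges obtained by subdividing `e` with the vertex `t`. -/
def star (t : V) : Sym2 V → Multiset (Sym2 V) :=
  Sym2.lift ⟨fun a b => {s(t, a), s(t, b)}, fun _ _ => Multiset.pair_comm _ _⟩

@[simp] lemma star_mk (t a b : V) : star t s(a, b) = {s(t, a), s(t, b)} := rfl

variable [DecidableEq V]

/-- The number of times `v` occurs as an end of an edge. -/
def endCount (v : V) : Sym2 V → ℕ :=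
  Sym2.lift ⟨fun a b => (if v = a then 1 else 0) + (if v = b then 1 else 0),
    fun _ _ => add_comm _ _⟩

@[simp] lemma endCount_mk (v a b : V) :
    endCount v s(a, b) = (if v = a then 1 else 0) + (if v = b then 1 else 0) := rfl

/-- The degree of `v` in a multiset of edges. -/
def mdeg (M : Multiset (Sym2 V)) (v : V) : ℕ := (M.map (endCount v)).sum

@[simp] lemma mdeg_zero (v : V) : mdeg (0 : Multiset (Sym2 V)) v = 0 := rfl

@[simp] lemma mdeg_add (M N : Multiset (Sym2 V)) (v : V) :
    mdeg (M + N) v = mdeg M v + mdeg N v := by simp [mdeg]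

@[simp] lemma mdeg_cons (e : Sym2 V) (M : Multiset (Sym2 V)) (v : V) :
    mdeg (e ::ₘ M) v = endCount v e + mdeg M v := by simp [mdeg]

@[simp] lemma mdeg_singleton (e : Sym2 V) (v : V) :
    mdeg {e} v = endCount v e := by simp [mdeg]

/-- A chain decomposition relative to ambient degree functions. -/
def Dec (h b : V → ℕ) : List (Chain V) → Prop
  | [] => True
  | c :: D => c.Ok h (fun v => b v + mdeg (total D) v) ∧
      Dec (fun v => h v + mdeg (c.edges : Multiset (Sym2 V)) v) b D

@[simp] lemma dec_nil (h b : V → ℕ) : Dec h b [] := trivial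
lemma dec_cons {h b : V → ℕ} {c : Chain V} {D : List (Chain V)} :
    Dec h b (c :: D) ↔ c.Ok h (fun v => b v + mdeg (total D) v) ∧
      Dec (fun v => h v + mdeg (c.edges : Multiset (Sym2 V)) v) b D := Iff.rfl

lemma dec_append {h b : V → ℕ} {D E : List (Chain V)} :
    Dec h b (D ++ E) ↔ Dec h (fun v => b v + mdeg (total E) v) D ∧
      Dec (fun v => h v + mdeg (total D) v) b E := by
  induction D generalizing h with
  | nil => simp
  | cons c D ih =>
    simp only [List.cons_append, dec_cons, ih, total_append, mdeg_add, total_cons, ← add_assoc,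
      and_assoc]
    simp only [add_comm, add_left_comm]

lemma Dec.mono {h b h' b' : V → ℕ} {D : List (Chain V)} (hD : Dec h b D)
    (hh : ∀ c ∈ D, ∀ v ∈ c.verts, min 2 (h v) ≤ h' v)
    (hb : ∀ c ∈ D, ∀ v ∈ c.verts, min 2 (b v) ≤ b' v) : Dec h' b' D := by
  induction D generalizing h h' with
  | nil => trivial
  | cons c D ih =>
    rw [dec_cons] at hD ⊢
    refine ⟨hD.1.mono (hh c (by simp)) fun v hv => ?_, ih hD.2 (fun d hd v hv => ?_)
      fun d hd => hb d (by simp [hd])⟩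
    · have := hb c (by simp) v hv; omega
    · have := hh d (by simp [hd]) v hv; omega

lemma Dec.mono_le {h b h' b' : V → ℕ} {D : List (Chain V)} (hD : Dec h b D)
    (hh : ∀ v, h v ≤ h' v) (hb : ∀ v, b v ≤ b' v) : Dec h' b' D :=
  hD.mono (fun _ _ v _ => by have := hh v; omega) (fun _ _ v _ => by have := hb v; omega)

lemma Dec.flip {h b : V → ℕ} {D : List (Chain V)} (hD : Dec h b D) : Dec b h (flips D) := by
  induction D generalizing h with
  | nil => trivial
  | cons c D ih =>
    rw [dec_cons] at hD
    rw [flips_cons, dec_append, dec_cons]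
    refine ⟨by simpa using ih hD.2, ?_, trivial⟩
    simpa [ok_flip] using hD.1

lemma endCount_eq_zero {v : V} {e : Sym2 V} (h : v ∉ e) : endCount v e = 0 := by
  induction e with | _ a b => simp_all

lemma mdeg_eq_zero {v : V} {M : Multiset (Sym2 V)} (h : ∀ e ∈ M, v ∉ e) : mdeg M v = 0 := by
  induction M using Multiset.induction_on with
  | empty => rfl
  | cons e M ih =>
    rw [mdeg_cons, endCount_eq_zero (h e (by simp)), ih fun e he => h e (by simp [he])]

lemma Fresh.mdeg_eq_zero {t : V} {D : List (Chain V)} (h : Fresh t D) :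
    mdeg (total D) t = 0 := by
  refine Chains.mdeg_eq_zero fun e he hte => ?_
  obtain ⟨c, hc, hec⟩ := mem_total.1 he
  exact h c hc (mem_verts_of_mem_edges hec hte)

lemma endCount_le_mdeg_star (t : V) (e : Sym2 V) (v : V) : endCount v e ≤ mdeg (star t e) v := by
  induction e with | _ a b =>
  simp [Multiset.insert_eq_cons]; omega

lemma two_le_mdeg_star (t : V) (e : Sym2 V) : 2 ≤ mdeg (star t e) t := by
  induction e with | _ a b =>
  simp [Multiset.insert_eq_cons]; omega

/-- Every vertex touched by a decomposition has a position with two edge ends on each side. -/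
lemma Dec.exists_split {h b : V → ℕ} {D : List (Chain V)} (hD : Dec h b D) {v : V}
    (hh : h v < 2) (hb : b v = 0) (hv : 0 < mdeg (total D) v) :
    ∃ A B, D = A ++ B ∧ 2 ≤ h v + mdeg (total A) v ∧ 2 ≤ b v + mdeg (total B) v := by
  induction D generalizing h with
  | nil => simp at hv
  | cons c D ih =>
    rw [dec_cons] at hD
    by_cases hc : v ∈ c.verts
    · have h2 : 2 ≤ b v + mdeg (total D) v := by
        cases c with
        | up l => exact hD.1.2.1 v hc
        | down l => have := hD.1.2.1 v hc; omega
        | oneWay x y =>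
          have := hD.1.1; have := hD.1.2
          simp at hc; rcases hc with rfl | rfl <;> omega
      by_cases h3 : 2 ≤ h v + mdeg (c.edges : Multiset (Sym2 V)) v
      · exact ⟨[c], D, rfl, by simpa using h3, h2⟩
      · obtain ⟨A, B, rfl, hA, hB⟩ := ih hD.2 (by omega) (by omega)
        exact ⟨c :: A, B, rfl, by simpa [add_assoc] using hA, hB⟩
    · have h0 : mdeg (c.edges : Multiset (Sym2 V)) v = 0 :=
        Chains.mdeg_eq_zero fun e he hve => hc (mem_verts_of_mem_edges (by simpa using he) hve)
      obtain ⟨A, B, rfl, hA, hB⟩ := ih hD.2 (by omega) (by simpa [h0] using hv)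
      exact ⟨c :: A, B, rfl, by simpa [add_assoc] using hA, hB⟩

lemma Dec.insert_oneWay {h b : V → ℕ} {A B : List (Chain V)} (hD : Dec h b (A ++ B)) {u v : V}
    (hu : 2 ≤ h u + mdeg (total A) u) (hv : 2 ≤ b v + mdeg (total B) v) :
    Dec h b (A ++ oneWay u v :: B) := by
  rw [dec_append] at hD ⊢
  rw [dec_cons]
  exact ⟨hD.1.mono_le (fun _ => le_rfl) fun v => by simp, ⟨hu, hv⟩,
    hD.2.mono_le (fun _ => by simp) fun v => le_rfl⟩

/-- A new edge can be added to a decomposition when both ends have a splitting position. -/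
lemma Dec.add_edge {h b : V → ℕ} {D : List (Chain V)} (hD : Dec h b D) {u v : V}
    (hu : ∃ A B, D = A ++ B ∧ 2 ≤ h u + mdeg (total A) u ∧ 2 ≤ b u + mdeg (total B) u)
    (hv : ∃ A B, D = A ++ B ∧ 2 ≤ h v + mdeg (total A) v ∧ 2 ≤ b v + mdeg (total B) v) :
    ∃ D', Dec h b D' ∧ total D' = s(u, v) ::ₘ total D := by
  obtain ⟨A, B, rfl, h1, h2⟩ := hu
  obtain ⟨A', B', hAB, h3, h4⟩ := hv
  rcases List.append_eq_append_iff.1 hAB with ⟨C, rfl, rfl⟩ | ⟨C, rfl, rfl⟩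
  · refine ⟨A ++ C ++ oneWay u v :: B', ?_, ?_⟩
    · apply Dec.insert_oneWay
      · simpa using hD
      · simp; omega
      · exact h4
    · simp [← Multiset.singleton_add]; abel
  · refine ⟨A' ++ C ++ oneWay v u :: B, ?_, ?_⟩
    · apply Dec.insert_oneWay
      · simpa using hD
      · simp; omega
      · exact h2
    · simp [← Multiset.singleton_add, Sym2.eq_swap (a := v)]; abel

end Chains

namespace Chains

open Chain
variable {V : Type*}

lemma not_mem_edge {t : V} {D : List (Chain V)} (hf : Fresh t D) {e : Sym2 V}
    (he : e ∈ total D) : t ∉ e := by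
  obtain ⟨c, hc, hec⟩ := mem_total.1 he
  exact fun h => hf c hc (mem_verts_of_mem_edges hec h)

lemma coe_walkEdges_subdivide (t : V) (l₁ : List V) (x y : V) (l₂ : List V) :
    (walkEdges (l₁ ++ x :: t :: y :: l₂) : Multiset (Sym2 V)) + {s(x, y)} =
      walkEdges (l₁ ++ x :: y :: l₂) + star t s(x, y) := by
  rw [walkEdges_append_cons_cons, walkEdges_cons_cons, walkEdges_append_cons_cons]
  simp [← Multiset.coe_add, ← Multiset.cons_coe, ← Multiset.singleton_add,
    Multiset.insert_eq_cons, Sym2.eq_swap (a := x) (b := t)]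
  abel

lemma ok_down_prefix {h b b' : V → ℕ} {l₁ : List V} {x : V} {l₂ : List V}
    (hc : (down (l₁ ++ x :: l₂)).Ok h b) (hb : ∀ v, b v ≤ b' v) (hx : 1 ≤ b' x) :
    (down (l₁ ++ [x])).Ok h b' := by
  obtain ⟨h1, h2, h3, h4⟩ := hc
  refine ⟨?_, fun v hv => h2 v ?_, fun v hv => ?_, fun v hv => ?_⟩
  · refine h1.sublist ?_
    simp
  · simp at hv ⊢; tauto
  · cases l₁ with
    | nil => simp at hv; subst hv; exact hx
    | cons a l => exact (h3 v (by simpa using hv)).trans (hb v)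
  · simp at hv; subst hv; exact hx

lemma ok_down_suffix {h b b' : V → ℕ} {l₁ : List V} {x : V} {l₂ : List V}
    (hc : (down (l₁ ++ x :: l₂)).Ok h b) (hb : ∀ v, b v ≤ b' v) (hx : 1 ≤ b' x) :
    (down (x :: l₂)).Ok h b' := by
  obtain ⟨h1, h2, h3, h4⟩ := hc
  refine ⟨?_, fun v hv => h2 v ?_, fun v hv => ?_, fun v hv => ?_⟩
  · refine h1.sublist ?_
    simp
  · simp at hv ⊢; tauto
  · simp at hv; subst hv; exact hx
  · exact (h4 v (by simpa [List.getLast?_append] using hv)).trans (hb v)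

variable [DecidableEq V]

/-- `P'` arises from `P` by subdividing the edge `e` with the new vertex `t`, and is valid as soon
as `t` has degree at least two above. -/
def LowSub (t : V) (h b : V → ℕ) (P P' : List (Chain V)) (e : Sym2 V) : Prop :=
  (∀ b' : V → ℕ, (∀ v, b v ≤ b' v) → 2 ≤ b' t → Dec h b' P') ∧
    total P' + {e} = total P + star t e

/-- Combining a lower and an upper subdivision. -/
lemma Dec.subdivide_two {h b : V → ℕ} {t : V} {A P B Q C P' Q' : List (Chain V)} {e f : Sym2 V}
    (hD : Dec h b (A ++ P ++ B ++ Q ++ C))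
    (hte : t ∉ e) (htf : t ∉ f)
    (hP : LowSub t (fun v => h v + mdeg (total A) v)
      (fun v => b v + mdeg (total (B ++ Q ++ C)) v) P P' e)
    (hQ : LowSub t (fun v => b v + mdeg (total C) v)
      (fun v => h v + mdeg (total (A ++ P ++ B)) v) (flips Q) Q' f) :
    ∃ D', Dec h b D' ∧
      total D' + {e} + {f} = total (A ++ P ++ B ++ Q ++ C) + star t e + star t f := by
  have hPd : ∀ v, mdeg (total P') v + endCount v e = mdeg (total P) v + mdeg (star t e) v := by
    intro v
    simpa using congrArg (fun M => mdeg M v) hP.2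
  have hQd : ∀ v, mdeg (total Q') v + endCount v f = mdeg (total Q) v + mdeg (star t f) v := by
    intro v
    simpa using congrArg (fun M => mdeg M v) hQ.2
  have he0 := endCount_eq_zero hte
  have hf0 := endCount_eq_zero htf
  have he2 := two_le_mdeg_star t e
  have hf2 := two_le_mdeg_star t f
  refine ⟨A ++ P' ++ B ++ flips Q' ++ C, ?_, ?_⟩
  · simp only [dec_append, total_append, mdeg_add] at hD ⊢
    obtain ⟨⟨⟨⟨hA, hP0⟩, hB⟩, hQ0⟩, hC⟩ := hD
    have l1 := fun v => endCount_le_mdeg_star t e v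
    have l2 := fun v => endCount_le_mdeg_star t f v
    refine ⟨⟨⟨⟨hA.mono_le (fun _ => le_rfl) fun v => ?_, hP.1 _ (fun v => ?_) ?_⟩,
      hB.mono_le (fun v => ?_) fun v => ?_⟩, ?_⟩, hC.mono_le (fun v => ?_) fun v => le_rfl⟩
    · have := hPd v; have := hQd v; have := l1 v; have := l2 v; simp; omega
    · have := hQd v; have := l2 v; simp; omega
    · have := hQd t; simp; omega
    · have := hPd v; have := l1 v; simp; omega
    · have := hQd v; have := l2 v; simp; omega
    · refine (hQ.1 _ (fun v => ?_) ?_).flip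
      · have := hPd v; have := l1 v; simp; omega
      · have := hPd t; simp; omega
    · have := hPd v; have := hQd v; have := l1 v; have := l2 v; simp; omega
  · have h1 := hP.2
    have h2 := hQ.2
    simp only [total_append, total_flips] at h2 ⊢
    calc _ = total A + (total P' + {e}) + total B + (total Q' + {f}) + total C := by abel
      _ = _ := by rw [h1, h2]; abel

lemma lowSub_up {h b : V → ℕ} {t : V} {l : List V} {e : Sym2 V} (hc : (up l).Ok h b)
    (ht : t ∉ l) (he : e ∈ walkEdges l) : ∃ P', LowSub t h b [up l] P' e := by
  obtain ⟨l₁, x, y, l₂, rfl, rfl⟩ := exists_split_of_mem_walkEdges he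
  refine ⟨[up (l₁ ++ x :: t :: y :: l₂)], fun b' hb hbt => ?_, ?_⟩
  · obtain ⟨h1, h2, h3, h4⟩ := hc
    refine ⟨⟨?_, fun v hv => ?_, fun v hv => ?_, fun v hv => ?_⟩, trivial⟩
    · rw [List.nodup_append] at h1 ⊢
      simp only [List.nodup_cons, List.mem_append, List.mem_cons] at h1 ht ⊢
      grind
    · by_cases hvt : v = t
      · subst hvt; simp; omega
      · have := h2 v (by simp_all); have := hb v; simp; omega
    · apply h3; cases l₁ <;> simp_all
    · apply h4; simp_all [List.getLast?_append, List.getLast?_cons_cons]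
  · simpa using coe_walkEdges_subdivide t l₁ x y l₂

lemma lowSub_down {h b : V → ℕ} {t : V} {l : List V} {e : Sym2 V} (hc : (down l).Ok h b)
    (he : e ∈ walkEdges l) : ∃ P', LowSub t h b [down l] P' e := by
  obtain ⟨l₁, x, y, l₂, rfl, rfl⟩ := exists_split_of_mem_walkEdges he
  refine ⟨[down (l₁ ++ [x]), down (y :: l₂), oneWay x t, oneWay y t], fun b' hb hbt => ?_, ?_⟩
  · have hx : 2 ≤ h x := hc.2.1 x (by simp)
    have hy : 2 ≤ h y := hc.2.1 y (by simp)
    refine ⟨ok_down_prefix hc (fun v => (hb v).trans (by simp)) ?_,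
      (ok_down_suffix (l₁ := l₁ ++ [x]) (b := b)
        (b' := fun v => b' v + mdeg (total [oneWay x t, oneWay y t]) v) (by simpa using hc)
        (fun v => (hb v).trans (by simp)) ?_).mono
        (fun v _ => by omega) (fun v _ => by omega), ⟨?_, ?_⟩, ⟨?_, ?_⟩, trivial⟩
    · simp; omega
    · simp; omega
    · simp; omega
    · simp; omega
    · simp; omega
    · simp; omega
  · simp [walkEdges_append_cons_cons, ← Multiset.coe_add, ← Multiset.cons_coe,
      ← Multiset.singleton_add, Multiset.insert_eq_cons, Sym2.eq_swap (a := t)]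
    abel

lemma lowSub_oneWay {h b : V → ℕ} {t u v : V} (hc : (oneWay u v).Ok h b) (hv : 1 ≤ h v)
    (ht : t ≠ v) : ∃ P', LowSub t h b [oneWay u v] P' s(u, v) := by
  refine ⟨[oneWay u t, up [t, v]], fun b' hb hbt => ?_, ?_⟩
  · have h1 := hc.1
    have h2 := hc.2
    have := hb v
    refine ⟨⟨h1, by simp; omega⟩, ⟨?_, ?_, ?_, ?_⟩, trivial⟩
    · simpa using ht
    · simp; omega
    · simp; omega
    · simp; omega
  · simp [← Multiset.singleton_add, Multiset.insert_eq_cons, Sym2.eq_swap (a := t) (b := u)]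
    abel

lemma lowSub_oneWay_up_head {h b : V → ℕ} {t u v : V} {l : List V} (hu : 2 ≤ h u)
    (hc : (up (v :: l)).Ok (fun w => h w + mdeg {s(u, v)} w) b) (ht : t ∉ v :: l)
    (hl : l ≠ []) : ∃ P', LowSub t h b [oneWay u v, up (v :: l)] P' s(u, v) := by
  obtain ⟨h1, h2, h3, h4⟩ := hc
  refine ⟨[oneWay u t, up (t :: v :: l)], fun b' hb hbt => ?_, ?_⟩
  · refine ⟨⟨hu, by simp; omega⟩, ⟨?_, fun w hw => ?_, fun w hw => ?_, fun w hw => ?_⟩, trivial⟩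
    · exact List.nodup_cons.2 ⟨ht, h1⟩
    · rcases List.mem_cons.1 hw with rfl | hw
      · simpa using hbt
      · have := h2 w hw; have := hb w; simp; omega
    · simp at hw; subst hw; simp; omega
    · obtain ⟨a, l, rfl⟩ := List.exists_cons_of_ne_nil hl
      rw [List.getLast?_cons_cons] at hw
      have hw1 := h4 w hw
      rw [List.getLast?_cons_cons] at hw
      have hwv : w ≠ v := by
        rintro rfl
        exact (List.nodup_cons.1 h1).1 (List.mem_of_mem_getLast? hw)
      by_cases hwu : w = u
      · subst hwu; simp; omega
      · simp [hwv, hwu] at hw1; simp; omega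
  · simp [← Multiset.singleton_add, ← Multiset.cons_coe, Multiset.insert_eq_cons,
      Sym2.eq_swap (a := t) (b := u)]
    abel

/-- Subdividing a one-way edge whose head is an end of the following up chain. -/
lemma lowSub_oneWay_up {h b : V → ℕ} {t u v : V} {l : List V} (hu : 2 ≤ h u)
    (hc : (up l).Ok (fun w => h w + mdeg {s(u, v)} w) b) (ht : t ∉ l) (hl : 2 ≤ l.length)
    (hv : l.head? = some v ∨ l.getLast? = some v) :
    ∃ P', LowSub t h b [oneWay u v, up l] P' s(u, v) := by
  rcases hv with hv | hv
  · obtain ⟨l, rfl⟩ : ∃ l', l = v :: l' := by cases l <;> simp_all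
    exact lowSub_oneWay_up_head hu hc ht (by rintro rfl; simp at hl)
  · obtain ⟨l', hl'⟩ : ∃ l', l.reverse = v :: l' := by
      rw [← List.head?_reverse] at hv
      cases h : l.reverse <;> simp_all
    obtain ⟨P', hP, hP2⟩ := lowSub_oneWay_up_head (t := t) (l := l') hu
      (hl' ▸ ok_up_reverse.2 hc) (by rw [← hl']; simpa using ht)
      (by rintro rfl; have := congrArg List.length hl'; simp at this; omega)
    refine ⟨P', hP, hP2.trans ?_⟩
    rw [← hl']
    simp [walkEdges_reverse]

end Chains

namespace Chains

open Chain
variable {V : Type*}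

lemma total_perm {D E : List (Chain V)} (h : D.Perm E) : total D = total E := by
  induction h with
  | nil => rfl
  | cons c _ ih => simp [ih]
  | swap c d D => simp only [total_cons]; abel
  | trans _ _ h1 h2 => rw [h1, h2]

variable [DecidableEq V]

@[simp] lemma mdeg_coe_append (l₁ l₂ : List (Sym2 V)) (v : V) :
    mdeg (↑(l₁ ++ l₂) : Multiset (Sym2 V)) v = mdeg (l₁ : Multiset (Sym2 V)) v +
      mdeg (l₂ : Multiset (Sym2 V)) v := by
  rw [← Multiset.coe_add, mdeg_add]

@[simp] lemma mdeg_coe_cons (e : Sym2 V) (l : List (Sym2 V)) (v : V) :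
    mdeg (↑(e :: l) : Multiset (Sym2 V)) v = endCount v e + mdeg (l : Multiset (Sym2 V)) v := by
  rw [← Multiset.cons_coe, mdeg_cons]

/-- The last step of the subdivision in the case of a one-way edge whose head is not below. -/
lemma exists_dec_oneWay_pair {h b : V → ℕ} {t u v : V} {c : Chain V} {f : Sym2 V}
    (hu : 2 ≤ h u) (hv : h v = 0) (hc : c.Ok (fun w => h w + mdeg {s(u, v)} w) b)
    (hvb : 2 ≤ b v + mdeg (c.edges : Multiset (Sym2 V)) v)
    (htc : t ∉ c.verts) (htu : t ≠ u) (htv : t ≠ v) (hf : f ∈ c.edges) :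
    ∃ X, Dec h b X ∧ total X + {s(u, v)} + {f} =
      {s(u, v)} + (c.edges : Multiset (Sym2 V)) + star t s(u, v) + star t f := by
  have huv : u ≠ v := by rintro rfl; omega
  have hh : ∀ w, 2 ≤ h w + mdeg {s(u, v)} w → w ≠ v ∧ 2 ≤ h w := by
    intro w hw
    by_cases h1 : w = v
    · subst h1; simp [huv.symm, hv] at hw
    · by_cases h2 : w = u
      · subst h2; exact ⟨h1, hu⟩
      · simp [h1, h2] at hw; exact ⟨h1, hw⟩
  have hh1 : ∀ w, w ≠ v → 1 ≤ h w + mdeg {s(u, v)} w → 1 ≤ h w := by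
    intro w h1 hw
    by_cases h2 : w = u
    · subst h2; omega
    · simpa [h1, h2] using hw
  have hv0 : v ∉ c.verts → mdeg (c.edges : Multiset (Sym2 V)) v = 0 := fun hv =>
    mdeg_eq_zero fun e he hve => hv (mem_verts_of_mem_edges (by simpa using he) hve)
  cases c with
  | up l =>
    obtain ⟨l', hl', hOk, hft, hhead, htl⟩ : ∃ l' : List V,
        (walkEdges l' : Multiset (Sym2 V)) = walkEdges l ∧
        (up l').Ok (fun w => h w + mdeg {s(u, v)} w) b ∧ f ∈ walkEdges l' ∧
        l'.head? ≠ some v ∧ t ∉ l' := by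
      by_cases h1 : l.head? = some v
      · refine ⟨l.reverse, by simp [walkEdges_reverse], ok_up_reverse.2 hc,
          by simpa [walkEdges_reverse] using hf, ?_, by simpa using htc⟩
        obtain ⟨l₁, x, y, l₂, rfl, rfl⟩ := exists_split_of_mem_walkEdges hf
        intro h2
        have hnd := hc.1
        rw [List.head?_reverse] at h2
        cases l₁ with
        | nil =>
          simp at h1 h2
          subst h1
          rw [List.nil_append, List.nodup_cons] at hnd
          exact hnd.1 (List.mem_of_getLast? h2)
        | cons a l₁ =>
          simp at h1
          subst h1
          rw [List.cons_append, List.nodup_cons] at hnd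
          rw [List.cons_append, List.getLast?_cons, List.getLast?_append] at h2
          simp at h2
          apply hnd.1
          rw [List.mem_append]
          right
          rw [← h2, List.getLast?_eq_some_getLast (by simp : y :: l₂ ≠ [])]
          exact List.mem_cons_of_mem _ (List.getLast_mem _)
      · exact ⟨l, rfl, hc, hf, h1, htc⟩
    obtain ⟨l₁, z, w, l₂, rfl, rfl⟩ := exists_split_of_mem_walkEdges hft
    obtain ⟨h1, h2, h3, h4⟩ := hOk
    have hbv : 2 ≤ b v := by
      by_cases hvl : v ∈ l₁ ++ z :: w :: l₂
      · exact h2 v hvl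
      · rw [edges_up, ← hl'] at hvb
        have : mdeg (walkEdges (l₁ ++ z :: w :: l₂) : Multiset (Sym2 V)) v = 0 :=
          mdeg_eq_zero fun e he hve => hvl (mem_of_mem_walkEdges (by simpa using he) hve)
        omega
    refine ⟨[oneWay u t, up (l₁ ++ [z, t]), oneWay t w, oneWay t v, up (w :: l₂)],
      ⟨⟨hu, ?_⟩, ⟨?_, fun x hx => ?_, fun x hx => ?_, fun x hx => ?_⟩, ⟨?_, ?_⟩, ⟨?_, ?_⟩,
        ⟨?_, fun x hx => ?_, fun x hx => ?_, fun x hx => ?_⟩, trivial⟩, ?_⟩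
    · simp [walkEdges_append_cons_cons]; omega
    · rw [List.nodup_append] at h1 ⊢
      simp only [List.nodup_cons, List.mem_append, List.mem_cons] at h1 htl ⊢
      grind
    · by_cases hxt : x = t
      · subst hxt; simp; omega
      · have := h2 x (by simp at hx ⊢; tauto)
        beta_reduce; omega
    · have hx' : x ∈ (l₁ ++ z :: w :: l₂).head? := by cases l₁ <;> simp_all
      exact (hh1 x (by rintro rfl; exact hhead hx') (h3 x hx')).trans (by simp)
    · simp [List.getLast?_append] at hx; subst hx; simp; omega
    · simp [walkEdges_append_cons_cons]; omega
    · have := h2 w (by simp); simp; omega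
    · simp [walkEdges_append_cons_cons]; omega
    · beta_reduce; omega
    · refine h1.sublist ?_
      simp
    · exact (h2 x (by simp at hx ⊢; tauto)).trans (by simp)
    · simp at hx; subst hx; simp [walkEdges_append_cons_cons]; omega
    · by_cases hxv : x = v
      · subst hxv; simp [walkEdges_append_cons_cons]; omega
      · have := hh1 x hxv (h4 x (by simpa [List.getLast?_append] using hx))
        beta_reduce; omega
    · simp only [edges_up]
      rw [← hl']
      simp [walkEdges_append_cons_cons, ← Multiset.coe_add, ← Multiset.cons_coe,
        ← Multiset.singleton_add, Multiset.insert_eq_cons, Sym2.eq_swap (a := t) (b := u),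
        Sym2.eq_swap (a := t) (b := z)]
      abel
  | down l =>
    obtain ⟨l₁, z, w, l₂, rfl, rfl⟩ := exists_split_of_mem_walkEdges hf
    obtain ⟨h1, h2, h3, h4⟩ := hc
    have hvl : v ∉ l₁ ++ z :: w :: l₂ := fun hvl => (hh v (h2 v hvl)).1 rfl
    have hbv : 2 ≤ b v := by have := hv0 hvl; omega
    simp only [verts_down] at htc
    refine ⟨[down (l₁ ++ [z]), oneWay z t, oneWay u t, down (t :: w :: l₂), oneWay t v],
      ⟨⟨?_, fun x hx => ?_, fun x hx => ?_, fun x hx => ?_⟩, ⟨?_, ?_⟩, ⟨?_, ?_⟩,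
        ⟨?_, fun x hx => ?_, fun x hx => ?_, fun x hx => ?_⟩, ⟨?_, ?_⟩, trivial⟩, ?_⟩
    · refine h1.sublist ?_
      simp
    · exact (hh x (h2 x (by simp at hx ⊢; tauto))).2
    · cases l₁ with
      | nil => simp at hx; subst hx; simp; omega
      | cons a l₁ => exact (h3 x (by simpa using hx)).trans (by simp)
    · simp at hx; subst hx; simp; omega
    · exact (hh z (h2 z (by simp))).2.trans (by simp)
    · simp; omega
    · beta_reduce; omega
    · simp; omega
    · refine List.nodup_cons.2 ⟨by simp at htc ⊢; tauto, h1.sublist ?_⟩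
      simp
    · by_cases hxt : x = t
      · subst hxt; simp; omega
      · have := (hh x (h2 x (by simp [hxt] at hx ⊢; tauto))).2
        beta_reduce; omega
    · simp at hx; subst hx; simp; omega
    · have := h4 x (by simpa [List.getLast?_append, List.getLast?_cons_cons] using hx)
      beta_reduce; omega
    · simp; omega
    · simpa using hbv
    · simp [walkEdges_append_cons_cons, ← Multiset.coe_add, ← Multiset.cons_coe,
        ← Multiset.singleton_add, Multiset.insert_eq_cons, Sym2.eq_swap (a := t) (b := u),
        Sym2.eq_swap (a := t) (b := z)]
      abel
  | oneWay u' v' =>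
    have hf' : f = s(u', v') := by simpa using hf
    subst hf'
    have hu' := hh u' hc.1
    simp only [verts_oneWay, List.mem_cons, List.not_mem_nil, or_false, not_or] at htc
    refine ⟨[oneWay u t, oneWay u' t, oneWay t v, oneWay t v'],
      ⟨⟨hu, ?_⟩, ⟨?_, ?_⟩, ⟨?_, ?_⟩, ⟨?_, ?_⟩, trivial⟩, ?_⟩
    · simp; omega
    · exact hu'.2.trans (by simp)
    · simp; omega
    · simp; omega
    · simp [hu'.1.symm] at hvb; simp; omega
    · simp; omega
    · simpa using hc.2
    · simp [← Multiset.singleton_add, Multiset.insert_eq_cons, Sym2.eq_swap (a := t) (b := u),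
        Sym2.eq_swap (a := t) (b := u')]
      abel

end Chains

namespace Chains

open Chain
variable {V : Type*}

lemma Fresh.perm {t : V} {D E : List (Chain V)} (h : Fresh t D) (hp : D.Perm E) : Fresh t E :=
  fun c hc => h c (hp.mem_iff.2 hc)

variable [DecidableEq V]

lemma mdeg_edges_eq_zero {c : Chain V} {v : V} (hv : v ∉ c.verts) :
    mdeg (c.edges : Multiset (Sym2 V)) v = 0 :=
  mdeg_eq_zero fun e he hve => hv (mem_verts_of_mem_edges (by simpa using he) hve)

lemma one_le_mdeg_walkEdges {l : List V} {v : V} (hv : v ∈ l) (hl : 2 ≤ l.length) :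
    1 ≤ mdeg (walkEdges l : Multiset (Sym2 V)) v := by
  induction l with
  | nil => simp at hv
  | cons a l ih =>
    match l, ih, hv, hl with
    | [w], _, hv, _ =>
      simp at hv
      rcases hv with rfl | rfl <;> simp
    | x :: y :: l, ih, hv, _ =>
      rcases List.mem_cons.1 hv with rfl | hv
      · simp; omega
      · exact (ih hv (by simp)).trans (by simp)

lemma exists_dec_of_untouched {h b : V → ℕ} {t u v : V} {A B C : List (Chain V)} {c : Chain V}
    {f : Sym2 V} (hD : Dec h b (A ++ oneWay u v :: B ++ c :: C))
    (hv : h v + mdeg (total A) v = 0) (hB : Fresh v B)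
    (ht : Fresh t (A ++ oneWay u v :: B ++ c :: C)) (hf : f ∈ c.edges) :
    ∃ D', Dec h b D' ∧ total D' + {s(u, v)} + {f} =
      total (A ++ oneWay u v :: B ++ c :: C) + star t s(u, v) + star t f := by
  simp only [fresh_append, fresh_cons, verts_oneWay, List.mem_cons, List.not_mem_nil, or_false,
    not_or] at ht
  obtain ⟨⟨htA, ⟨htu, htv⟩, htB⟩, htc, htC⟩ := ht
  have htf : t ∉ f := fun h => htc (mem_verts_of_mem_edges hf h)
  simp only [dec_append, dec_cons, total_append, total_cons, mdeg_add] at hD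
  obtain ⟨⟨hA, hOk, hB'⟩, hc, hC⟩ := hD
  have hu : 2 ≤ h u + mdeg (total A) u := hOk.1
  have hvb := hOk.2
  have huv : u ≠ v := by rintro rfl; omega
  have hBv := hB.mdeg_eq_zero
  obtain ⟨X, hX, hXt⟩ := exists_dec_oneWay_pair (h := fun w => h w + mdeg (total A) w +
      mdeg (total B) w) (b := fun w => b w + mdeg (total C) w) (t := t) (u := u) (v := v) (f := f)
    (by omega) (by omega) (hc.mono (fun w _ => by simp; omega) (fun w _ => by omega))
    (by simp at hvb; omega) htc htu htv hf
  have hXd : ∀ w, w ≠ t → mdeg {s(u, v)} w + mdeg (c.edges : Multiset (Sym2 V)) w ≤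
      mdeg (total X) w := by
    intro w hw
    have h1 := congrArg (fun M => mdeg M w) hXt
    have h2 := endCount_le_mdeg_star t s(u, v) w
    have h3 := endCount_le_mdeg_star t f w
    simp only [mdeg_add, mdeg_singleton] at h1 ⊢
    omega
  have hXt0 : mdeg {s(u, v)} t + mdeg (c.edges : Multiset (Sym2 V)) t = 0 := by
    rw [mdeg_edges_eq_zero htc]; simp [htu, htv]
  have hXd' : ∀ w, mdeg {s(u, v)} w + mdeg (c.edges : Multiset (Sym2 V)) w ≤
      mdeg (total X) w := by
    intro w
    by_cases hw : w = t
    · subst hw; omega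
    · exact hXd w hw
  refine ⟨A ++ B ++ X ++ C, ?_, ?_⟩
  · simp only [dec_append, total_append, mdeg_add]
    refine ⟨⟨⟨hA.mono_le (fun _ => le_rfl) fun w => ?_, hB'.mono (fun d hd w hw => ?_)
      fun d hd w hw => ?_⟩, ?_⟩, hC.mono_le (fun w => ?_) fun _ => le_rfl⟩
    · have := hXd' w; simp at this ⊢; omega
    · have hwv : w ≠ v := fun h => hB d hd (h ▸ hw)
      by_cases hwu : w = u
      · subst hwu; omega
      · simp [hwv, hwu]
    · have := hXd' w; omega
    · simpa [add_assoc] using hX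
    · have := hXd' w; simp at this ⊢; omega
  · simp only [total_append, total_cons]
    calc _ = total A + total B + (total X + {s(u, v)} + {f}) + total C := by abel
      _ = _ := by rw [hXt, edges_oneWay, Multiset.coe_singleton]; abel

/-- Either the edge `e` of `c` can be subdivided from below after a rearrangement, or `c` is a
one-way edge whose head is not below and is not touched by `B`. -/
lemma exists_lowSub {h b : V → ℕ} {t : V} {A B R : List (Chain V)} {c : Chain V}
    {e : Sym2 V} (hD : Dec h b (A ++ c :: B ++ R)) (hne : ∀ g ∈ B, g.edges ≠ [])
    (ht : Fresh t (A ++ c :: B ++ R)) (he : e ∈ c.edges) :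
    (∃ A' P B' P', Dec h b (A' ++ P ++ B' ++ R) ∧ (A' ++ P ++ B').Perm (A ++ c :: B) ∧
      (P = [c] ∨ ∃ l, P = [c, up l]) ∧
      LowSub t (fun v => h v + mdeg (total A') v) (fun v => b v + mdeg (total (B' ++ R)) v)
        P P' e) ∨
    ∃ u v, c = oneWay u v ∧ h v + mdeg (total A) v = 0 ∧ Fresh v B := by
  have htc : t ∉ c.verts := by simp at ht; tauto
  have key := hD
  rw [List.append_assoc, List.cons_append, dec_append, dec_cons] at key
  have hOk := key.2.1
  by_cases hgood : ∃ P', LowSub t (fun v => h v + mdeg (total A) v)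
      (fun v => b v + mdeg (total (B ++ R)) v) [c] P' e
  · obtain ⟨P', hP'⟩ := hgood
    exact Or.inl ⟨A, [c], B, P', by simpa using hD, by simp, Or.inl rfl, hP'⟩
  cases c with
  | up l => exact (hgood (lowSub_up hOk htc he)).elim
  | down l => exact (hgood (lowSub_down hOk he)).elim
  | oneWay u v =>
  obtain rfl : e = s(u, v) := by simpa using he
  have hv0 : h v + mdeg (total A) v = 0 := by
    by_contra hne
    exact hgood (lowSub_oneWay hOk (by omega) (by rintro rfl; simp at htc))
  by_cases hBf : Fresh v B
  · exact Or.inr ⟨u, v, rfl, hv0, hBf⟩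
  left
  have huv : u ≠ v := by rintro rfl; exact absurd hOk.1 (by beta_reduce; omega)
  obtain ⟨B₁, g, B₂, rfl, hg, hB₁⟩ : ∃ B₁ g B₂, B = B₁ ++ g :: B₂ ∧ v ∈ g.verts ∧ Fresh v B₁ := by
    clear hD key hOk hne ht hgood
    induction B with
    | nil => simp at hBf
    | cons g B ih =>
      by_cases hvg : v ∈ g.verts
      · exact ⟨[], g, B, rfl, hvg, by simp⟩
      · obtain ⟨B₁, g', B₂, rfl, h1, h2⟩ := ih (by simpa [hvg] using hBf)
        exact ⟨g :: B₁, g', B₂, rfl, h1, by simp [hvg, h2]⟩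
  have hB₁v := hB₁.mdeg_eq_zero
  simp only [List.append_assoc, List.cons_append, dec_append, dec_cons, total_append, total_cons,
    mdeg_add] at key
  obtain ⟨hA, -, hB₁d, hgOk, hB₂⟩ := key
  simp only [edges_oneWay, Multiset.coe_singleton] at hB₁d hgOk hB₂
  have hne' : ∀ w, w ≠ v → min 2 (h w + mdeg (total A) w + mdeg {s(u, v)} w) ≤
      h w + mdeg (total A) w := by
    intro w hw
    by_cases hwu : w = u
    · subst hwu; have := hOk.1; beta_reduce at this; omega
    · simp [hw, hwu]
  have hB₁' : Dec (fun w => h w + mdeg (total A) w)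
      (fun w => b w + (mdeg (g.edges : Multiset (Sym2 V)) w + mdeg {s(u, v)} w +
        (mdeg (total B₂) w + mdeg (total R) w))) B₁ :=
    hB₁d.mono (fun d hd w hw => hne' w fun h => hB₁ d hd (h ▸ hw)) (fun d _ w _ => by omega)
  have huA := hOk.1
  have hvb := hOk.2
  simp only [List.append_assoc, List.cons_append, total_append, total_cons, mdeg_add] at hvb
  -- moving the one-way edge after `g`
  have hmove : g.Ok (fun w => h w + mdeg (total A) w + mdeg (total B₁) w)
        (fun w => b w + (mdeg (total B₂) w + mdeg (total R) w)) →
      2 ≤ b v + (mdeg (total B₂) v + mdeg (total R) v) →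
      1 ≤ mdeg (g.edges : Multiset (Sym2 V)) v → ∃ A' P B' P', Dec h b (A' ++ P ++ B' ++ R) ∧
        (A' ++ P ++ B').Perm (A ++ oneWay u v :: (B₁ ++ g :: B₂)) ∧
        (P = [oneWay u v] ∨ ∃ l, P = [oneWay u v, up l]) ∧
        LowSub t (fun v => h v + mdeg (total A') v) (fun v => b v + mdeg (total (B' ++ R)) v)
          P P' s(u, v) := by
    intro hg' hv2 hgv
    have hOk' : (oneWay u v).Ok (fun w => h w + mdeg (total (A ++ B₁ ++ [g])) w)
        (fun w => b w + mdeg (total (B₂ ++ R)) w) := by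
      refine ⟨huA.trans (by simp), ?_⟩
      simpa using hv2
    obtain ⟨P', hP'⟩ := lowSub_oneWay (t := t) hOk' (by simp; omega)
      (by rintro rfl; simp at htc)
    refine ⟨A ++ B₁ ++ [g], [oneWay u v], B₂, P', ?_, ?_, Or.inl rfl, hP'⟩
    · simp only [List.append_assoc, List.cons_append, List.nil_append, dec_append, dec_cons,
        total_append, total_cons, mdeg_add]
      refine ⟨hA.mono_le (fun _ => le_rfl) fun w => ?_, hB₁'.mono_le (fun _ => le_rfl) fun w => ?_,
        hg'.mono (fun w _ => by omega) (fun w _ => by omega), ?_, ?_, ?_⟩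
      · simp; omega
      · simp; omega
      · simpa [add_assoc] using hOk'
      · exact hB₂.1.mono_le (fun w => by simp; omega) fun w => by simp
      · exact hB₂.2.mono_le (fun w => by simp; omega) fun w => le_rfl
    · refine Multiset.coe_eq_coe.1 ?_
      simp only [← Multiset.coe_add, ← Multiset.cons_coe, ← Multiset.singleton_add,
        Multiset.coe_nil]
      abel
  have hv1 : ∀ w, w ≠ v → 1 ≤ h w + mdeg (total A) w + mdeg {s(u, v)} w + mdeg (total B₁) w →
      1 ≤ h w + mdeg (total A) w + mdeg (total B₁) w := by
    intro w hw h1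
    have := hne' w hw
    omega
  have hv2 : ∀ w, 2 ≤ h w + mdeg (total A) w + mdeg {s(u, v)} w + mdeg (total B₁) w →
      w ≠ v ∧ 2 ≤ h w + mdeg (total A) w + mdeg (total B₁) w := by
    intro w h2
    have hw : w ≠ v := by rintro rfl; simp [huv.symm] at h2; omega
    have := hne' w hw
    exact ⟨hw, by omega⟩
  cases g with
  | down l => exact absurd rfl (hv2 v (hgOk.2.1 v hg)).1
  | oneWay x y =>
    have hx := hv2 x hgOk.1
    have hy : y = v := by
      simp only [verts_oneWay, List.mem_cons, List.not_mem_nil, or_false] at hg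
      exact (hg.resolve_left hx.1.symm).symm
    exact hmove ⟨hx.2, hgOk.2⟩ (hy ▸ hgOk.2) (by simp [hy])
  | up l =>
    have hl : 2 ≤ l.length := by
      have := hne (up l) (by simp)
      match l, this with
      | _ :: _ :: _, _ => simp
      | [_], h => simp at h
      | [], h => simp at h
    by_cases hend : l.head? = some v ∨ l.getLast? = some v
    · obtain ⟨P', hP'⟩ := lowSub_oneWay_up (t := t) (u := u) (v := v)
        (h := fun w => h w + mdeg (total (A ++ B₁)) w)
        (b := fun w => b w + mdeg (total (B₂ ++ R)) w) (huA.trans (by simp))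
        (hgOk.mono (fun w _ => by simp; omega) (fun w _ => by simp)) (by simp at ht; tauto) hl hend
      refine ⟨A ++ B₁, [oneWay u v, up l], B₂, P', ?_, ?_, Or.inr ⟨l, rfl⟩, hP'⟩
      · simp only [List.append_assoc, List.cons_append, List.nil_append, dec_append, dec_cons,
          total_append, total_cons, mdeg_add]
        refine ⟨hA.mono_le (fun _ => le_rfl) fun w => by omega,
          hB₁'.mono_le (fun _ => le_rfl) fun w => by simp; omega,
          ⟨huA.trans (by beta_reduce; omega), ?_⟩,
          hgOk.mono (fun w _ => by simp; omega) (fun w _ => by simp),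
          hB₂.1.mono_le (fun w => by simp; omega) fun w => le_rfl,
          hB₂.2.mono_le (fun w => by simp; omega) fun w => le_rfl⟩
        have := hgOk.2.1 v hg
        beta_reduce at this ⊢
        omega
      · refine Multiset.coe_eq_coe.1 ?_
        simp only [← Multiset.coe_add, ← Multiset.cons_coe, ← Multiset.singleton_add,
          Multiset.coe_nil]
        abel
    · rw [not_or] at hend
      refine hmove ⟨hgOk.1, hgOk.2.1, fun w hw => hv1 w ?_ (hgOk.2.2.1 w hw),
        fun w hw => hv1 w ?_ (hgOk.2.2.2 w hw)⟩ (hgOk.2.1 v hg) ?_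
      · rintro rfl; exact hend.1 hw
      · rintro rfl; exact hend.2 hw
      · exact one_le_mdeg_walkEdges hg hl

/-- Subdividing two edges of different chains. -/
lemma exists_dec_of_two_chains {h b : V → ℕ} {t : V} {A B C : List (Chain V)} {c c' : Chain V}
    {e f : Sym2 V} (hD : Dec h b (A ++ c :: B ++ c' :: C))
    (hne : ∀ g ∈ A ++ c :: B ++ c' :: C, g.edges ≠ [])
    (ht : Fresh t (A ++ c :: B ++ c' :: C)) (he : e ∈ c.edges) (hf : f ∈ c'.edges) :
    ∃ D', Dec h b D' ∧ total D' + {e} + {f} =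
      total (A ++ c :: B ++ c' :: C) + star t e + star t f := by
  rcases exists_lowSub hD (fun g hg => hne g (by simp [hg])) ht he with
    ⟨A, P, B, P', hD, hperm, hP, hP'⟩ | ⟨u, v, rfl, hv0, hBf⟩
  swap
  · obtain rfl : e = s(u, v) := by simpa using he
    exact exists_dec_of_untouched hD hv0 hBf ht hf
  have hpermD := hperm.append_right (c' :: C)
  have ht := ht.perm hpermD.symm
  replace hne : ∀ g ∈ A ++ P ++ B ++ c' :: C, g.edges ≠ [] := fun g hg =>
    hne g (hpermD.mem_iff.1 hg)
  rw [← total_perm hpermD]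
  clear hperm hpermD
  have hDf := hD.flip
  have htf := fresh_flips.2 ht
  rw [show flips (A ++ P ++ B ++ c' :: C) =
    flips C ++ c'.flip :: flips B ++ (flips P ++ flips A) by simp] at hDf htf
  have hte : t ∉ e := not_mem_edge ht (by rcases hP with rfl | ⟨l, rfl⟩ <;> simp [he])
  have htf' : t ∉ f := not_mem_edge ht (by simp [hf])
  have hneB : ∀ g ∈ flips B, g.edges ≠ [] := by
    intro g hg
    obtain ⟨g', hg', rfl⟩ : ∃ g' ∈ B, g'.flip = g := by simpa [flips] using hg
    simpa using hne g' (by simp [hg'])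
  rcases exists_lowSub hDf hneB htf (e := f) (by simpa using hf) with
    ⟨A₂, Q, B₂, Q', hD₂, hperm, -, hQ'⟩ | ⟨v, u, hc', hv0, hBf⟩
  · have htot := total_perm hperm
    simp only [total_append, total_cons, total_flips, edges_flip] at htot
    have h1 : total (flips B₂ ++ flips Q ++ flips A₂) = total (B ++ c' :: C) := by
      simp only [total_append, total_cons, total_flips]
      calc _ = total A₂ + total Q + total B₂ := by abel
        _ = _ := by rw [htot]; abel
    have h2 : total (flips A₂) = total A₂ := by simp
    have h3 : total (A ++ P ++ flips B₂) = total (B₂ ++ (flips P ++ flips A)) := by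
      simp only [total_append, total_flips]; abel
    obtain ⟨D', hD', hT⟩ := Dec.subdivide_two (h := h) (b := b) (t := t) (A := A) (P := P)
      (B := flips B₂) (Q := flips Q) (C := flips A₂) (by simpa using hD₂.flip) hte htf'
      (by rw [h1]; exact hP') (by rw [h2, h3, flips_flips]; exact hQ')
    refine ⟨D', hD', ?_⟩
    rw [hT]
    congr 2
    calc _ = total (A ++ P) + total (flips B₂ ++ flips Q ++ flips A₂) := by
          simp only [total_append]; abel
      _ = _ := by rw [h1]; simp only [total_append]; abel
  · rw [hc'] at hDf htf
    have hfe : f = s(u, v) := by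
      rw [← edges_flip, hc'] at hf
      simpa [Sym2.eq_swap] using hf
    have hedges : c'.edges = [s(v, u)] := by rw [← edges_flip, hc']; rfl
    obtain ⟨B', A', hB', hsplit⟩ : ∃ B' A', Fresh u B' ∧ flips C ++ oneWay v u :: flips B ++
        (flips P ++ flips A) = flips C ++ oneWay v u :: B' ++ c.flip :: A' := by
      rcases hP with rfl | ⟨l, rfl⟩
      · exact ⟨flips B, flips A, hBf, by simp⟩
      · refine ⟨flips B ++ [down l], flips A, ?_, by simp [Chain.flip]⟩
        simp only [fresh_append, fresh_cons, hBf, true_and, verts_down, fresh_nil, and_true]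
        intro hul
        simp only [dec_append, dec_cons, total_append, total_cons, mdeg_add] at hD hDf
        have h1 := hD.1.1.2.2.1.2.1 u hul
        have h2 : 2 ≤ b v + mdeg (total (flips C)) v := hDf.1.2.1.1
        have h3 := hBf.mdeg_eq_zero
        simp only [total_flips, total_nil, mdeg_zero] at h1 h2 h3 hv0
        have h4 : mdeg (c'.edges : Multiset (Sym2 V)) u ≤ 1 := by
          have : u ≠ v := by rintro rfl; omega
          simp [hedges, this]
        omega
    rw [hsplit] at hDf htf
    obtain ⟨D', hD', hT⟩ := exists_dec_of_untouched hDf hv0 hB' htf (f := e) (by simpa using he)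
    refine ⟨flips D', hD'.flip, ?_⟩
    rw [← hsplit, ← hc', Sym2.eq_swap, ← hfe] at hT
    rw [total_flips, add_right_comm, hT, add_right_comm]
    congr 2
    simp only [total_append, total_cons, total_flips, edges_flip]
    abel

end Chains

namespace Chains

open Chain
variable {V : Type*} [DecidableEq V]

lemma exists_dec_of_up {h b : V → ℕ} {t x y z w : V} {l₁ l₂ m l₃ : List V}
    (hc : (up (l₁ ++ x :: y :: l₂)).Ok h b) (hl : y :: l₂ = m ++ z :: w :: l₃)
    (ht : t ∉ l₁ ++ x :: y :: l₂) :
    ∃ X, Dec h b X ∧ total X + {s(x, y)} + {s(z, w)} =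
      (walkEdges (l₁ ++ x :: y :: l₂) : Multiset (Sym2 V)) + star t s(x, y) + star t s(z, w) := by
  obtain ⟨h1, h2, h3, h4⟩ := hc
  have hm : ∃ m', m ++ [z] = y :: m' := by
    cases m with
    | nil => simp at hl; exact ⟨[], by simp [hl]⟩
    | cons a m => simp at hl; exact ⟨m ++ [z], by simp [hl]⟩
  obtain ⟨m', hm'⟩ := hm
  rw [hl] at h1 h2 h3 h4 ht
  have hymem : y ∈ m ++ [z] := by simp [hm']
  refine ⟨[up (l₁ ++ x :: t :: w :: l₃), oneWay t y, oneWay t z, up (m ++ [z])],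
    ⟨⟨?_, fun v hv => ?_, fun v hv => ?_, fun v hv => ?_⟩, ⟨?_, ?_⟩, ⟨?_, ?_⟩,
      ⟨?_, fun v hv => ?_, fun v hv => ?_, fun v hv => ?_⟩, trivial⟩, ?_⟩
  · have : (l₁ ++ x :: w :: l₃).Nodup := h1.sublist (by simp)
    rw [List.nodup_append] at this ⊢
    simp only [List.nodup_cons, List.mem_append, List.mem_cons] at this ht ⊢
    grind
  · by_cases hvt : v = t
    · subst hvt; simp; omega
    · exact (h2 v (by simp at hv ⊢; tauto)).trans (by simp)
  · exact h3 v (by cases l₁ <;> simp_all)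
  · refine h4 v ?_
    rw [show l₁ ++ x :: (m ++ z :: w :: l₃) = (l₁ ++ x :: (m ++ [z])) ++ w :: l₃ by simp,
      List.getLast?_append_cons]
    simpa [List.getLast?_append_cons, List.getLast?_cons_cons] using hv
  · simp [walkEdges_append_cons_cons]; omega
  · exact (h2 y (by simp at hymem ⊢; tauto)).trans (by simp)
  · simp [walkEdges_append_cons_cons]; omega
  · exact (h2 z (by simp)).trans (by simp)
  · exact h1.sublist (by simp)
  · exact (h2 v (by simp at hv ⊢; tauto)).trans (by simp)
  · simp [hm'] at hv; subst hv; simp; omega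
  · simp at hv; subst hv; simp; omega
  · rw [walkEdges_append_cons_cons, hl, walkEdges_append_cons_cons m]
    simp [walkEdges_append_cons_cons, ← Multiset.coe_add, ← Multiset.cons_coe,
      ← Multiset.singleton_add, Multiset.insert_eq_cons, Sym2.eq_swap (a := t) (b := x)]
    abel

lemma exists_dec_of_up_le {h b : V → ℕ} {t : V} {l : List V} {e f : Sym2 V}
    {M : Multiset (Sym2 V)} (hc : (up l).Ok h b) (ht : t ∉ l)
    (hM : (walkEdges l : Multiset (Sym2 V)) = e ::ₘ f ::ₘ M) :
    ∃ X, Dec h b X ∧ total X + {e} + {f} =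
      (walkEdges l : Multiset (Sym2 V)) + star t e + star t f := by
  have he : e ∈ walkEdges l := by
    have : e ∈ (walkEdges l : Multiset (Sym2 V)) := by simp [hM]
    simpa using this
  obtain ⟨l₁, x, y, l₂, rfl, rfl⟩ := exists_split_of_mem_walkEdges he
  have hf : f ∈ walkEdges (l₁ ++ [x]) ∨ f ∈ walkEdges (y :: l₂) := by
    rw [walkEdges_append_cons_cons, ← Multiset.coe_add, ← Multiset.cons_coe,
      Multiset.add_cons, Multiset.cons_inj_right] at hM
    have : f ∈ (walkEdges (l₁ ++ [x]) : Multiset (Sym2 V)) +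
      (walkEdges (y :: l₂) : Multiset (Sym2 V)) := by simp [hM]
    simpa using this
  rcases hf with hf | hf
  · obtain ⟨k, z, w, k', hk, rfl⟩ := exists_split_of_mem_walkEdges hf
    have hl : l₁ ++ x :: y :: l₂ = k ++ z :: w :: (k' ++ y :: l₂) := by
      have : l₁ ++ x :: y :: l₂ = (l₁ ++ [x]) ++ y :: l₂ := by simp
      rw [this, hk]; simp
    obtain ⟨m, hm⟩ : ∃ m, w :: (k' ++ y :: l₂) = m ++ x :: y :: l₂ := by
      have h1 : (w :: k').getLast? = some x := by
        have := congrArg List.getLast? hk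
        simpa [List.getLast?_append, List.getLast?_cons_cons] using this.symm
      obtain ⟨m, hm⟩ := List.getLast?_eq_some_iff.1 h1
      exact ⟨m, by rw [← List.cons_append, hm]; simp⟩
    obtain ⟨X, hX, hXt⟩ := exists_dec_of_up (t := t) (hl ▸ hc) hm (hl ▸ ht)
    refine ⟨X, hX, ?_⟩
    rw [add_right_comm, hXt, hl, add_right_comm]
  · obtain ⟨m, z, w, l₃, hl, rfl⟩ := exists_split_of_mem_walkEdges hf
    exact exists_dec_of_up hc hl ht

/-- Subdividing two edges of the same chain. -/
lemma exists_dec_of_one_chain {h b : V → ℕ} {t : V} {A B : List (Chain V)} {c : Chain V}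
    {e f : Sym2 V} {M : Multiset (Sym2 V)} (hD : Dec h b (A ++ c :: B))
    (ht : t ∉ c.verts) (hM : (c.edges : Multiset (Sym2 V)) = e ::ₘ f ::ₘ M) :
    ∃ D', Dec h b D' ∧ total D' + {e} + {f} = total (A ++ c :: B) + star t e + star t f := by
  rw [dec_append, dec_cons] at hD
  obtain ⟨hA, hc, hB⟩ := hD
  obtain ⟨X, hX, hXt⟩ : ∃ X, Dec (fun v => h v + mdeg (total A) v)
      (fun v => b v + mdeg (total B) v) X ∧ total X + {e} + {f} =
      (c.edges : Multiset (Sym2 V)) + star t e + star t f := by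
    cases c with
    | up l => exact exists_dec_of_up_le hc ht hM
    | down l =>
      obtain ⟨X, hX, hXt⟩ := exists_dec_of_up_le (ok_flip.2 hc) ht hM
      exact ⟨flips X, hX.flip, by simpa using hXt⟩
    | oneWay u v => simpa using congrArg Multiset.card hM
  have hXd : ∀ v, mdeg (c.edges : Multiset (Sym2 V)) v ≤ mdeg (total X) v := by
    intro w
    have h1 := congrArg (fun M => mdeg M w) hXt
    have h2 := endCount_le_mdeg_star t e w
    have h3 := endCount_le_mdeg_star t f w
    simp only [mdeg_add, mdeg_singleton] at h1 ⊢
    omega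
  refine ⟨A ++ X ++ B, ?_, ?_⟩
  · simp only [dec_append, total_append, mdeg_add]
    refine ⟨⟨hA.mono_le (fun _ => le_rfl) fun v => ?_, hX⟩, hB.mono_le (fun v => ?_)
      fun _ => le_rfl⟩
    · have := hXd v; simp; omega
    · have := hXd v; omega
  · simp only [total_append, total_cons]
    calc _ = total A + (total X + {e} + {f}) + total B := by abel
      _ = _ := by rw [hXt]; abel

lemma Dec.exists_nonempty {h b : V → ℕ} {D : List (Chain V)} (hD : Dec h b D) :
    ∃ D', Dec h b D' ∧ total D' = total D ∧ ∀ c ∈ D', c.edges ≠ [] := by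
  induction D generalizing h with
  | nil => exact ⟨[], trivial, rfl, by simp⟩
  | cons c D ih =>
    rw [dec_cons] at hD
    obtain ⟨D', h1, h2, h3⟩ := ih hD.2
    by_cases hc : c.edges = []
    · exact ⟨D', by simpa [hc] using h1, by simp [h2, hc], h3⟩
    · exact ⟨c :: D', dec_cons.2 ⟨by simpa [h2] using hD.1, h1⟩, by simp [h2], by
        simpa [hc] using h3⟩

lemma exists_mem_edges {c : Chain V} {v : V} (hv : v ∈ c.verts) (hc : c.edges ≠ []) :
    ∃ e ∈ c.edges, v ∈ e := by
  by_contra! hcon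
  have h0 : mdeg (c.edges : Multiset (Sym2 V)) v = 0 := mdeg_eq_zero (by simpa using hcon)
  have hwalk : ∀ l : List V, v ∈ l → walkEdges l ≠ [] →
      1 ≤ mdeg (walkEdges l : Multiset (Sym2 V)) v := by
    intro l hl hne
    refine one_le_mdeg_walkEdges hl ?_
    match l, hne with
    | _ :: _ :: _, _ => simp
    | [_], h => simp at h
    | [], h => simp at h
  cases c with
  | up l => have := hwalk l hv hc; simp at h0; omega
  | down l => have := hwalk l hv hc; simp at h0; omega
  | oneWay x y => simp at hv hcon; tauto

/-- Two edges of a decomposed graph can be pinched together at a new vertex `t`. -/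
lemma Dec.pinch {h b : V → ℕ} {D : List (Chain V)} (hD : Dec h b D) {t : V} {e f : Sym2 V}
    {M : Multiset (Sym2 V)} (hM : total D = e ::ₘ f ::ₘ M) (ht : ∀ g ∈ total D, t ∉ g) :
    ∃ D', Dec h b D' ∧ total D' = M + star t e + star t f := by
  suffices H : ∃ D', Dec h b D' ∧ total D' + {e} + {f} = total D + star t e + star t f by
    obtain ⟨D', hD', hT⟩ := H
    refine ⟨D', hD', ?_⟩
    rw [hM] at hT
    refine add_right_cancel (b := {e} + {f}) ?_
    rw [← add_assoc, hT]
    simp only [← Multiset.singleton_add]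
    abel
  obtain ⟨D, hD, hDt, hne⟩ := hD.exists_nonempty
  rw [← hDt] at hM ht ⊢
  clear hDt
  have hfr : Fresh t D := by
    intro c hc htc
    obtain ⟨g, hg, htg⟩ := exists_mem_edges htc (hne c hc)
    exact ht g (mem_total.2 ⟨c, hc, hg⟩) htg
  obtain ⟨c, hc, hec⟩ := mem_total.1 (show e ∈ total D by simp [hM])
  obtain ⟨A, B, rfl⟩ := List.append_of_mem hc
  obtain ⟨N, hN⟩ := Multiset.exists_cons_of_mem (s := (c.edges : Multiset (Sym2 V)))
    (a := e) (by simpa using hec)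
  have hf : f ∈ total A ∨ f ∈ N ∨ f ∈ total B := by
    rw [total_append, total_cons, hN, Multiset.cons_add, Multiset.add_cons,
      Multiset.cons_inj_right] at hM
    have : f ∈ total A + (N + total B) := by simp [hM]
    simpa using this
  rcases hf with hf | hf | hf
  · obtain ⟨c', hc', hfc⟩ := mem_total.1 hf
    obtain ⟨A₁, A₂, rfl⟩ := List.append_of_mem hc'
    obtain ⟨D', h1, h2⟩ := exists_dec_of_two_chains hD hne hfr hfc hec
    exact ⟨D', h1, by rw [add_right_comm, h2, add_right_comm]⟩
  · obtain ⟨N', rfl⟩ := Multiset.exists_cons_of_mem hf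
    exact exists_dec_of_one_chain hD (hfr c hc) hN
  · obtain ⟨c', hc', hfc⟩ := mem_total.1 hf
    obtain ⟨B₁, B₂, rfl⟩ := List.append_of_mem hc'
    have hl : A ++ c :: (B₁ ++ c' :: B₂) = A ++ c :: B₁ ++ c' :: B₂ := by simp
    rw [hl] at hD hne hfr ⊢
    exact exists_dec_of_two_chains hD hne hfr hec hfc

end Chains

namespace Chains

variable {V : Type*} [DecidableEq V]

/-- The number of times (zero or one) that an edge crosses the boundary of `X`. -/
def cross (X : Finset V) : Sym2 V → ℕ :=
  Sym2.lift ⟨fun a b => if a ∈ X ↔ b ∈ X then 0 else 1, fun a b => by simp [iff_comm]⟩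

@[simp] lemma cross_mk (X : Finset V) (a b : V) :
    cross X s(a, b) = if a ∈ X ↔ b ∈ X then 0 else 1 := rfl

/-- The number of edges leaving `X`. -/
def cut (M : Multiset (Sym2 V)) (X : Finset V) : ℕ := (M.map (cross X)).sum

@[simp] lemma cut_zero (X : Finset V) : cut (0 : Multiset (Sym2 V)) X = 0 := rfl
@[simp] lemma cut_cons (e : Sym2 V) (M : Multiset (Sym2 V)) (X : Finset V) :
    cut (e ::ₘ M) X = cross X e + cut M X := by simp [cut]

lemma cross_le_one (X : Finset V) (e : Sym2 V) : cross X e ≤ 1 := by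
  induction e with | _ a b => simp; split_ifs <;> simp

lemma cut_inter_add_cut_union (M : Multiset (Sym2 V)) (X Y : Finset V) :
    cut M (X ∩ Y) + cut M (X ∪ Y) ≤ cut M X + cut M Y := by
  induction M using Multiset.induction_on with
  | empty => simp
  | cons e M ih =>
    have : cross (X ∩ Y) e + cross (X ∪ Y) e ≤ cross X e + cross Y e := by
      induction e with | _ a b =>
      by_cases h1 : a ∈ X <;> by_cases h2 : b ∈ X <;> by_cases h3 : a ∈ Y <;>
        by_cases h4 : b ∈ Y <;> simp [h1, h2, h3, h4]
    simp only [cut_cons]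
    omega

lemma cut_sdiff_add_cut_sdiff (M : Multiset (Sym2 V)) (X Y : Finset V) :
    cut M (X \ Y) + cut M (Y \ X) ≤ cut M X + cut M Y := by
  induction M using Multiset.induction_on with
  | empty => simp
  | cons e M ih =>
    have : cross (X \ Y) e + cross (Y \ X) e ≤ cross X e + cross Y e := by
      induction e with | _ a b =>
      by_cases h1 : a ∈ X <;> by_cases h2 : b ∈ X <;> by_cases h3 : a ∈ Y <;>
        by_cases h4 : b ∈ Y <;> simp [h1, h2, h3, h4]
    simp only [cut_cons]
    omega

lemma cut_parity (M : Multiset (Sym2 V)) (X Y : Finset V) :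
    ∃ k, cut M X + 2 * k = cut M (X ∩ Y) + cut M (X \ Y) := by
  induction M using Multiset.induction_on with
  | empty => exact ⟨0, by simp⟩
  | cons e M ih =>
    obtain ⟨k, hk⟩ := ih
    have : cross (X ∩ Y) e + cross (X \ Y) e = cross X e ∨
        cross (X ∩ Y) e + cross (X \ Y) e = cross X e + 2 := by
      induction e with | _ a b =>
      by_cases h1 : a ∈ X <;> by_cases h2 : b ∈ X <;> by_cases h3 : a ∈ Y <;>
        by_cases h4 : b ∈ Y <;> simp [h1, h2, h3, h4]
    rcases this with h | h
    · exact ⟨k, by simp only [cut_cons]; omega⟩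
    · exact ⟨k + 1, by simp only [cut_cons]; omega⟩

lemma cut_insert {M : Multiset (Sym2 V)} {s : V} (hs : ∀ e ∈ M, s ∉ e) (X : Finset V) :
    cut M (insert s X) = cut M X := by
  refine congrArg Multiset.sum (Multiset.map_congr rfl fun e he => ?_)
  have := hs e he
  induction e with | _ a b =>
  simp at this
  simp [Ne.symm this.1, Ne.symm this.2]

lemma cut_singleton_le_mdeg (M : Multiset (Sym2 V)) (v : V) : cut M {v} ≤ mdeg M v := by
  induction M using Multiset.induction_on with
  | empty => simp
  | cons e M ih =>
    have : cross {v} e ≤ endCount v e := by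
      induction e with | _ a b =>
      by_cases h1 : v = a <;> by_cases h2 : v = b <;> simp [h1, h2] <;> grind
    simp only [cut_cons, mdeg_cons]
    omega

/-- Every set avoiding `r` that meets an edge is left by at least four edges. -/
def FourCut (M : Multiset (Sym2 V)) (r : V) : Prop :=
  ∀ X : Finset V, r ∉ X → (∃ e ∈ M, ∃ v ∈ X, v ∈ e) → 4 ≤ cut M X

/-- A set violating the cut condition after splitting off at a vertex of degree four contains
exactly one of the two pairs. -/
lemma exists_of_not_fourCut {M : Multiset (Sym2 V)} {r s x₁ x₂ x₃ x₄ : V}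
    (hM : FourCut (s(s, x₁) ::ₘ s(s, x₂) ::ₘ s(s, x₃) ::ₘ s(s, x₄) ::ₘ M) r) (hr : s ≠ r)
    (hs : ∀ e ∈ M, s ∉ e) (h₁ : x₁ ≠ s) (h₂ : x₂ ≠ s) (h₃ : x₃ ≠ s) (h₄ : x₄ ≠ s)
    (hbad : ¬ FourCut (s(x₁, x₂) ::ₘ s(x₃, x₄) ::ₘ M) r) :
    ∃ X : Finset V, s ∉ X ∧ r ∉ X ∧ cut M X ≤ 3 ∧ (x₁ ∈ X ↔ x₂ ∈ X) ∧ (x₃ ∈ X ↔ x₄ ∈ X) ∧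
      (x₁ ∈ X ↔ x₃ ∉ X) := by
  obtain ⟨X, hrX, htouch, hcut⟩ : ∃ X : Finset V, r ∉ X ∧
      (∃ e ∈ s(x₁, x₂) ::ₘ s(x₃, x₄) ::ₘ M, ∃ v ∈ X, v ∈ e) ∧
      cut (s(x₁, x₂) ::ₘ s(x₃, x₄) ::ₘ M) X ≤ 3 := by
    simp only [FourCut] at hbad
    push Not at hbad
    obtain ⟨X, h1, h2, h3⟩ := hbad
    exact ⟨X, h1, h2, by omega⟩
  have hcutE : cut M (X.erase s) = cut M X := by
    by_cases hsX : s ∈ X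
    · rw [← cut_insert hs, Finset.insert_erase hsX]
    · rw [Finset.erase_eq_of_notMem hsX]
  have hin := hM (insert s X) (by simp [hr.symm, hrX]) ⟨s(s, x₁), by simp, s, by simp, by simp⟩
  have hout := hM (X.erase s) (by simp [hrX])
  simp only [cut_cons, cross_mk, cut_insert hs, hcutE] at hin hout hcut
  simp only [Finset.mem_insert, Finset.mem_erase, h₁, h₂, h₃, h₄, true_or, false_or,
    true_iff, ne_eq, not_true_eq_false, false_and, not_false_eq_true, true_and, false_iff]
    at hin hout
  have hout' : (x₁ ∈ X ∨ x₂ ∈ X ∨ x₃ ∈ X ∨ x₄ ∈ X) ∨ 4 ≤ cut M X := by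
    by_contra! hcon
    obtain ⟨⟨n1, n2, n3, n4⟩, hlt⟩ := hcon
    obtain ⟨e, he, v, hvX, hve⟩ := htouch
    have heM : e ∈ M := by
      simp only [Multiset.mem_cons] at he
      rcases he with rfl | rfl | he
      · simp at hve; rcases hve with rfl | rfl <;> contradiction
      · simp at hve; rcases hve with rfl | rfl <;> contradiction
      · exact he
    have := hout ⟨e, by simp [heM], v, ⟨by rintro rfl; exact hs e heM hve, hvX⟩, hve⟩
    simp [n1, n2, n3, n4] at this
    omega
  have hout'' : (x₁ ∈ X ∨ x₂ ∈ X ∨ x₃ ∈ X ∨ x₄ ∈ X) → _ := fun h => hout (by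
    rcases h with h | h | h | h
    · exact ⟨s(s, x₁), by simp, x₁, ⟨h₁, h⟩, by simp⟩
    · exact ⟨s(s, x₂), by simp, x₂, ⟨h₂, h⟩, by simp⟩
    · exact ⟨s(s, x₃), by simp, x₃, ⟨h₃, h⟩, by simp⟩
    · exact ⟨s(s, x₄), by simp, x₄, ⟨h₄, h⟩, by simp⟩)
  clear hout htouch hM
  refine ⟨X.erase s, by simp, by simp [hrX], by rw [hcutE]; omega, ?_⟩
  simp only [Finset.mem_erase, ne_eq, h₁, h₂, h₃, h₄, not_false_eq_true, true_and]
  by_cases i1 : x₁ ∈ X <;> by_cases i2 : x₂ ∈ X <;> by_cases i3 : x₃ ∈ X <;>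
    by_cases i4 : x₄ ∈ X <;> simp [i1, i2, i3, i4] at hin hout' hout'' hcut ⊢ <;> omega

lemma FourCut.splitting {M : Multiset (Sym2 V)} {r s x₁ x₂ x₃ x₄ : V}
    (hM : FourCut (s(s, x₁) ::ₘ s(s, x₂) ::ₘ s(s, x₃) ::ₘ s(s, x₄) ::ₘ M) r) (hr : s ≠ r)
    (hs : ∀ e ∈ M, s ∉ e) (h₁ : x₁ ≠ s) (h₂ : x₂ ≠ s) (h₃ : x₃ ≠ s) (h₄ : x₄ ≠ s) :
    FourCut (s(x₁, x₂) ::ₘ s(x₃, x₄) ::ₘ M) r ∨ FourCut (s(x₁, x₃) ::ₘ s(x₂, x₄) ::ₘ M) r := by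
  by_contra! hcon
  obtain ⟨X, hsX, hrX, hX, a1, a2, a3⟩ := exists_of_not_fourCut hM hr hs h₁ h₂ h₃ h₄ hcon.1
  obtain ⟨Y, hsY, hrY, hY, b1, b2, b3⟩ := exists_of_not_fourCut
    (x₁ := x₁) (x₂ := x₃) (x₃ := x₂) (x₄ := x₄)
    (by rwa [Multiset.cons_swap s(s, x₃)]) hr hs h₁ h₃ h₂ h₄ hcon.2
  have key : ∀ Z : Finset V, r ∉ Z → s ∉ Z → (x₁ ∈ Z ∨ x₂ ∈ Z ∨ x₃ ∈ Z ∨ x₄ ∈ Z) →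
      4 ≤ cut M Z + (if x₁ ∈ Z then 1 else 0) + (if x₂ ∈ Z then 1 else 0) +
        (if x₃ ∈ Z then 1 else 0) + (if x₄ ∈ Z then 1 else 0) := by
    intro Z hrZ hsZ h
    have := hM Z hrZ (by
      rcases h with h | h | h | h
      · exact ⟨s(s, x₁), by simp, x₁, h, by simp⟩
      · exact ⟨s(s, x₂), by simp, x₂, h, by simp⟩
      · exact ⟨s(s, x₃), by simp, x₃, h, by simp⟩
      · exact ⟨s(s, x₄), by simp, x₄, h, by simp⟩)
    simp [hsZ] at this
    omega
  have hQ := hM (insert s (X ∪ Y)) (by simp [hr.symm, hrX, hrY])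
    ⟨s(s, x₁), by simp, s, by simp, by simp⟩
  simp only [cut_cons, cross_mk, cut_insert hs, Finset.mem_insert, h₁, h₂, h₃, h₄, true_or,
    false_or, true_iff, Finset.mem_union] at hQ
  have k1 := key (X ∩ Y) (by simp [hrX]) (by simp [hsX])
  have k2 := key (X \ Y) (by simp [hrX]) (by simp [hsX])
  have k3 := key (Y \ X) (by simp [hrY]) (by simp [hsY])
  simp only [Finset.mem_inter, Finset.mem_sdiff] at k1 k2 k3
  have c1 := cut_inter_add_cut_union M X Y
  have c2 := cut_sdiff_add_cut_sdiff M X Y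
  obtain ⟨k, c3⟩ := cut_parity M X Y
  by_cases i1 : x₁ ∈ X <;> by_cases j1 : x₁ ∈ Y <;>
    simp only [i1, j1, true_iff, false_iff, not_not] at a1 a3 b1 b3 <;>
    simp [i1, j1, a1, a3, b1, b3, ← a2, ← b2] at hQ k1 k2 k3 <;> omega

end Chains

namespace Chains

open Chain
variable {V : Type*} [DecidableEq V]

/-- The degree bonus of the root. -/
def rootBonus (r v : V) : ℕ := if v = r then 2 else 0

lemma card_filter_mem_eq_cut {M : Multiset (Sym2 V)} {s : V} (h : s(s, s) ∉ M) :
    (M.filter (s ∈ ·)).card = cut M {s} := by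
  induction M using Multiset.induction_on with
  | empty => simp
  | cons e M ih =>
    simp only [Multiset.mem_cons, not_or] at h
    have : cross {s} e = if s ∈ e then 1 else 0 := by
      induction e with | _ a b =>
      have h1 := h.1
      simp only [cross_mk, Finset.mem_singleton, Sym2.mem_iff, eq_comm (a := s)]
      by_cases ha : a = s <;> by_cases hb : b = s <;> simp_all
    rw [cut_cons, this, ← ih h.2, Multiset.filter_cons]
    split_ifs <;> simp [add_comm]

lemma exists_dec_of_erase {M : Multiset (Sym2 V)} {r : V} (hM : FourCut M r) {e : Sym2 V}
    (he : e ∈ M) {D : List (Chain V)} (hD : Dec (rootBonus r) (rootBonus r) D)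
    (hDM : total D = M.erase e) :
    ∃ D', Dec (rootBonus r) (rootBonus r) D' ∧ total D' = M := by
  have key : ∀ u ∈ e, ∃ A B, D = A ++ B ∧ 2 ≤ rootBonus r u + mdeg (total A) u ∧
      2 ≤ rootBonus r u + mdeg (total B) u := by
    intro u hu
    by_cases hur : u = r
    · exact ⟨[], D, rfl, by simp [rootBonus, hur], by simp [rootBonus, hur]⟩
    · apply hD.exists_split (by simp [rootBonus, hur]) (by simp [rootBonus, hur])
      have h1 := hM {u} (by simpa using Ne.symm hur) ⟨e, he, u, by simp, hu⟩
      rw [← Multiset.cons_erase he, cut_cons, ← hDM] at h1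
      have := cross_le_one {u} e
      have := cut_singleton_le_mdeg (total D) u
      omega
  induction e with | _ u v =>
  obtain ⟨D', h1, h2⟩ := hD.add_edge (key u (by simp)) (key v (by simp))
  exact ⟨D', h1, by rw [h2, hDM, Multiset.cons_erase he]⟩

lemma exists_degree_four {M : Multiset (Sym2 V)} {r : V} (hM : FourCut M r) (h0 : M ≠ 0)
    (hcrit : ∀ e ∈ M, ¬ FourCut (M.erase e) r) :
    ∃ s, s ≠ r ∧ s(s, s) ∉ M ∧ cut M {s} = 4 := by
  have tight : ∀ e ∈ M, ∃ X : Finset V, r ∉ X ∧ (∃ e ∈ M, ∃ v ∈ X, v ∈ e) ∧ cut M X = 4 ∧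
      cross X e = 1 := by
    intro e he
    have := hcrit e he
    simp only [FourCut, not_forall, not_le] at this
    obtain ⟨X, hr, ⟨f, hf, v, hv, hvf⟩, hc⟩ := this
    have ht : ∃ e ∈ M, ∃ v ∈ X, v ∈ e := ⟨f, Multiset.mem_of_mem_erase hf, v, hv, hvf⟩
    have h1 := hM X hr ht
    have h2 : cut M X = cross X e + cut (M.erase e) X := by
      rw [← cut_cons, Multiset.cons_erase he]
    have := cross_le_one X e
    exact ⟨X, hr, ht, by omega, by omega⟩
  have hex : ∃ n, ∃ X : Finset V, X.card = n ∧ r ∉ X ∧ (∃ e ∈ M, ∃ v ∈ X, v ∈ e) ∧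
      cut M X = 4 := by
    obtain ⟨e, he⟩ := Multiset.exists_mem_of_ne_zero h0
    obtain ⟨X, h1, h2, h3, -⟩ := tight e he
    exact ⟨_, X, rfl, h1, h2, h3⟩
  classical
  obtain ⟨X, hXn, hrX, hX, hcX⟩ := Nat.find_spec hex
  have hmin : ∀ Z : Finset V, r ∉ Z → (∃ e ∈ M, ∃ v ∈ Z, v ∈ e) → cut M Z = 4 →
      X.card ≤ Z.card := fun Z h1 h2 h3 => by
    rw [hXn]; exact Nat.find_min' hex ⟨Z, rfl, h1, h2, h3⟩
  have hind : ∀ a b, s(a, b) ∈ M → a ∈ X → b ∈ X → False := by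
    have aux : ∀ (Y : Finset V) a b, s(a, b) ∈ M → a ∈ X → b ∈ X → a ∈ Y → b ∉ Y → r ∉ Y →
        cut M Y = 4 → False := by
      intro Y a b hab ha hb haY hbY hrY hcY
      have hI : ∃ e ∈ M, ∃ v ∈ X ∩ Y, v ∈ e := ⟨_, hab, a, by simp [ha, haY], by simp⟩
      have h1 := hM (X ∩ Y) (by simp [hrX]) hI
      have h2 := hM (X ∪ Y) (by simp [hrX, hrY]) ⟨_, hab, a, by simp [ha], by simp⟩
      have h3 := cut_inter_add_cut_union M X Y
      have h4 := hmin (X ∩ Y) (by simp [hrX]) hI (by omega)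
      have h5 : X ∩ Y = X := Finset.eq_of_subset_of_card_le Finset.inter_subset_left h4
      exact hbY (Finset.mem_inter.1 (h5 ▸ hb)).2
    intro a b hab ha hb
    obtain ⟨Y, hrY, -, hcY, hcr⟩ := tight _ hab
    by_cases haY : a ∈ Y
    · exact aux Y a b hab ha hb haY (fun h => by simp [haY, h] at hcr) hrY hcY
    · exact aux Y b a (Sym2.eq_swap ▸ hab) hb ha (by by_contra h; simp [haY, h] at hcr) haY hrY hcY
  obtain ⟨e, he, s, hs, hse⟩ := hX
  have hsr : s ≠ r := fun h => hrX (h ▸ hs)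
  refine ⟨s, hsr, fun h => hind s s h hs hs, le_antisymm ?_
    (hM _ (by simpa using hsr.symm) ⟨e, he, s, by simp, hse⟩)⟩
  rw [← hcX]
  refine Multiset.sum_map_le_sum_map _ _ fun g hg => ?_
  induction g with | _ a b =>
  simp only [cross_mk, Finset.mem_singleton]
  have h1 := hind a b hg
  by_cases ha : a = s <;> by_cases hb : b = s <;> simp_all

lemma exists_eq_cons_four {M : Multiset (Sym2 V)} {s : V} (hs : s(s, s) ∉ M)
    (hc : cut M {s} = 4) :
    ∃ x₁ x₂ x₃ x₄ M', M = s(s, x₁) ::ₘ s(s, x₂) ::ₘ s(s, x₃) ::ₘ s(s, x₄) ::ₘ M' ∧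
      x₁ ≠ s ∧ x₂ ≠ s ∧ x₃ ≠ s ∧ x₄ ≠ s ∧ ∀ e ∈ M', s ∉ e := by
  have h4 := card_filter_mem_eq_cut hs
  obtain ⟨e, f, g, k, hN⟩ := Multiset.card_eq_four.1 (h4.trans hc)
  have hM := Multiset.filter_add_not (s ∈ ·) M
  have hmem : ∀ a ∈ M.filter (s ∈ ·), ∃ x, x ≠ s ∧ a = s(s, x) := by
    intro a ha
    rw [Multiset.mem_filter] at ha
    obtain ⟨x, rfl⟩ := ha.2
    exact ⟨x, fun h => hs (h ▸ ha.1), rfl⟩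
  rw [hN] at hM hmem
  obtain ⟨x₁, h1, rfl⟩ := hmem e (by simp)
  obtain ⟨x₂, h2, rfl⟩ := hmem f (by simp)
  obtain ⟨x₃, h3, rfl⟩ := hmem g (by simp)
  obtain ⟨x₄, h5, rfl⟩ := hmem k (by simp)
  exact ⟨x₁, x₂, x₃, x₄, M.filter (s ∉ ·), hM.symm.trans (by simp [Multiset.insert_eq_cons]),
    h1, h2, h3, h5,
    fun e he => (Multiset.mem_filter.1 he).2⟩

/-- A multigraph in which every cut avoiding `r` has at least four edges has a chain
decomposition rooted at `r`. -/
theorem FourCut.exists_dec {M : Multiset (Sym2 V)} {r : V} (hM : FourCut M r) :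
    ∃ D, Dec (rootBonus r) (rootBonus r) D ∧ total D = M := by
  induction hn : M.card using Nat.strong_induction_on generalizing M with
  | _ n ih =>
  by_cases h0 : M = 0
  · exact ⟨[], trivial, h0.symm⟩
  by_cases hcrit : ∃ e ∈ M, FourCut (M.erase e) r
  · obtain ⟨e, he, h⟩ := hcrit
    obtain ⟨D, hD, hDM⟩ := ih _ (hn ▸ Multiset.card_erase_lt_of_mem he) h rfl
    exact exists_dec_of_erase hM he hD hDM
  push Not at hcrit
  obtain ⟨s, hsr, hss, hc⟩ := exists_degree_four hM h0 hcrit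
  obtain ⟨x₁, x₂, x₃, x₄, M', rfl, h1, h2, h3, h4, hM'⟩ := exists_eq_cons_four hss hc
  simp only [Multiset.card_cons] at hn
  rcases hM.splitting hsr hM' h1 h2 h3 h4 with h | h
  · obtain ⟨D, hD, hDM⟩ := ih _ (by simp only [Multiset.card_cons]; omega) h rfl
    obtain ⟨D', hD', hDM'⟩ := hD.pinch (t := s) hDM (by rw [hDM]; simp_all [eq_comm])
    refine ⟨D', hD', hDM'.trans ?_⟩
    simp only [star_mk, Multiset.insert_eq_cons, ← Multiset.singleton_add]
    abel
  · obtain ⟨D, hD, hDM⟩ := ih _ (by simp only [Multiset.card_cons]; omega) h rfl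
    obtain ⟨D', hD', hDM'⟩ := hD.pinch (t := s) hDM (by rw [hDM]; simp_all [eq_comm])
    refine ⟨D', hD', hDM'.trans ?_⟩
    simp only [star_mk, Multiset.insert_eq_cons, ← Multiset.singleton_add]
    abel

end Chains

namespace MG

open Chains Chains.Chain Classical
variable {G : MG}

lemma isLink_iff {vs : List G.V} {es : List G.E} (h : vs ≠ []) :
    G.IsLink vs es ↔ es.map G.ends = walkEdges vs := by
  induction vs generalizing es with
  | nil => simp at h
  | cons a vs ih =>
    cases vs with
    | nil => cases es <;> simp [IsLink]
    | cons b vs => cases es <;> simp [IsLink, ih]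

lemma deg_insert {F : Set G.E} (hF : F.Finite) {e : G.E} (he : e ∉ F) (v : G.V) :
    G.deg (insert e F) v = endCount v (G.ends e) + G.deg F v := by
  have key : ∀ p : G.E → Prop, {x ∈ insert e F | p x}.ncard =
      (if p e then 1 else 0) + {x ∈ F | p x}.ncard := by
    intro p
    split_ifs with h
    · have : {x ∈ insert e F | p x} = insert e {x ∈ F | p x} := by
        ext x; simp only [Set.mem_ofPred_eq, Set.mem_insert_iff]; grind
      rw [this, Set.ncard_insert_of_notMem (fun h => he h.1) (hF.subset (Set.sep_subset _ _)),
        add_comm]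
    · have : {x ∈ insert e F | p x} = {x ∈ F | p x} := by
        ext x; simp only [Set.mem_ofPred_eq, Set.mem_insert_iff]; grind
      rw [this, zero_add]
  rw [deg, deg, key, key]
  generalize G.ends e = p
  induction p with | _ a b =>
  by_cases h1 : v = a <;> by_cases h2 : v = b <;> simp [h1, h2] <;> grind

lemma deg_eq_mdeg {L : List G.E} (hL : L.Nodup) (v : G.V) :
    G.deg {e | e ∈ L} v = mdeg (L.map G.ends : Multiset (Sym2 G.V)) v := by
  induction L with
  | nil => simp [deg]
  | cons e L ih =>
    rw [List.nodup_cons] at hL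
    have : {x | x ∈ e :: L} = insert e {x | x ∈ L} := by ext; simp
    rw [this, deg_insert L.finite_toSet hL.1, ih hL.2, List.map_cons, ← Multiset.cons_coe,
      mdeg_cons]

lemma isOpenUpChain_of_ok {r : G.V} {L₁ L₂ es : List G.E} {l : List G.V}
    (h₂ : L₂.Nodup) (hes : es.Nodup) (h0 : es ≠ [])
    (hd₁ : es.Disjoint L₁) (hd₂ : es.Disjoint L₂) (hl : es.map G.ends = walkEdges l)
    (hok : (up l).Ok (fun v => rootBonus r v + mdeg (L₁.map G.ends : Multiset (Sym2 G.V)) v)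
      (fun v => rootBonus r v + mdeg (L₂.map G.ends : Multiset (Sym2 G.V)) v)) :
    G.IsOpenUpChain r {e | e ∈ L₁} {e | e ∈ L₂} {e | e ∈ es} := by
  obtain ⟨hn, hb, hh, ht⟩ := hok
  have hl0 : l ≠ [] := by rintro rfl; simp at hl; exact h0 hl
  have key : ∀ v, 1 ≤ rootBonus r v + mdeg (L₁.map G.ends : Multiset (Sym2 G.V)) v →
      v = r ∨ v ∈ G.vertsOf {e | e ∈ L₁} := by
    intro v hv
    by_contra! h
    rw [rootBonus, if_neg h.1, mdeg_eq_zero] at hv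
    · omega
    · intro e he hve
      obtain ⟨f, hf, rfl⟩ := List.mem_map.1 (Multiset.mem_coe.1 he)
      exact h.2 ⟨f, hf, hve⟩
  refine ⟨Set.disjoint_left.2 fun e => @hd₁ e, Set.disjoint_left.2 fun e => @hd₂ e, l, es,
    ⟨hn, hes, (isLink_iff hl0).2 hl⟩, h0, rfl, fun v hv => ?_, fun v hv => key v (hh v hv),
    fun v hv => key v (ht v hv)⟩
  have := hb v hv
  rw [deg_eq_mdeg h₂]
  by_cases h : v = r
  · exact .inl h
  · right; simpa [rootBonus, h] using this

lemma isChain_of_ok {r : G.V} {L₁ L₂ es : List G.E} {c : Chain G.V}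
    (h₁ : L₁.Nodup) (h₂ : L₂.Nodup) (hes : es.Nodup) (h0 : es ≠ [])
    (hd₁ : es.Disjoint L₁) (hd₂ : es.Disjoint L₂) (hl : es.map G.ends = c.edges)
    (hok : c.Ok (fun v => rootBonus r v + mdeg (L₁.map G.ends : Multiset (Sym2 G.V)) v)
      (fun v => rootBonus r v + mdeg (L₂.map G.ends : Multiset (Sym2 G.V)) v)) :
    G.IsChain r {e | e ∈ L₁} {e | e ∈ L₂} {e | e ∈ es} := by
  cases c with
  | up l => exact .inl (.inl (isOpenUpChain_of_ok h₂ hes h0 hd₁ hd₂ hl hok))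
  | down l => exact .inr (.inl (.inl (isOpenUpChain_of_ok h₁ hes h0 hd₂ hd₁ hl hok)))
  | oneWay u v =>
    obtain ⟨hu, hv⟩ := hok
    obtain ⟨e, rfl, he⟩ : ∃ e, es = [e] ∧ G.ends e = s(u, v) := by simpa using hl
    refine .inr (.inr ⟨u, v, e, ?_, ?_, by simp, he, ?_, ?_⟩)
    · exact fun h => hd₁ (by simp) h
    · exact fun h => hd₂ (by simp) h
    · rw [deg_eq_mdeg h₁]
      by_cases h : u = r
      · exact .inl h
      · right; simpa [rootBonus, h] using hu
    · rw [deg_eq_mdeg h₂]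
      by_cases h : v = r
      · exact .inl h
      · right; simpa [rootBonus, h] using hv

lemma exists_list_of_map_eq {α β : Type*} (f : α → β) {l : List β} {N : Multiset α}
    {M : Multiset β} (h : N.map f = l + M) :
    ∃ (es : List α) (N' : Multiset α), es.map f = l ∧ N = es + N' ∧ N'.map f = M := by
  induction l generalizing N with
  | nil => exact ⟨[], N, rfl, by simp, by simpa using h⟩
  | cons b l ih =>
    obtain ⟨a, ha, rfl⟩ : ∃ a ∈ N, f a = b := by rw [← Multiset.mem_map, h]; simp
    obtain ⟨N, rfl⟩ := Multiset.exists_cons_of_mem ha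
    obtain ⟨es, N', h1, rfl, h3⟩ := ih (N := N) (by
      rwa [Multiset.map_cons, ← Multiset.cons_coe, Multiset.cons_add, Multiset.cons_inj_right] at h)
    exact ⟨a :: es, N', by simp [h1], by simp [← Multiset.cons_coe], h3⟩

lemma exists_named {D : List (Chain G.V)} {N : Multiset G.E} (h : N.map G.ends = total D) :
    ∃ P : List (Chain G.V × List G.E), P.map Prod.fst = D ∧
      (∀ p ∈ P, p.2.map G.ends = p.1.edges) ∧ (P.flatMap Prod.snd : Multiset G.E) = N := by
  induction D generalizing N with
  | nil => exact ⟨[], rfl, by simp, by simpa [eq_comm] using h⟩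
  | cons c D ih =>
    obtain ⟨es, N', h1, rfl, h3⟩ := exists_list_of_map_eq _ h
    obtain ⟨P, rfl, h4, h5⟩ := ih h3
    exact ⟨(c, es) :: P, by simp, by simpa [h1] using h4, by simp [← h5]⟩

lemma total_map_fst {P : List (Chain G.V × List G.E)}
    (h : ∀ p ∈ P, p.2.map G.ends = p.1.edges) :
    total (P.map Prod.fst) = ((P.flatMap Prod.snd).map G.ends : Multiset (Sym2 G.V)) := by
  induction P with
  | nil => simp
  | cons p P ih => simp_all

lemma hasChainDecomp_of_dec [Finite G.E] [Nonempty G.E] {r : G.V} {D : List (Chain G.V)}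
    (hD : Dec (rootBonus r) (rootBonus r) D) (h0 : ∀ c ∈ D, c.edges ≠ []) {N : Multiset G.E}
    (hN : N.Nodup) (hmem : ∀ e, e ∈ N) (hDN : N.map G.ends = total D) :
    G.HasChainDecomp r := by
  obtain ⟨P, rfl, hP, rfl⟩ := exists_named hDN
  rw [Multiset.coe_nodup] at hN
  suffices ∃ n, ∃ Gs : Fin n → Set G.E, G.IsChainDecomp r Gs by
    obtain ⟨n, Gs, h⟩ := this
    cases n with
    | zero =>
      obtain ⟨e⟩ := ‹Nonempty G.E›
      have := h.2.1 ▸ Set.mem_univ e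
      simp at this
    | succ n => exact ⟨n, Gs, h⟩
  refine ⟨P.length, fun i => {e | e ∈ P[i].2}, fun i j hij => ?_, ?_, fun i => ?_⟩
  · rw [List.nodup_flatMap] at hN
    have hp := hN.2
    rw [List.pairwise_iff_getElem] at hp
    rw [Set.disjoint_left]
    intro e h1 h2
    rcases lt_or_gt_of_ne (Fin.val_ne_of_ne hij) with h | h
    · exact hp i j i.2 j.2 h h1 h2
    · exact hp j i j.2 i.2 h h2 h1
  · ext e
    have := hmem e
    simp only [Multiset.mem_coe, List.mem_flatMap] at this
    obtain ⟨p, hp, he⟩ := this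
    obtain ⟨i, hi, rfl⟩ := List.getElem_of_mem hp
    simpa using ⟨⟨i, hi⟩, he⟩
  · have hsplit : P = P.take i ++ P[i] :: P.drop (i + 1) := by simp
    have hb : G.before (fun i : Fin P.length => {e | e ∈ P[i].2}) i =
        {e | e ∈ (P.take i).flatMap Prod.snd} := by
      ext e
      simp only [before, Set.mem_ofPred_eq, List.mem_flatMap, List.mem_take_iff_getElem]
      constructor
      · rintro ⟨j, hj, he⟩
        exact ⟨_, ⟨j, by have := j.2; simp; omega, rfl⟩, he⟩
      · rintro ⟨_, ⟨j, hj, rfl⟩, he⟩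
        exact ⟨⟨j, by omega⟩, by simp [Fin.lt_def]; omega, he⟩
    have ha : G.after (fun i : Fin P.length => {e | e ∈ P[i].2}) i =
        {e | e ∈ (P.drop (i + 1)).flatMap Prod.snd} := by
      ext e
      simp only [after, Set.mem_ofPred_eq, List.mem_flatMap, List.mem_drop_iff_getElem]
      constructor
      · rintro ⟨j, hj, he⟩
        refine ⟨_, ⟨j - (i + 1), by have := j.2; rw [Fin.lt_def] at hj; omega, rfl⟩, ?_⟩
        have : (i : ℕ) + 1 + (j - (i + 1)) = j := by rw [Fin.lt_def] at hj; omega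
        simpa [this] using he
      · rintro ⟨_, ⟨j, hj, rfl⟩, he⟩
        exact ⟨⟨i + 1 + j, by omega⟩, by simp [Fin.lt_def]; omega, he⟩
    rw [hb, ha]
    have hA : ∀ p ∈ P.take i, p.2.map G.ends = p.1.edges :=
      fun p hp => hP p (List.mem_of_mem_take hp)
    have hB : ∀ p ∈ P.drop (i + 1), p.2.map G.ends = p.1.edges :=
      fun p hp => hP p (List.mem_of_mem_drop hp)
    have hi := List.getElem_mem i.2
    have hPi := hP _ hi
    have h0i := h0 _ (List.mem_map_of_mem hi)
    generalize P.take i = A at *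
    generalize P.drop (i + 1) = B at *
    change P = A ++ P[(i : ℕ)] :: B at hsplit
    change G.IsChain r _ _ {e | e ∈ P[(i : ℕ)].2}
    generalize P[(i : ℕ)] = p at *
    subst hsplit
    rw [List.map_append, List.map_cons, dec_append, dec_cons, total_map_fst hA, total_map_fst hB]
      at hD
    rw [List.flatMap_append, List.flatMap_cons, List.nodup_append', List.nodup_append',
      List.disjoint_append_right] at hN
    refine isChain_of_ok hN.1 hN.2.1.2.1 hN.2.1.1 ?_ hN.2.2.1.symm hN.2.1.2.2 hPi hD.2.1
    rintro h
    simp [h] at hPi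
    exact h0i hPi

lemma FourEdgeConnected.fourCut [Fintype G.E] (h : G.FourEdgeConnected) (r : G.V) :
    FourCut ((Finset.univ : Finset G.E).val.map G.ends) r := by
  rintro X hr ⟨-, -, v, hv, -⟩
  by_contra! hlt
  have hc : cut ((Finset.univ : Finset G.E).val.map G.ends) X =
      {e | cross X (G.ends e) = 1}.ncard := by
    rw [Set.ncard_eq_toFinset_card', cut, Multiset.map_map, Finset.card_eq_sum_ones,
      Set.toFinset_ofPred, Finset.sum_filter]
    refine Finset.sum_congr rfl fun e _ => ?_
    have := cross_le_one X (G.ends e)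
    simp only [Function.comp]
    split_ifs <;> omega
  have hreach := h.2 {e | cross X (G.ends e) = 1} (Set.toFinite _) (hc ▸ hlt) r v
  clear hlt hc
  induction hreach with
  | refl => exact hr hv
  | @tail a b _ hab ih =>
    obtain ⟨e, he, hab⟩ := hab
    exact ih (by_contra fun ha => he (by simp [hab, ha, hv]))

theorem FourEdgeConnected.hasChainDecomp [Finite G.E] [Nonempty G.E]
    (h : G.FourEdgeConnected) (r : G.V) : G.HasChainDecomp r := by
  have := Fintype.ofFinite G.E
  obtain ⟨D, hD, hDM⟩ := (h.fourCut r).exists_dec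
  obtain ⟨D', hD', hDM', h0⟩ := hD.exists_nonempty
  exact hasChainDecomp_of_dec hD' h0 Finset.univ.nodup (by simp) (hDM.symm.trans hDM'.symm)

end MG

namespace MG

open Chains Chains.Chain Classical
variable {G : MG}

lemma IsLink.mem_of_mem {vs : List G.V} {es : List G.E} (h : G.IsLink vs es) {e : G.E}
    (he : e ∈ es) {v : G.V} (hv : v ∈ G.ends e) : v ∈ vs := by
  have h0 : vs ≠ [] := by rintro rfl; simp [IsLink] at h
  rw [isLink_iff h0] at h
  exact mem_of_mem_walkEdges (h ▸ List.mem_map_of_mem he) hv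

lemma IsPath.exists_from {vs : List G.V} {es : List G.E} (h : G.IsPath vs es) {a : G.V}
    (ha : a ∈ vs) : ∃ vs' es', G.IsPath vs' es' ∧ vs'.head? = some a ∧
      vs'.getLast? = vs.getLast? ∧ es' ⊆ es := by
  induction vs generalizing es with
  | nil => simp at ha
  | cons b vs ih =>
    by_cases hab : a = b
    · exact ⟨b :: vs, es, h, by simp [hab], rfl, by simp⟩
    · have ha' : a ∈ vs := by simpa [hab] using ha
      obtain ⟨h1, h2, h3⟩ := h
      cases vs with
      | nil => simp at ha'
      | cons c vs =>
        cases es with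
        | nil => simp [IsLink] at h3
        | cons e es =>
          obtain ⟨vs', es', h4, h5, h6, h7⟩ := ih (es := es) ⟨h1.of_cons, h2.of_cons, h3.2⟩ ha'
          exact ⟨vs', es', h4, h5, by simp [h6], fun x hx => List.mem_cons_of_mem _ (h7 hx)⟩

lemma Reach.exists_path {F : Set G.E} {a b : G.V} (h : G.Reach F a b) :
    ∃ vs es, G.IsPath vs es ∧ vs.head? = some a ∧ vs.getLast? = some b ∧ ∀ e ∈ es, e ∈ F := by
  induction h using Relation.ReflTransGen.head_induction_on with
  | refl => exact ⟨[b], [], by simp [IsPath, IsLink], rfl, rfl, by simp⟩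
  | @head a c hac _ ih =>
    obtain ⟨e, he, hac⟩ := hac
    obtain ⟨vs, es, h1, h2, h3, h4⟩ := ih
    by_cases ha : a ∈ vs
    · obtain ⟨vs', es', h5, h6, h7, h8⟩ := h1.exists_from ha
      exact ⟨vs', es', h5, h6, h7.trans h3, fun e he => h4 e (h8 he)⟩
    · cases vs with
      | nil => simp at h2
      | cons d vs =>
        obtain rfl : d = c := by simpa using h2
        refine ⟨a :: d :: vs, e :: es, ⟨by simp_all [IsPath], ?_, hac, h1.2.2⟩, rfl,
          by simpa using h3, by simp_all⟩
        exact List.nodup_cons.2 ⟨fun h => ha (h1.2.2.mem_of_mem h (by simp [hac])), h1.2.1⟩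

lemma IsLink.reach {F : Set G.E} {vs : List G.V} {es : List G.E} (h : G.IsLink vs es)
    (hF : ∀ e ∈ es, e ∈ F) {a b : G.V} (ha : vs.head? = some a) (hb : vs.getLast? = some b) :
    G.Reach F a b := by
  induction vs generalizing es a with
  | nil => simp at ha
  | cons c vs ih =>
    obtain rfl : c = a := by simpa using ha
    cases vs with
    | nil =>
      obtain rfl : c = b := by simpa using hb
      exact .refl
    | cons d vs =>
      cases es with
      | nil => simp [IsLink] at h
      | cons e es =>
        exact .head ⟨e, hF e (by simp), h.1⟩
          (ih h.2 (fun e he => hF e (by simp [he])) rfl (by simpa using hb))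

lemma Reach.symm {F : Set G.E} {a b : G.V} (h : G.Reach F a b) : G.Reach F b a :=
  haveI : Std.Symm (fun a b => ∃ e ∈ F, G.ends e = s(a, b)) :=
    ⟨fun _ _ ⟨e, he, hab⟩ => ⟨e, he, hab.trans Sym2.eq_swap⟩⟩
  Relation.ReflTransGen.stdSymm.symm _ _ h

theorem HasFourEIST.fourEdgeConnected {r : G.V} (h : G.HasFourEIST r) (hV : 2 ≤ Nat.card G.V) :
    G.FourEdgeConnected := by
  obtain ⟨T, hT, hind⟩ := h
  refine ⟨hV, fun S hS hcard => ?_⟩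
  suffices ∀ v, G.Reach Sᶜ r v from fun a b => (this a).symm.trans (this b)
  intro v
  have hv : ∀ i w, w ∈ (T i).verts := fun i w => (hT i).2 ▸ Set.mem_univ w
  have hpath : ∀ i, ∃ vs es, (T i).PathIn r v vs es := fun i =>
    Reach.exists_path ((hT i).1.1.2 r (hv i r) v (hv i v))
  choose vs es hp using hpath
  by_cases hex : ∃ i, ∀ e ∈ es i, e ∈ Sᶜ
  · obtain ⟨i, hi⟩ := hex
    exact (hp i).1.2.2.reach hi (hp i).2.1 (hp i).2.2.1
  · push Not at hex
    choose f hf hfS using hex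
    have hinj : Function.Injective f := fun i j hij => by
      by_contra hne
      exact (hind i j hne).2.2 v ⟨hv i v, hv j v⟩ _ _ _ _ (hp i) (hp j) _ (hf i) (hij ▸ hf j)
    have : (Set.range f).ncard ≤ S.ncard :=
      Set.ncard_le_ncard (by rintro _ ⟨i, rfl⟩; simpa using hfS i) hS
    rw [Set.ncard_range_of_injective hinj] at this
    simp at this
    omega

end MG

namespace MG

open Chains Chains.Chain Classical
variable {G : MG}

/-- Every vertex of `U` other than `r` has a parent edge in `H` leading to a parent in `W`, and
`f` increases along parent edges away from the root. -/
def Half (r : G.V) (H : Set G.E) (U W : Set G.V) (a : G.V → G.E) (p : G.V → G.V)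
    (f : G.E → ℚ) : Prop :=
  ∀ v ∈ U, v ≠ r → a v ∈ H ∧ G.ends (a v) = s(v, p v) ∧ p v ∈ W ∧
    (p v = r ∨ f (a (p v)) < f (a v))

lemma Half.mono {r : G.V} {H H' : Set G.E} {U U' W W' : Set G.V} {a : G.V → G.E} {p : G.V → G.V}
    {f : G.E → ℚ} (h : Half r H U W a p f) (hH : H ⊆ H') (hU : U' ⊆ U) (hW : W ⊆ W') :
    Half r H' U' W' a p f := fun v hv hr =>
  have ⟨h1, h2, h3, h4⟩ := h v (hU hv) hr
  ⟨hH h1, h2, hW h3, h4⟩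

/-- If only the values outside `W` and `H` change, the parent structure on `W` persists. -/
lemma Half.congr {r : G.V} {H : Set G.E} {W : Set G.V} {a a' : G.V → G.E} {p p' : G.V → G.V}
    {f f' : G.E → ℚ} (h : Half r H W W a p f) (ha : ∀ v ∈ W, a' v = a v ∧ p' v = p v)
    (hf : ∀ e ∈ H, f' e = f e) : Half r H W W a' p' f' := by
  intro v hv hr
  obtain ⟨h1, h2, h3, h4⟩ := h v hv hr
  rw [(ha v hv).1, (ha v hv).2, (ha _ h3).1, hf _ h1]
  refine ⟨h1, h2, h3, ?_⟩
  by_cases hp : p v = r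
  · exact .inl hp
  · rw [hf _ (h _ h3 hp).1]
    exact h4

lemma Half.congr_edges {r : G.V} {H : Set G.E} {U W : Set G.V} {a : G.V → G.E} {p : G.V → G.V}
    {f f' : G.E → ℚ} (h : Half r H U W a p f) (hWU : W ⊆ U) (hf : ∀ e ∈ H, f' e = f e) :
    Half r H U W a p f' := by
  intro v hv hr
  obtain ⟨h1, h2, h3, h4⟩ := h v hv hr
  refine ⟨h1, h2, h3, ?_⟩
  by_cases hp : p v = r
  · exact .inl hp
  · rw [hf _ h1, hf _ (h _ (hWU h3) hp).1]
    exact h4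

/-- Give the vertex `v ∉ W` the parent edge `e`. -/
lemma Half.update {r : G.V} {H : Set G.E} {U W : Set G.V} {a : G.V → G.E} {p : G.V → G.V}
    {f f' : G.E → ℚ} (h : Half r H U W a p f) (hWU : W ⊆ U) {u v : G.V} {e : G.E}
    (hu : u ∈ W) (hv : v ∉ W) (he : G.ends e = s(u, v)) (hf : ∀ e ∈ H, f' e = f e)
    (hlt : u = r ∨ f (a u) < f' e) :
    Half r (insert e H) (insert v U) W (Function.update a v e) (Function.update p v u) f' := by
  have key : ∀ w ∈ W, w ≠ v := fun w hw h => hv (h ▸ hw)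
  intro w hw hr
  by_cases hwv : w = v
  · subst hwv
    simp only [Function.update_self, Function.update_of_ne (key u hu)]
    refine ⟨by simp, he.trans Sym2.eq_swap, hu, ?_⟩
    by_cases hur : u = r
    · exact .inl hur
    · rw [hf _ (h u (hWU hu) hur).1]
      exact hlt
  · have hw : w ∈ U := hw.resolve_left hwv
    obtain ⟨h1, h2, h3, h4⟩ := h w hw hr
    simp only [Function.update_of_ne hwv, Function.update_of_ne (key _ h3)]
    refine ⟨.inr h1, h2, h3, ?_⟩
    by_cases hp : p w = r
    · exact .inl hp
    · rw [hf _ h1, hf _ (h _ (hWU h3) hp).1]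
      exact h4

/-- The edges `e 0, …, e (n - 1)` form a path through `x 0, …, x n`, closed only at a
vertex of `W`. -/
structure Ear (W : Set G.V) (x : ℕ → G.V) (e : ℕ → G.E) (n : ℕ) : Prop where
  link : ∀ j < n, G.ends (e j) = s(x j, x (j + 1))
  inj : ∀ i j, i < j → j ≤ n → x i = x j → i = 0 ∧ j = n ∧ x 0 ∈ W
  einj : ∀ i j, i < n → j < n → e i = e j → i = j

lemma Ear.reverse {W : Set G.V} {x : ℕ → G.V} {e : ℕ → G.E} {n : ℕ} (h : Ear W x e n) :
    Ear W (fun j => x (n - j)) (fun j => e (n - 1 - j)) n where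
  link j hj := by
    rw [h.link _ (by omega), Sym2.eq_swap, show n - 1 - j + 1 = n - j by omega,
      show n - 1 - j = n - (j + 1) by omega]
  inj i j hij hj hx := by
    obtain ⟨h1, h2, h3⟩ := h.inj (n - j) (n - i) (by omega) (by omega) hx.symm
    refine ⟨by omega, by omega, ?_⟩
    have : x (n - j) ∈ W := by rwa [h1]
    rw [← hx] at this
    simpa [show i = 0 by omega] using this
  einj i j hi hj hij := by
    have := h.einj _ _ (by omega) (by omega) hij
    omega

lemma image_sub_Iic {α : Type*} (x : ℕ → α) (n : ℕ) :
    (fun j => x (n - j)) '' Set.Iic n = x '' Set.Iic n := by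
  ext v
  constructor
  · rintro ⟨j, -, rfl⟩
    exact ⟨n - j, by simp, rfl⟩
  · rintro ⟨j, hj, rfl⟩
    exact ⟨n - j, by simp, by simp only [Set.mem_Iic] at hj; simp [Nat.sub_sub_self hj]⟩

lemma image_sub_Iio {α : Type*} (x : ℕ → α) (n : ℕ) :
    (fun j => x (n - 1 - j)) '' Set.Iio n = x '' Set.Iio n := by
  ext v
  constructor
  · rintro ⟨j, hj, rfl⟩
    exact ⟨n - 1 - j, by simp only [Set.mem_Iio] at *; omega, rfl⟩
  · rintro ⟨j, hj, rfl⟩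
    simp only [Set.mem_Iio] at hj
    exact ⟨n - 1 - j, by simp only [Set.mem_Iio]; omega,
      by simp [Nat.sub_sub_self (show j ≤ n - 1 by omega)]⟩

lemma Half.ear {r : G.V} {H : Set G.E} {U W : Set G.V} {a : G.V → G.E} {p : G.V → G.V}
    {f f' : G.E → ℚ} (h : Half r H U W a p f) (hWU : W ⊆ U)
    {x : ℕ → G.V} {e : ℕ → G.E} {n : ℕ} (hx : Ear W x e n) (h0 : x 0 ∈ U)
    (hxint : ∀ j, 0 < j → j < n → x j ∉ U) (hf : ∀ g ∈ H, f' g = f g)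
    (hmono : ∀ j, j + 1 < n → f' (e j) < f' (e (j + 1)))
    (hlt : x 0 = r ∨ f (a (x 0)) < f' (e 0)) :
    ∃ a' p', Half r (H ∪ e '' Set.Iio n) (U ∪ x '' Set.Iic n) (W ∪ x '' Set.Iic n) a' p' f' ∧
      (∀ v, (∀ j < n, v ∉ W → v ≠ x (j + 1)) → a' v = a v ∧ p' v = p v) ∧
      ∀ j < n, x (j + 1) ∉ W → a' (x (j + 1)) = e j := by
  let y : {j : Fin n // x (j + 1) ∉ W} → G.V := fun j => x (j.1 + 1)
  have hy : Function.Injective y := by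
    intro i j hij
    by_contra hne
    have : (i.1 : ℕ) ≠ j.1 := fun h => hne (Subtype.ext (Fin.ext h))
    rcases lt_or_gt_of_ne this with hlt | hlt
    · have := hx.inj _ _ (Nat.add_lt_add_right hlt 1) (by omega) hij
      omega
    · have := hx.inj _ _ (Nat.add_lt_add_right hlt 1) (by omega) hij.symm
      omega
  let a' : G.V → G.E := Function.extend y (fun j => e j.1) a
  let p' : G.V → G.V := Function.extend y (fun j => x j.1) p
  have k1 : ∀ j < n, x (j + 1) ∉ W → a' (x (j + 1)) = e j ∧ p' (x (j + 1)) = x j :=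
    fun j hj hW => ⟨hy.extend_apply (fun j => e j.1) a ⟨⟨j, hj⟩, hW⟩,
      hy.extend_apply (fun j => x j.1) p ⟨⟨j, hj⟩, hW⟩⟩
  have k2 : ∀ v, (∀ j < n, v ∉ W → v ≠ x (j + 1)) → a' v = a v ∧ p' v = p v := by
    intro v hv
    have : ¬ ∃ j, y j = v := by
      rintro ⟨⟨j, hj⟩, rfl⟩
      exact hv j j.2 hj rfl
    exact ⟨Function.extend_apply' _ _ _ this, Function.extend_apply' _ _ _ this⟩
  refine ⟨a', p', ?_, k2, fun j hj hW => (k1 j hj hW).1⟩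
  have k3 : ∀ v ∈ U, v ≠ r → f' (a v) = f (a v) := fun v hv hvr => hf _ (h v hv hvr).1
  intro v hv hvr
  by_cases hon : ∃ j < n, v ∉ W ∧ v = x (j + 1)
  · obtain ⟨j, hj, hW, rfl⟩ := hon
    rw [(k1 j hj hW).1, (k1 j hj hW).2]
    refine ⟨.inr ⟨j, hj, rfl⟩, (hx.link j hj).trans Sym2.eq_swap,
      .inr ⟨j, hj.le, rfl⟩, ?_⟩
    cases j with
    | zero =>
      by_cases hr0 : x 0 = r
      · exact .inl hr0
      · have h00 : ∀ j < n, x 0 ∉ W → x 0 ≠ x (j + 1) := fun j hj hW he =>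
          hW (hx.inj 0 (j + 1) (by omega) (by omega) he).2.2
        rw [(k2 _ h00).1, k3 _ h0 hr0]
        exact .inr (hlt.resolve_left hr0)
    | succ i =>
      right
      rw [(k1 i (by omega) fun hW => hxint (i + 1) (by omega) hj (hWU hW)).1]
      exact hmono i hj
  · push Not at hon
    have hvU : v ∈ U := by
      rcases hv with hv | ⟨j, hj, rfl⟩
      · exact hv
      · cases j with
        | zero => exact h0
        | succ j =>
          by_contra hvU
          exact hon j hj (fun hW => hvU (hWU hW)) rfl
    obtain ⟨h1, h2, h3, h4⟩ := h v hvU hvr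
    rw [(k2 v hon).1, (k2 v hon).2, (k2 (p v) fun _ _ hW => absurd h3 hW).1]
    refine ⟨.inl h1, h2, .inl h3, ?_⟩
    by_cases hp : p v = r
    · exact .inl hp
    · rw [k3 v hvU hvr, k3 _ (hWU h3) hp]
      exact h4

end MG

namespace MG

open Chains Chains.Chain Classical
variable {G : MG}

/-- Two families of parent edges together with a numbering of the edges. -/
structure Numbering (G : MG) where
  a : G.V → G.E
  p : G.V → G.V
  b : G.V → G.E
  q : G.V → G.V
  f : G.E → ℚ

/-- The invariant maintained while building a numbering along a chain decomposition: `H` is the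
set of edges seen so far, `U` the set of attached vertices, `W` the set of vertices which already
have two parent edges. -/
structure Numbering.Inv (s : Numbering G) (r : G.V) (H : Set G.E) (U W : Set G.V) : Prop where
  sub : W ⊆ U
  root : r ∈ W
  lower : Half r H U W s.a s.p s.f
  upper : Half r H U W s.b s.q (fun e => -s.f e)
  lt : ∀ v ∈ W, v ≠ r → s.f (s.a v) < s.f (s.b v)
  eq : ∀ v ∈ U, v ∉ W → s.a v = s.b v
  inj : ∀ v ∈ U, v ∉ W → ∀ w ∈ U, w ∉ W → s.f (s.a v) = s.f (s.a w) → v = w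

/-- Two numberings agree on the vertices in `W` and the edges in `H`. -/
structure Numbering.Agree (H : Set G.E) (W : Set G.V) (s s' : Numbering G) : Prop where
  lower : ∀ v ∈ W, s'.a v = s.a v ∧ s'.p v = s.p v
  upper : ∀ v ∈ W, s'.b v = s.b v ∧ s'.q v = s.q v
  f : ∀ e ∈ H, s'.f e = s.f e

lemma Numbering.Agree.rfl {H : Set G.E} {W : Set G.V} {s : Numbering G} :
    Numbering.Agree H W s s := ⟨by simp, by simp, by simp⟩

lemma Numbering.Agree.trans {H H' : Set G.E} {W W' : Set G.V} {s s' s'' : Numbering G}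
    (h : Numbering.Agree H W s s') (h' : Numbering.Agree H' W' s' s'') (hH : H ⊆ H')
    (hW : W ⊆ W') : Numbering.Agree H W s s'' where
  lower v hv := by simp [h'.lower v (hW hv), h.lower v hv]
  upper v hv := by simp [h'.upper v (hW hv), h.upper v hv]
  f e he := by rw [h'.f e (hH he), h.f e he]

lemma Numbering.Inv.ear_of_lt {s : Numbering G} {r : G.V} {H : Set G.E} {U W : Set G.V}
    (h : s.Inv r H U W) {x : ℕ → G.V} {e : ℕ → G.E} {n : ℕ} (hx : Ear W x e n) (hn : 0 < n)
    (h0 : x 0 ∈ U) (hxn : x n ∈ U) (hxint : ∀ j, 0 < j → j < n → x j ∉ U)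
    (he : ∀ j < n, e j ∉ H) {lo hi : ℚ} (hlohi : lo < hi)
    (hlo : x 0 = r ∨ s.f (s.a (x 0)) ≤ lo) (hhi : x n = r ∨ hi ≤ s.f (s.b (x n))) :
    ∃ s' : Numbering G, s'.Inv r (H ∪ e '' Set.Iio n) (U ∪ x '' Set.Iic n) (W ∪ x '' Set.Iic n) ∧
      s.Agree H W s' := by
  let g : ℕ → ℚ := fun j => lo + (hi - lo) * (j / (n + 1))
  have hg : StrictMono g := by
    intro i j hij
    have : (i : ℚ) < j := by exact_mod_cast hij
    simp only [g]
    have := sub_pos.2 hlohi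
    gcongr
  have hg0 : g 0 = lo := by simp [g]
  have hgn : g (n + 1) = hi := by
    have : (n : ℚ) + 1 ≠ 0 := by positivity
    simp [g, this]
  let y : Fin n → G.E := fun j => e j
  have hy : Function.Injective y := fun i j hij => Fin.ext (hx.einj i j i.2 j.2 hij)
  let f' : G.E → ℚ := Function.extend y (fun j => g (j + 1)) s.f
  have hfe : ∀ j < n, f' (e j) = g (j + 1) := fun j hj =>
    hy.extend_apply (fun j => g (j + 1)) s.f ⟨j, hj⟩
  have hfH : ∀ k ∈ H, f' k = s.f k := fun k hk => Function.extend_apply' _ _ _ (by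
    rintro ⟨j, rfl⟩
    exact he j j.2 hk)
  obtain ⟨a', p', hA, hA1, hA2⟩ := h.lower.ear h.sub hx h0 hxint hfH
    (fun j hj => by rw [hfe j (by omega), hfe _ hj]; exact hg (by omega))
    (hlo.imp_right fun hlo => by
      rw [hfe 0 hn]; exact hlo.trans_lt (hg0 ▸ hg (by omega)))
  obtain ⟨b', q', hB, hB1, hB2⟩ := h.upper.ear (f' := fun e => -f' e) h.sub hx.reverse
    (by simpa using hxn) (fun j hj hjn => hxint _ (by omega) (by omega))
    (fun k hk => by rw [hfH k hk])
    (fun j hj => by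
      rw [hfe _ (by omega), hfe _ (by omega), neg_lt_neg_iff]
      exact hg (by omega))
    (by
      simp only [Nat.sub_zero]
      refine hhi.imp_right fun hhi => ?_
      rw [hfe _ (by omega), neg_lt_neg_iff]
      exact lt_of_lt_of_le (hgn ▸ hg (by omega)) hhi)
  rw [image_sub_Iic, image_sub_Iio] at hB
  have hB1' : ∀ v, (∀ j < n, v ∉ W → v ≠ x j) → b' v = s.b v ∧ q' v = s.q v :=
    fun v hv => hB1 v fun j hj hW => hv _ (by omega) hW
  have hB2' : ∀ j < n, x j ∉ W → b' (x j) = e j := fun j hj hW => by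
    have := hB2 (n - 1 - j) (by omega)
    rw [show n - (n - 1 - j + 1) = j by omega, show n - 1 - (n - 1 - j) = j by omega] at this
    exact this hW
  have hfa : ∀ v ∈ U, v ≠ r → f' (s.a v) = s.f (s.a v) := fun v hv hvr =>
    hfH _ (h.lower v hv hvr).1
  have hfb : ∀ v ∈ U, v ≠ r → f' (s.b v) = s.f (s.b v) := fun v hv hvr =>
    hfH _ (h.upper v hv hvr).1
  refine ⟨⟨a', p', b', q', f'⟩, ⟨Set.union_subset_union_left _ h.sub, .inl h.root, hA, hB,
    ?_, ?_, ?_⟩, ⟨fun v hv => hA1 v (by simp [hv]), fun v hv => hB1' v (by simp [hv]), hfH⟩⟩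
  · intro v hv hvr
    by_cases hvW : v ∈ W
    · simp only [(hA1 v (by simp [hvW])).1, (hB1' v (by simp [hvW])).1]
      rw [hfa v (h.sub hvW) hvr, hfb v (h.sub hvW) hvr]
      exact h.lt v hvW hvr
    · obtain ⟨j, hj, rfl⟩ := hv.resolve_left hvW
      simp only [Set.mem_Iic] at hj
      have h1 : f' (a' (x j)) ≤ g j := by
        cases j with
        | zero =>
          rw [(hA1 (x 0) fun i hi hW hxi => hW (hx.inj _ _ (by omega) (by omega) hxi).2.2).1,
            hfa _ h0 hvr, hg0]
          exact hlo.resolve_left hvr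
        | succ j => rw [hA2 j (by omega) hvW, hfe j (by omega)]
      have h2 : g (j + 1) ≤ f' (b' (x j)) := by
        rcases hj.lt_or_eq with hj | rfl
        · rw [hB2' j hj hvW, hfe j hj]
        · rw [(hB1' (x j) fun i hi hW hxi => ?_).1, hfb _ hxn hvr, hgn]
          · exact hhi.resolve_left hvr
          · have := hx.inj _ _ hi le_rfl hxi.symm
            exact hW (by rw [hxi, this.1]; exact this.2.2)
      exact (h1.trans_lt (hg (by omega))).trans_le h2
  · intro v hv hvW
    rw [Set.mem_union, not_or] at hvW
    have hvx : ∀ j ≤ n, v ≠ x j := fun j hj hvj => hvW.2 ⟨j, hj, hvj.symm⟩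
    simp only [(hA1 v fun j hj _ => hvx _ hj).1, (hB1' v fun j hj _ => hvx _ hj.le).1]
    exact h.eq v (hv.resolve_right hvW.2) hvW.1
  · intro v hv hvW w hw hwW
    rw [Set.mem_union, not_or] at hvW hwW
    have hvx : ∀ j ≤ n, v ≠ x j := fun j hj hvj => hvW.2 ⟨j, hj, hvj.symm⟩
    have hwx : ∀ j ≤ n, w ≠ x j := fun j hj hvj => hwW.2 ⟨j, hj, hvj.symm⟩
    have hvU := hv.resolve_right hvW.2
    have hwU := hw.resolve_right hwW.2
    simp only [(hA1 v fun j hj _ => hvx _ hj).1, (hA1 w fun j hj _ => hwx _ hj).1]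
    rw [hfa v hvU fun h' => hvW.1 (h' ▸ h.root), hfa w hwU fun h' => hwW.1 (h' ▸ h.root)]
    exact h.inj v hvU hvW.1 w hwU hwW.1

lemma Numbering.Inv.exists_lt_of {s : Numbering G} {r : G.V} {H : Set G.E} {U W : Set G.V}
    (h : s.Inv r H U W) {u v : G.V} (hu : u ∈ U) (hv : v ∈ U) (huv : u = v → u ∈ W) :
    (∃ lo hi, lo < hi ∧ (u = r ∨ s.f (s.a u) ≤ lo) ∧ (v = r ∨ hi ≤ s.f (s.b v))) ∨
    ∃ lo hi, lo < hi ∧ (v = r ∨ s.f (s.a v) ≤ lo) ∧ (u = r ∨ hi ≤ s.f (s.b u)) := by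
  by_cases hur : u = r
  · exact .inl ⟨s.f (s.b v) - 1, s.f (s.b v), by simp, .inl hur, .inr le_rfl⟩
  by_cases hvr : v = r
  · exact .inl ⟨s.f (s.a u), s.f (s.a u) + 1, by simp, .inr le_rfl, .inl hvr⟩
  by_cases h1 : s.f (s.a u) < s.f (s.b v)
  · exact .inl ⟨_, _, h1, .inr le_rfl, .inr le_rfl⟩
  by_cases h2 : s.f (s.a v) < s.f (s.b u)
  · exact .inr ⟨_, _, h2, .inr le_rfl, .inr le_rfl⟩
  exfalso
  have key : ∀ w ∈ U, w ≠ r → s.f (s.a w) ≤ s.f (s.b w) := fun w hw hwr => by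
    by_cases hW : w ∈ W
    · exact (h.lt w hW hwr).le
    · rw [h.eq w hw hW]
  have k1 := key u hu hur
  have k2 := key v hv hvr
  have huW : u ∉ W := fun hW => by have := h.lt u hW hur; linarith
  have hvW : v ∉ W := fun hW => by have := h.lt v hW hvr; linarith
  exact huW (huv (h.inj u hu huW v hv hvW (by linarith)))

/-- Extend a numbering along a path with both ends attached. -/
lemma Numbering.Inv.ear {s : Numbering G} {r : G.V} {H : Set G.E} {U W : Set G.V}
    (h : s.Inv r H U W) {x : ℕ → G.V} {e : ℕ → G.E} {n : ℕ} (hx : Ear W x e n) (hn : 0 < n)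
    (h0 : x 0 ∈ U) (hxn : x n ∈ U) (he : ∀ j < n, e j ∉ H) :
    ∃ s' : Numbering G, s'.Inv r (H ∪ e '' Set.Iio n) (U ∪ x '' Set.Iic n) (W ∪ x '' Set.Iic n) ∧
      s.Agree H W s' := by
  induction n using Nat.strong_induction_on generalizing s H U W x e with
  | _ n ih =>
  by_cases hxint : ∃ j, 0 < j ∧ j < n ∧ x j ∈ U
  · obtain ⟨j, hj, hjn, hxj⟩ := hxint
    have hx1 : Ear W x e j := by
      refine ⟨fun i hi => hx.link i (by omega), fun i k hik hk hxx => ?_,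
        fun i k hi hk => hx.einj i k (by omega) (by omega)⟩
      have := hx.inj i k hik (by omega) hxx
      omega
    obtain ⟨s₁, h₁, hs₁⟩ := ih j hjn h hx1 hj h0 hxj fun i hi => he i (by omega)
    have hx2 : Ear (W ∪ x '' Set.Iic j) (fun i => x (j + i)) (fun i => e (j + i)) (n - j) := by
      refine ⟨fun i hi => hx.link _ (by omega), fun i k hik hk hxx => ?_, fun i k hi hk hik => ?_⟩
      · have := hx.inj (j + i) (j + k) (by omega) (by omega) hxx
        omega
      · have := hx.einj _ _ (by omega) (by omega) hik
        omega
    obtain ⟨s₂, h₂, hs₂⟩ := ih (n - j) (by omega) h₁ hx2 (by omega) (.inl hxj)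
      (.inl (by simpa [show j + (n - j) = n by omega] using hxn)) (fun i hi hmem => by
        rcases hmem with hmem | ⟨k, hk, hki⟩
        · exact he _ (by omega) hmem
        · simp only [Set.mem_Iio] at hk
          have := hx.einj _ _ (by omega) (by omega) hki
          omega)
    have hX : x '' Set.Iic j ∪ (fun i => x (j + i)) '' Set.Iic (n - j) = x '' Set.Iic n := by
      ext v
      simp only [Set.mem_union, Set.mem_image, Set.mem_Iic]
      constructor
      · rintro (⟨i, hi, rfl⟩ | ⟨i, hi, rfl⟩)
        · exact ⟨i, by omega, rfl⟩
        · exact ⟨j + i, by omega, rfl⟩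
      · rintro ⟨i, hi, rfl⟩
        by_cases hij : i ≤ j
        · exact .inl ⟨i, hij, rfl⟩
        · exact .inr ⟨i - j, by omega, by congr 1; omega⟩
    have hE : e '' Set.Iio j ∪ (fun i => e (j + i)) '' Set.Iio (n - j) = e '' Set.Iio n := by
      ext v
      simp only [Set.mem_union, Set.mem_image, Set.mem_Iio]
      constructor
      · rintro (⟨i, hi, rfl⟩ | ⟨i, hi, rfl⟩)
        · exact ⟨i, by omega, rfl⟩
        · exact ⟨j + i, by omega, rfl⟩
      · rintro ⟨i, hi, rfl⟩
        by_cases hij : i < j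
        · exact .inl ⟨i, hij, rfl⟩
        · exact .inr ⟨i - j, by omega, by congr 1; omega⟩
    rw [Set.union_assoc, Set.union_assoc, Set.union_assoc, hX, hE] at h₂
    exact ⟨s₂, h₂, hs₁.trans hs₂ Set.subset_union_left Set.subset_union_left⟩
  · have hxint' : ∀ j, 0 < j → j < n → x j ∉ U := fun j h1 h2 h3 => hxint ⟨j, h1, h2, h3⟩
    rcases h.exists_lt_of h0 hxn fun h' => (hx.inj 0 n hn le_rfl h').2.2 with
      ⟨lo, hi, hlt, h1, h2⟩ | ⟨lo, hi, hlt, h1, h2⟩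
    · exact h.ear_of_lt hx hn h0 hxn hxint' he hlt h1 h2
    · have := h.ear_of_lt hx.reverse hn (by simpa using hxn) (by simpa using h0)
        (fun j hj hjn => hxint' _ (by omega) (by omega)) (fun j hj => he _ (by omega)) hlt
        (by simpa using h1) (by simpa using h2)
      rwa [image_sub_Iic, image_sub_Iio] at this

end MG

namespace MG

open Chains Chains.Chain Classical
variable {G : MG}

lemma Numbering.inv_empty (s : Numbering G) (r : G.V) : s.Inv r ∅ {r} {r} where
  sub := subset_rfl
  root := rfl
  lower _ hv hvr := absurd hv hvr
  upper _ hv hvr := absurd hv hvr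
  lt _ hv hvr := absurd hv hvr
  eq _ hv hvr := absurd hv hvr
  inj _ hv hvr := absurd hv hvr

lemma Numbering.Inv.mono {s : Numbering G} {r : G.V} {H H' : Set G.E} {U W : Set G.V}
    (h : s.Inv r H U W) (hH : H ⊆ H') : s.Inv r H' U W :=
  { h with
    lower := h.lower.mono hH subset_rfl subset_rfl
    upper := h.upper.mono hH subset_rfl subset_rfl }

lemma Numbering.Inv.exists_fresh [Finite G.E] {s : Numbering G} {r : G.V} {H : Set G.E}
    {U W : Set G.V} (h : s.Inv r H U W) {u : G.V} (hu : u ∈ W) :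
    ∃ c, (∀ e, s.f e ≠ c) ∧ (u = r ∨ s.f (s.a u) < c) ∧ (u = r ∨ c < s.f (s.b u)) := by
  have hfin : (Set.range s.f).Finite := Set.finite_range _
  by_cases hur : u = r
  · obtain ⟨c, -, hc⟩ := (Set.infinite_univ (α := ℚ)).exists_notMem_finite hfin
    exact ⟨c, fun e he => hc ⟨e, he⟩, .inl hur, .inl hur⟩
  · obtain ⟨c, hc, hc'⟩ := (Set.Ioo_infinite (h.lt u hu hur)).exists_notMem_finite hfin
    exact ⟨c, fun e he => hc' ⟨e, he⟩, .inr hc.1, .inr hc.2⟩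

/-- Extend a numbering along a single edge leading to a new vertex. -/
lemma Numbering.Inv.pendant [Finite G.E] {s : Numbering G} {r : G.V} {H : Set G.E} {U W : Set G.V}
    (h : s.Inv r H U W) {u v : G.V} {e : G.E} (hu : u ∈ W) (hv : v ∉ U) (he : e ∉ H)
    (hev : G.ends e = s(u, v)) :
    ∃ s' : Numbering G, s'.Inv r (insert e H) (insert v U) W ∧ s.Agree H W s' := by
  obtain ⟨c, hc, hc1, hc2⟩ := h.exists_fresh hu
  have hfH : ∀ k ∈ H, Function.update s.f e c k = s.f k := fun k hk =>
    Function.update_of_ne (by rintro rfl; exact he hk) _ _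
  have hfa : ∀ w ∈ U, w ≠ r → Function.update s.f e c (s.a w) = s.f (s.a w) :=
    fun w hw hwr => hfH _ (h.lower w hw hwr).1
  have hvW : v ∉ W := fun hvW => hv (h.sub hvW)
  have hne : ∀ w ∈ U, w ≠ v := fun w hw hwv => hv (hwv ▸ hw)
  refine ⟨⟨Function.update s.a v e, Function.update s.p v u, Function.update s.b v e,
    Function.update s.q v u, Function.update s.f e c⟩,
    ⟨h.sub.trans (Set.subset_insert _ _), h.root,
      h.lower.update h.sub hu hvW hev hfH (hc1.imp_right fun hc1 => by simpa using hc1),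
      h.upper.update (f' := fun k => -Function.update s.f e c k) h.sub hu hvW hev
        (fun k hk => by rw [hfH k hk])
        (hc2.imp_right fun hc2 => by simpa using hc2), ?_, ?_, ?_⟩,
    ⟨fun w hw => ?_, fun w hw => ?_, hfH⟩⟩
  · intro w hw hwr
    simp only [Function.update_of_ne (hne w (h.sub hw))]
    rw [hfH _ (h.lower w (h.sub hw) hwr).1, hfH _ (h.upper w (h.sub hw) hwr).1]
    exact h.lt w hw hwr
  · intro w hw hwW
    rcases hw with rfl | hw
    · simp
    · simpa only [Function.update_of_ne (hne w hw)] using h.eq w hw hwW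
  · intro w hw hwW w' hw' hwW'
    have hwr : w ≠ r := fun h' => hwW (h' ▸ h.root)
    have hwr' : w' ≠ r := fun h' => hwW' (h' ▸ h.root)
    rcases hw with rfl | hw <;> rcases hw' with rfl | hw'
    · simp
    · simp only [Function.update_self, Function.update_of_ne (hne w' hw'), hfa w' hw' hwr']
      exact fun h' => absurd h'.symm (hc _)
    · simp only [Function.update_self, Function.update_of_ne (hne w hw), hfa w hw hwr]
      exact fun h' => absurd h' (hc _)
    · simp only [Function.update_of_ne (hne w' hw'), Function.update_of_ne (hne w hw),
        hfa w hw hwr, hfa w' hw' hwr']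
      exact h.inj w hw hwW w' hw' hwW'
  · simp [Function.update_of_ne (hne w (h.sub hw))]
  · simp [Function.update_of_ne (hne w (h.sub hw))]

/-- Extend a numbering along a single edge leading to an attached vertex. -/
lemma Numbering.Inv.edge [Finite G.E] {s : Numbering G} {r : G.V} {H : Set G.E} {U W : Set G.V}
    (h : s.Inv r H U W) {u v : G.V} {e : G.E} (hu : u ∈ W) (hvU : v ∈ U) (hv : v ∉ W) (he : e ∉ H)
    (hev : G.ends e = s(u, v)) :
    ∃ s' : Numbering G, s'.Inv r (insert e H) U (insert v W) ∧ s.Agree H W s' := by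
  obtain ⟨c, hc, hc1, hc2⟩ := h.exists_fresh hu
  have hfH : ∀ k ∈ H, Function.update s.f e c k = s.f k := fun k hk =>
    Function.update_of_ne (by rintro rfl; exact he hk) _ _
  have hfa : ∀ w ∈ U, w ≠ r → Function.update s.f e c (s.a w) = s.f (s.a w) :=
    fun w hw hwr => hfH _ (h.lower w hw hwr).1
  have hfb : ∀ w ∈ U, w ≠ r → Function.update s.f e c (s.b w) = s.f (s.b w) :=
    fun w hw hwr => hfH _ (h.upper w hw hwr).1
  have hvr : v ≠ r := fun h' => hv (h' ▸ h.root)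
  have hne : ∀ w ∈ W, w ≠ v := fun w hw hwv => hv (hwv ▸ hw)
  have hlow := h.lower.congr_edges h.sub hfH
  have hup := h.upper.congr_edges (f' := fun k => -Function.update s.f e c k)
    h.sub (fun k hk => by rw [hfH k hk])
  have hW : W ⊆ insert v W := Set.subset_insert _ _
  have hH : H ⊆ insert e H := Set.subset_insert _ _
  have hsub : insert v W ⊆ U := Set.insert_subset hvU h.sub
  have hvU' : insert v U = U := Set.insert_eq_of_mem hvU
  rcases lt_or_gt_of_ne (hc (s.a v)) with hcv | hcv
  · have hb := h.upper.update (f' := fun k => -Function.update s.f e c k) h.sub hu hv hev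
      (fun k hk => by rw [hfH k hk]) (hc2.imp_right fun hc2 => by simpa using hc2)
    rw [hvU'] at hb
    refine ⟨⟨s.a, s.p, Function.update s.b v e, Function.update s.q v u, Function.update s.f e c⟩,
      ⟨hsub, hW h.root, hlow.mono hH subset_rfl hW, hb.mono subset_rfl subset_rfl hW, ?_, ?_, ?_⟩,
      ⟨by simp, fun w hw => by simp [Function.update_of_ne (hne w hw)], hfH⟩⟩
    · intro w hw hwr
      rcases hw with rfl | hw
      · simpa only [Function.update_self, hfa w hvU hwr] using hcv
      · simp only [Function.update_of_ne (hne w hw)]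
        rw [hfa w (h.sub hw) hwr, hfb w (h.sub hw) hwr]
        exact h.lt w hw hwr
    · intro w hw hwW
      simp only [Set.mem_insert_iff, not_or] at hwW
      simpa only [Function.update_of_ne hwW.1] using h.eq w hw hwW.2
    · intro w hw hwW w' hw' hwW'
      simp only [Set.mem_insert_iff, not_or] at hwW hwW'
      simp only [hfa w hw fun h' => hwW.2 (h' ▸ h.root),
        hfa w' hw' fun h' => hwW'.2 (h' ▸ h.root)]
      exact h.inj w hw hwW.2 w' hw' hwW'.2
  · have ha := h.lower.update h.sub hu hv hev hfH (hc1.imp_right fun hc1 => by simpa using hc1)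
    rw [hvU'] at ha
    refine ⟨⟨Function.update s.a v e, Function.update s.p v u, s.b, s.q, Function.update s.f e c⟩,
      ⟨hsub, hW h.root, ha.mono subset_rfl subset_rfl hW, hup.mono hH subset_rfl hW, ?_, ?_, ?_⟩,
      ⟨fun w hw => by simp [Function.update_of_ne (hne w hw)], by simp, hfH⟩⟩
    · intro w hw hwr
      rcases hw with rfl | hw
      · change Function.update s.f e c (Function.update s.a w e w) < Function.update s.f e c (s.b w)
        rw [Function.update_self, Function.update_self, hfb w hvU hwr, ← h.eq w hvU hv]
        exact hcv
      · simp only [Function.update_of_ne (hne w hw)]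
        rw [hfa w (h.sub hw) hwr, hfb w (h.sub hw) hwr]
        exact h.lt w hw hwr
    · intro w hw hwW
      simp only [Set.mem_insert_iff, not_or] at hwW
      simpa only [Function.update_of_ne hwW.1] using h.eq w hw hwW.2
    · intro w hw hwW w' hw' hwW'
      simp only [Set.mem_insert_iff, not_or] at hwW hwW'
      simp only [Function.update_of_ne hwW.1, Function.update_of_ne hwW'.1,
        hfa w hw fun h' => hwW.2 (h' ▸ h.root), hfa w' hw' fun h' => hwW'.2 (h' ▸ h.root)]
      exact h.inj w hw hwW.2 w' hw' hwW'.2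

end MG

namespace MG

open Chains Chains.Chain Classical
variable {G : MG}

/-- The root together with the vertices met by `H`. -/
def attached (r : G.V) (H : Set G.E) : Set G.V := {v | v = r ∨ v ∈ G.vertsOf H}

/-- The root together with the vertices of degree at least two in `H`. -/
def full (r : G.V) (H : Set G.E) : Set G.V := {v | v = r ∨ 2 ≤ G.deg H v}

lemma vertsOf_mono {H H' : Set G.E} (h : H ⊆ H') : G.vertsOf H ⊆ G.vertsOf H' :=
  fun _ ⟨e, he, hv⟩ => ⟨e, h he, hv⟩

lemma attached_mono {r : G.V} {H H' : Set G.E} (h : H ⊆ H') : attached r H ⊆ attached r H' :=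
  fun _ hv => hv.imp_right fun hv => vertsOf_mono h hv

lemma mem_vertsOf_of_deg_pos {H : Set G.E} {v : G.V} (h : 0 < G.deg H v) : v ∈ G.vertsOf H := by
  by_contra hv
  have h1 : {e ∈ H | v ∈ G.ends e} = ∅ := by
    ext e
    simp only [Set.mem_ofPred_eq, Set.mem_empty_iff_false, iff_false]
    exact fun he => hv ⟨e, he⟩
  have h2 : {e ∈ H | G.ends e = s(v, v)} = ∅ := by
    ext e
    simp only [Set.mem_ofPred_eq, Set.mem_empty_iff_false, iff_false]
    exact fun he => hv ⟨e, he.1, by simp [he.2]⟩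
  simp [deg, h1, h2] at h

lemma full_subset_attached {r : G.V} {H : Set G.E} : full r H ⊆ attached r H :=
  fun _ hv => hv.imp_right fun hv => mem_vertsOf_of_deg_pos (by omega)

lemma deg_union_of_notMem {H C : Set G.E} {v : G.V} (h : v ∉ G.vertsOf C) :
    G.deg (H ∪ C) v = G.deg H v := by
  have h1 : {e ∈ H ∪ C | v ∈ G.ends e} = {e ∈ H | v ∈ G.ends e} := by
    ext e
    have : ¬ (e ∈ C ∧ v ∈ G.ends e) := fun he => h ⟨e, he⟩
    simp only [Set.mem_ofPred_eq, Set.mem_union]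
    tauto
  have h2 : {e ∈ H ∪ C | G.ends e = s(v, v)} = {e ∈ H | G.ends e = s(v, v)} := by
    ext e
    have : ¬ (e ∈ C ∧ G.ends e = s(v, v)) := fun he => h ⟨e, he.1, by simp [he.2]⟩
    simp only [Set.mem_ofPred_eq, Set.mem_union]
    tauto
  rw [deg, deg, h1, h2]

section
variable [Finite G.E]

lemma deg_mono {H H' : Set G.E} (h : H ⊆ H') (v : G.V) : G.deg H v ≤ G.deg H' v :=
  add_le_add (Set.ncard_le_ncard (fun _ he => ⟨h he.1, he.2⟩) (Set.toFinite _))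
    (Set.ncard_le_ncard (fun _ he => ⟨h he.1, he.2⟩) (Set.toFinite _))

lemma full_mono {r : G.V} {H H' : Set G.E} (h : H ⊆ H') : full r H ⊆ full r H' :=
  fun v hv => hv.imp_right fun hv => hv.trans (deg_mono h v)

lemma two_le_deg {H : Set G.E} {v : G.V} {e e' : G.E} (he : e ∈ H) (he' : e' ∈ H) (hne : e ≠ e')
    (hv : v ∈ G.ends e) (hv' : v ∈ G.ends e') : 2 ≤ G.deg H v := by
  have : 1 < {e ∈ H | v ∈ G.ends e}.ncard :=
    (Set.one_lt_ncard (Set.toFinite _)).2 ⟨e, ⟨he, hv⟩, e', ⟨he', hv'⟩, hne⟩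
  simp only [deg]
  omega

end

lemma IsLink.length_eq : ∀ {vs : List G.V} {es : List G.E}, G.IsLink vs es →
    vs.length = es.length + 1
  | [_], [], _ => rfl
  | _ :: b :: vs, _ :: es, h => by
    have := IsLink.length_eq h.2
    simpa using this

lemma IsLink.ends_getD (d : G.V) (d' : G.E) : ∀ {vs : List G.V} {es : List G.E}, G.IsLink vs es →
    ∀ j < es.length, G.ends (es.getD j d') = s(vs.getD j d, vs.getD (j + 1) d)
  | [_], [], _, j, hj => by simp at hj
  | a :: b :: vs, e :: es, h, 0, _ => by simpa using h.1
  | a :: b :: vs, e :: es, h, j + 1, hj => by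
    simpa using IsLink.ends_getD d d' h.2 j (by simpa using hj)

lemma getD_inj_of_nodup {α : Type*} {l : List α} (h : l.Nodup) (d : α) {i j : ℕ} (hi : i < l.length)
    (hj : j < l.length) (hij : l.getD i d = l.getD j d) : i = j := by
  rw [List.getD_eq_getElem _ _ hi, List.getD_eq_getElem _ _ hj] at hij
  exact (h.getElem_inj_iff).1 hij

lemma image_getD {α : Type*} (l : List α) (d : α) :
    (fun j => l.getD j d) '' Set.Iio l.length = {a | a ∈ l} := by
  ext a
  simp only [Set.mem_image, Set.mem_Iio, Set.mem_ofPred_eq, List.mem_iff_getElem]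
  constructor
  · rintro ⟨j, hj, rfl⟩
    exact ⟨j, hj, (List.getD_eq_getElem _ _ hj).symm⟩
  · rintro ⟨j, hj, rfl⟩
    exact ⟨j, hj, List.getD_eq_getElem _ _ hj⟩

lemma vertsOf_subset_full_of_isUpChain {r : G.V} {H Hb C : Set G.E} (hC : G.IsUpChain r H Hb C) :
    G.vertsOf C ⊆ full r Hb := by
  rintro w ⟨e, he, hw⟩
  rcases hC with ⟨-, -, vs, es, ⟨-, -, hl⟩, -, rfl, hall, -⟩ |
    ⟨v, -, -, vs, es, ⟨-, -, -, hl⟩, rfl, hall, -⟩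
  · exact hall w (hl.mem_of_mem he hw)
  · have := hl.mem_of_mem he hw
    refine hall w ?_
    simp only [List.mem_cons, List.mem_append, List.not_mem_nil, or_false] at this ⊢
    tauto

lemma attached_union {r : G.V} {H C : Set G.E} (h : G.vertsOf C ⊆ attached r H) :
    attached r (H ∪ C) = attached r H := by
  refine Set.Subset.antisymm ?_ (attached_mono Set.subset_union_left)
  rintro v (hv | ⟨e, he | he, hv⟩)
  · exact .inl hv
  · exact .inr ⟨e, he, hv⟩
  · exact h ⟨e, he, hv⟩

variable [Finite G.E]

/-- Extend a numbering along a chain of the form of an ear. -/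
lemma Numbering.Inv.link {s : Numbering G} {r : G.V} {H : Set G.E}
    (h : s.Inv r H (attached r H) (full r H)) {vs : List G.V} {es : List G.E}
    (hl : G.IsLink vs es) (hes : es.Nodup) (hne : es ≠ []) (hdis : ∀ e ∈ es, e ∉ H)
    (h0 : vs.getD 0 r ∈ attached r H) (hn : vs.getD es.length r ∈ attached r H)
    (hinj : ∀ i j, i < j → j ≤ es.length → vs.getD i r = vs.getD j r →
      i = 0 ∧ j = es.length ∧ vs.getD 0 r ∈ full r H) :
    ∃ s' : Numbering G, s'.Inv r (H ∪ {e | e ∈ es}) (attached r (H ∪ {e | e ∈ es}))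
      (full r (H ∪ {e | e ∈ es})) ∧ s.Agree H (full r H) s' := by
  have hpos : 0 < es.length := List.length_pos_of_ne_nil hne
  let d := es.head hne
  have hear : Ear (full r H) (fun j => vs.getD j r) (fun j => es.getD j d) es.length :=
    ⟨hl.ends_getD r d, hinj, fun i j hi hj => getD_inj_of_nodup hes d hi hj⟩
  have hmem : ∀ j < es.length, es.getD j d ∈ es := fun j hj => by
    rw [List.getD_eq_getElem _ _ hj]; exact List.getElem_mem _
  obtain ⟨s', hs', hag⟩ := h.ear hear hpos h0 hn fun j hj => hdis _ (hmem j hj)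
  have hI : Set.Iic es.length = Set.Iio vs.length := by
    rw [hl.length_eq]; ext j; simp
  rw [hI, image_getD, image_getD] at hs'
  have hC : ∀ v ∈ vs, v ∈ G.vertsOf {e | e ∈ es} := by
    intro v hv
    obtain ⟨j, hj, rfl⟩ : v ∈ (fun j => vs.getD j r) '' Set.Iio vs.length := by
      rwa [image_getD]
    have hj : j < es.length + 1 := hl.length_eq ▸ hj
    rcases Nat.eq_zero_or_pos j with rfl | hj0
    · exact ⟨_, hmem 0 hpos, by rw [hl.ends_getD r d 0 hpos]; simp⟩
    · refine ⟨_, hmem (j - 1) (by omega), ?_⟩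
      rw [hl.ends_getD r d (j - 1) (by omega), Nat.sub_add_cancel hj0]; simp
  have hC' : ∀ v ∈ G.vertsOf {e | e ∈ es}, v ∈ vs := fun v ⟨e, he, hv⟩ => hl.mem_of_mem he hv
  have hatt : attached r H ∪ {v | v ∈ vs} = attached r (H ∪ {e | e ∈ es}) := by
    ext v
    constructor
    · rintro (hv | hv)
      · exact attached_mono Set.subset_union_left hv
      · exact .inr (vertsOf_mono Set.subset_union_right (hC v hv))
    · rintro (hv | ⟨e, he | he, hv⟩)
      · exact .inl (.inl hv)
      · exact .inl (.inr ⟨e, he, hv⟩)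
      · exact .inr (hC' v ⟨e, he, hv⟩)
  have hend : ∀ v ∈ vs, v ∈ attached r H → v ∈ full r (H ∪ {e | e ∈ es}) := by
    rintro v hv (hvr | ⟨e, he, hve⟩)
    · exact .inl hvr
    · obtain ⟨e', he', hve'⟩ := hC v hv
      exact .inr (two_le_deg (.inl he) (.inr he') (fun h => hdis e' he' (h ▸ he)) hve hve')
  have hfull : full r H ∪ {v | v ∈ vs} = full r (H ∪ {e | e ∈ es}) := by
    ext v
    constructor
    · rintro (hv | hv)
      · exact full_mono Set.subset_union_left hv
      · obtain ⟨j, hj, rfl⟩ : v ∈ (fun j => vs.getD j r) '' Set.Iio vs.length := by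
          rwa [image_getD]
        have hj : j < es.length + 1 := hl.length_eq ▸ hj
        rcases Nat.eq_zero_or_pos j with rfl | hj0
        · exact hend _ hv h0
        · rcases (Nat.lt_succ_iff.1 hj).eq_or_lt with rfl | hjn
          · exact hend _ hv hn
          · refine .inr (two_le_deg (.inr (hmem (j - 1) (by omega))) (.inr (hmem j hjn))
              (fun h => ?_) ?_ ?_)
            · have := getD_inj_of_nodup hes d (by omega) hjn h
              omega
            · rw [hl.ends_getD r d (j - 1) (by omega), Nat.sub_add_cancel hj0]; simp
            · rw [hl.ends_getD r d j hjn]; simp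
    · rintro (hv | hv)
      · exact .inl (.inl hv)
      · by_cases hvs : v ∈ vs
        · exact .inr hvs
        · rw [deg_union_of_notMem fun h => hvs (hC' v h)] at hv
          exact .inl (.inr hv)
  rw [hatt, hfull] at hs'
  exact ⟨s', hs', hag⟩

lemma Numbering.Inv.up {s : Numbering G} {r : G.V} {H Hb C : Set G.E}
    (h : s.Inv r H (attached r H) (full r H)) (hC : G.IsUpChain r H Hb C) :
    ∃ s' : Numbering G, s'.Inv r (H ∪ C) (attached r (H ∪ C)) (full r (H ∪ C)) ∧
      s.Agree H (full r H) s' := by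
  rcases hC with ⟨hd, -, vs, es, ⟨hvs, hes, hl⟩, hne, rfl, -, hhead, hlast⟩ |
    ⟨v, hd, -, vs, es, ⟨hvs, hes, hne, hl⟩, rfl, -, hv⟩
  · have hlen := hl.length_eq
    refine h.link hl hes hne (fun e he => Set.disjoint_left.1 hd he) ?_ ?_ ?_
    · refine hhead _ ?_
      rw [List.head?_eq_getElem?, List.getD_eq_getElem _ _ (by omega)]
      simp [hlen]
    · refine hlast _ ?_
      rw [List.getLast?_eq_getElem?, List.getD_eq_getElem _ _ (by omega)]
      simp [hlen]
    · intro i j hij hj hxy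
      have := getD_inj_of_nodup hvs r (by omega) (by omega) hxy
      omega
  · have hlen := hl.length_eq
    have hlen' : vs.length + 1 = es.length := by simpa using hlen
    have hlast : (v :: (vs ++ [v])).getD es.length r = v := by
      rw [← hlen']; simp
    refine h.link hl hes hne (fun e he => Set.disjoint_left.1 hd he) ?_ ?_ ?_
    · exact full_subset_attached hv
    · rw [hlast]; exact full_subset_attached hv
    · intro i j hij hj hxy
      have hi : i < (v :: vs).length := by simp; omega
      have hcons : ∀ k < (v :: vs).length, (v :: (vs ++ [v])).getD k r = (v :: vs).getD k r := by
        intro k hk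
        rw [← List.cons_append, List.getD_append _ _ _ _ hk]
      rcases hj.eq_or_lt with rfl | hjn
      · refine ⟨?_, rfl, hv⟩
        rw [hlast, hcons i hi] at hxy
        exact getD_inj_of_nodup hvs r hi (by simp) (by simpa using hxy)
      · rw [hcons i hi, hcons j (by simp; omega)] at hxy
        have := getD_inj_of_nodup hvs r hi (by simp; omega) hxy
        omega

lemma full_union {r : G.V} {H C : Set G.E} (h : G.vertsOf C ⊆ full r H) :
    full r (H ∪ C) = full r H := by
  refine Set.Subset.antisymm ?_ (full_mono Set.subset_union_left)
  rintro v (hv | hv)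
  · exact .inl hv
  · by_cases hvC : v ∈ G.vertsOf C
    · exact h hvC
    · rw [deg_union_of_notMem hvC] at hv
      exact .inr hv

lemma Numbering.Inv.down {s : Numbering G} {r : G.V} {H Hb C : Set G.E}
    (h : s.Inv r H (attached r H) (full r H)) (hC : G.IsDownChain r H Hb C) :
    ∃ s' : Numbering G, s'.Inv r (H ∪ C) (attached r (H ∪ C)) (full r (H ∪ C)) ∧
      s.Agree H (full r H) s' := by
  have hC' := vertsOf_subset_full_of_isUpChain hC
  rw [full_union hC', attached_union (hC'.trans full_subset_attached)]
  exact ⟨s, h.mono Set.subset_union_left, .rfl⟩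

lemma Numbering.Inv.oneWay {s : Numbering G} {r : G.V} {H Hb C : Set G.E}
    (h : s.Inv r H (attached r H) (full r H)) (hC : G.IsOneWayChain r H Hb C) :
    ∃ s' : Numbering G, s'.Inv r (H ∪ C) (attached r (H ∪ C)) (full r (H ∪ C)) ∧
      s.Agree H (full r H) s' := by
  obtain ⟨u, v, e, heH, -, rfl, hev, hu, -⟩ := hC
  have hu : u ∈ full r H := hu
  by_cases hv : v ∈ full r H
  · have hC' : G.vertsOf {e} ⊆ full r H := by
      rintro w ⟨_, rfl, hw⟩
      rw [hev, Sym2.mem_iff] at hw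
      rcases hw with rfl | rfl <;> assumption
    rw [full_union hC', attached_union (hC'.trans full_subset_attached)]
    exact ⟨s, h.mono Set.subset_union_left, .rfl⟩
  have huv : u ≠ v := fun h => hv (h ▸ hu)
  have hvr : v ≠ r := fun h => hv (.inl h)
  have hdeg : ∀ w, w ≠ v → (w ∈ full r (insert e H) ↔ w ∈ full r H) := by
    intro w hwv
    by_cases hwu : w = u
    · subst hwu
      exact ⟨fun _ => hu, fun h => full_mono (Set.subset_insert _ _) h⟩
    · have : w ∉ G.vertsOf {e} := by
        rintro ⟨_, rfl, hw⟩
        rw [hev, Sym2.mem_iff] at hw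
        tauto
      rw [Set.insert_eq, Set.union_comm]
      simp only [full, Set.mem_ofPred_eq, deg_union_of_notMem this]
  have hatt : attached r (insert e H) = insert v (attached r H) := by
    ext w
    constructor
    · rintro (hw | ⟨k, rfl | hk, hw⟩)
      · exact .inr (.inl hw)
      · rw [hev, Sym2.mem_iff] at hw
        rcases hw with rfl | rfl
        · exact .inr (full_subset_attached hu)
        · exact .inl rfl
      · exact .inr (.inr ⟨k, hk, hw⟩)
    · rintro (rfl | hw)
      · exact .inr ⟨e, .inl rfl, by simp [hev]⟩
      · exact attached_mono (Set.subset_insert _ _) hw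
  rw [Set.union_singleton]
  by_cases hvU : v ∈ attached r H
  · obtain ⟨k, hk, hvk⟩ := hvU.resolve_left hvr
    have hfull : full r (insert e H) = insert v (full r H) := by
      ext w
      by_cases hwv : w = v
      · subst hwv
        simp only [Set.mem_insert_iff, true_or, iff_true]
        exact .inr (two_le_deg (.inl rfl) (.inr hk) (fun h => heH (h ▸ hk)) (by simp [hev]) hvk)
      · simp [hdeg w hwv, hwv]
    rw [hfull, hatt, Set.insert_eq_of_mem hvU]
    exact h.edge hu hvU hv heH hev
  · have hfull : full r (insert e H) = full r H := by
      ext w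
      by_cases hwv : w = v
      · subst hwv
        refine iff_of_false ?_ hv
        rintro (hwr | hw)
        · exact hvr hwr
        · have h0 : G.deg H w = 0 := by
            by_contra h0
            exact hvU (.inr (mem_vertsOf_of_deg_pos (Nat.pos_of_ne_zero h0)))
          rw [deg_insert (Set.toFinite _) heH, h0, hev] at hw
          simp [endCount, huv.symm] at hw
      · exact hdeg w hwv
    rw [hfull, hatt]
    exact h.pendant hu hvU heH hev

lemma Numbering.Inv.chain {s : Numbering G} {r : G.V} {H Hb C : Set G.E}
    (h : s.Inv r H (attached r H) (full r H)) (hC : G.IsChain r H Hb C) :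
    ∃ s' : Numbering G, s'.Inv r (H ∪ C) (attached r (H ∪ C)) (full r (H ∪ C)) ∧
      s.Agree H (full r H) s' := by
  rcases hC with hC | hC | hC
  exacts [h.up hC, h.down hC, h.oneWay hC]

end MG

namespace MG

open Chains Chains.Chain Classical
variable {G : MG}

/-- The two parent structures of a numbering are defined on all full vertices of `H`, and stay
within `H`. -/
structure Numbering.Core (s : Numbering G) (r : G.V) (H : Set G.E) : Prop where
  lower : Half r H (full r H) (full r H) s.a s.p s.f
  upper : Half r H (full r H) (full r H) s.b s.q (fun e => -s.f e)

lemma Numbering.Inv.core {s : Numbering G} {r : G.V} {H : Set G.E}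
    (h : s.Inv r H (attached r H) (full r H)) : s.Core r H :=
  ⟨h.lower.mono subset_rfl full_subset_attached subset_rfl,
    h.upper.mono subset_rfl full_subset_attached subset_rfl⟩

lemma Numbering.Core.congr {s s' : Numbering G} {r : G.V} {H : Set G.E} (h : s.Core r H)
    (hs : Numbering.Agree H (full r H) s s') : s'.Core r H :=
  ⟨h.lower.congr hs.lower hs.f, h.upper.congr hs.upper fun e he => by rw [hs.f e he]⟩

lemma exists_numbering [Finite G.E] [Nonempty G.E] (r : G.V) {n : ℕ} (P : ℕ → Set G.E)
    (h0 : P 0 = ∅) (hP : ∀ k < n, ∃ Hb C, P (k + 1) = P k ∪ C ∧ G.IsChain r (P k) Hb C) :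
    ∃ s : Numbering G, (∀ k ≤ n, s.Core r (P k)) ∧
      ∀ v ∈ full r (P n), v ≠ r → s.f (s.a v) < s.f (s.b v) := by
  have key : ∀ K ≤ n, ∃ s : Numbering G, s.Inv r (P K) (attached r (P K)) (full r (P K)) ∧
      ∀ k ≤ K, P k ⊆ P K ∧ s.Core r (P k) := by
    intro K
    induction K with
    | zero =>
      intro _
      let e : G.E := Classical.arbitrary _
      let s : Numbering G := ⟨fun _ => e, id, fun _ => e, id, fun _ => 0⟩
      have hs := s.inv_empty r
      have h1 : attached r (P 0) = {r} := by
        ext v; simp [attached, vertsOf, h0]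
      have h2 : full r (P 0) = {r} := by
        ext v; simp [full, deg, h0]
      have h3 : s.Inv r (P 0) (attached r (P 0)) (full r (P 0)) := by
        rw [h1, h2, h0]; exact hs
      refine ⟨s, h3, fun k hk => ?_⟩
      obtain rfl := Nat.le_zero.1 hk
      exact ⟨subset_rfl, h3.core⟩
    | succ K ih =>
      intro hK
      obtain ⟨s, hs, hcore⟩ := ih (by omega)
      obtain ⟨Hb, C, hPC, hC⟩ := hP K (by omega)
      obtain ⟨s', hs', hag⟩ := hs.chain hC
      rw [← hPC] at hs'
      refine ⟨s', hs', fun k hk => ?_⟩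
      rcases hk.eq_or_lt with rfl | hk
      · exact ⟨subset_rfl, hs'.core⟩
      · obtain ⟨hsub, hc⟩ := hcore k (by omega)
        refine ⟨hsub.trans (hPC ▸ Set.subset_union_left), hc.congr ?_⟩
        exact ⟨fun v hv => hag.lower v (full_mono hsub hv),
          fun v hv => hag.upper v (full_mono hsub hv), fun e he => hag.f e (hsub he)⟩
  obtain ⟨s, hs, hcore⟩ := key n le_rfl
  exact ⟨s, fun k hk => (hcore k hk).2, hs.lt⟩

lemma IsChain.swap {r : G.V} {H Hb C : Set G.E} (h : G.IsChain r H Hb C) :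
    G.IsChain r Hb H C := by
  rcases h with h | h | ⟨u, v, e, h1, h2, h3, h4, h5, h6⟩
  · exact .inr (.inl h)
  · exact .inl h
  · exact .inr (.inr ⟨v, u, e, h2, h1, h3, h4.trans Sym2.eq_swap, h6, h5⟩)

lemma IsChain.mem_full {r : G.V} {H Hb C : Set G.E} (h : G.IsChain r H Hb C) {v : G.V}
    (hv : v ∈ G.vertsOf C) : v ∈ full r H ∨ v ∈ full r Hb := by
  rcases h with h | h | ⟨u, w, e, -, -, rfl, h4, h5, h6⟩
  · exact .inr (vertsOf_subset_full_of_isUpChain h hv)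
  · exact .inl (vertsOf_subset_full_of_isUpChain h hv)
  · obtain ⟨_, rfl, hv⟩ := hv
    rw [h4, Sym2.mem_iff] at hv
    rcases hv with rfl | rfl
    exacts [.inl h5, .inr h6]

/-- The union of the first `k` chains of a sequence. -/
def initial {n : ℕ} (Gs : Fin n → Set G.E) (k : ℕ) : Set G.E :=
  {e | ∃ j : Fin n, (j : ℕ) < k ∧ e ∈ Gs j}

section
variable {r : G.V} {n : ℕ} {Gs : Fin n → Set G.E}

lemma initial_zero : initial Gs 0 = ∅ := by
  ext e; simp [initial]

lemma initial_succ (i : Fin n) : initial Gs (i + 1) = initial Gs i ∪ Gs i := by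
  ext e
  constructor
  · rintro ⟨j, hj, he⟩
    rcases (Nat.lt_succ_iff.1 hj).eq_or_lt with h | h
    · exact .inr (Fin.ext h ▸ he)
    · exact .inl ⟨j, h, he⟩
  · rintro (⟨j, hj, he⟩ | he)
    exacts [⟨j, by omega, he⟩, ⟨i, by omega, he⟩]

lemma IsChainDecomp.initial_last (h : G.IsChainDecomp r Gs) : initial Gs n = Set.univ := by
  rw [← h.2.1]
  ext e
  simp [initial]

lemma IsChainDecomp.after_eq (h : G.IsChainDecomp r Gs) (i : Fin n) :
    G.after Gs i = (initial Gs (i + 1))ᶜ := by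
  ext e
  constructor
  · rintro ⟨j, hj, he⟩ ⟨k, hk, hek⟩
    refine Set.disjoint_left.1 (h.1 j k fun hjk => ?_) he hek
    subst hjk
    have : (i : ℕ) < j := hj
    omega
  · intro he
    obtain ⟨j, hj⟩ := Set.mem_iUnion.1 (h.2.1 ▸ Set.mem_univ e)
    refine ⟨j, ?_, hj⟩
    by_contra hij
    have : (j : ℕ) ≤ i := not_lt.1 hij
    exact he ⟨j, by omega, hj⟩

lemma IsChainDecomp.isChain (h : G.IsChainDecomp r Gs) (i : Fin n) :
    G.IsChain r (initial Gs i) (initial Gs (i + 1))ᶜ (Gs i) := by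
  rw [← h.after_eq i]
  exact h.2.2 i

lemma IsChainDecomp.compl_initial (h : G.IsChainDecomp r Gs) (i : Fin n) :
    (initial Gs i)ᶜ = (initial Gs (i + 1))ᶜ ∪ Gs i := by
  have hdis : Disjoint (Gs i) (initial Gs i) := by
    rw [Set.disjoint_left]
    rintro e he ⟨j, hj, hej⟩
    refine Set.disjoint_left.1 (h.1 i j fun hij => ?_) he hej
    subst hij
    omega
  ext e
  have : e ∈ Gs i → e ∉ initial Gs i := fun he => Set.disjoint_left.1 hdis he
  rw [initial_succ]
  simp only [Set.mem_compl_iff, Set.mem_union]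
  tauto

lemma IsChainDecomp.exists_full [Finite G.E] (h : G.IsChainDecomp r Gs) (hG : G.NoIsolated)
    {v : G.V} (hv : v ≠ r) :
    ∃ k ≤ n, v ∈ full r (initial Gs k) ∧ v ∈ full r (initial Gs k)ᶜ := by
  have hex : ∃ k, k ≤ n ∧ v ∈ full r (initial Gs k) := by
    obtain ⟨e, he⟩ := hG v
    obtain ⟨i, hi⟩ := Set.mem_iUnion.1 (h.2.1 ▸ Set.mem_univ e)
    refine ⟨n, le_rfl, ?_⟩
    rw [h.initial_last]
    rcases (h.isChain i).mem_full ⟨e, hi, he⟩ with hf | hf <;>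
      exact full_mono (Set.subset_univ _) hf
  obtain ⟨hkn, hk⟩ := Nat.find_spec hex
  obtain ⟨k, hkeq⟩ : ∃ k, Nat.find hex = k + 1 := by
    refine Nat.exists_eq_succ_of_ne_zero fun h0 => ?_
    rw [h0, initial_zero] at hk
    simp [full, deg, hv] at hk
  rw [hkeq] at hk hkn
  have hmin : v ∉ full r (initial Gs k) := fun hf =>
    Nat.find_min hex (m := k) (by omega) ⟨by omega, hf⟩
  refine ⟨k + 1, hkn, hk, ?_⟩
  have hs := initial_succ (Gs := Gs) ⟨k, hkn⟩
  have hc := h.isChain ⟨k, hkn⟩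
  simp only at hs hc
  refine (hc.mem_full ?_).resolve_left hmin
  by_contra hvC
  rw [hs] at hk
  rcases hk with hk | hk
  · exact hv hk
  · rw [deg_union_of_notMem hvC] at hk
    exact hmin (.inr hk)

end

end MG

namespace MG

open Chains Chains.Chain Classical
variable {G : MG}

/-- `w` is reached from `v` by following parents. -/
def Anc (r : G.V) (p : G.V → G.V) : G.V → G.V → Prop :=
  Relation.ReflTransGen fun x y => x ≠ r ∧ p x = y

lemma Half.anc {r : G.V} {H : Set G.E} {W : Set G.V} {a : G.V → G.E} {p : G.V → G.V}
    {f : G.E → ℚ} (h : Half r H W W a p f) {v w : G.V} (hvw : Anc r p v w) (hv : v ∈ W)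
    (hw : w ≠ r) : w ∈ W ∧ a w ∈ H ∧ f (a w) ≤ f (a v) := by
  induction hvw with
  | refl => exact ⟨hv, (h v hv hw).1, le_rfl⟩
  | @tail x y _ hxy ih =>
    obtain ⟨hxr, rfl⟩ := hxy
    obtain ⟨hxW, -, hle⟩ := ih hxr
    obtain ⟨-, -, hpW, hlt⟩ := h x hxW hxr
    exact ⟨hpW, (h _ hpW hw).1, (hlt.resolve_left hw).le.trans hle⟩

lemma Anc.eq_root {r : G.V} {p : G.V → G.V} {w : G.V} (h : Anc r p r w) : w = r := by
  induction h with
  | refl => rfl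
  | tail _ hxy ih => exact absurd ih hxy.1

/-- The spanning subgraph formed by all parent edges. -/
def parentTree (r : G.V) (a : G.V → G.E) : Sub G where
  verts := Set.univ
  edges := {e | ∃ v, v ≠ r ∧ a v = e}
  valid _ _ v _ := Set.mem_univ v

section
variable {r : G.V} {a : G.V → G.E} {p : G.V → G.V} {f : G.E → ℚ}

lemma Half.parent_ne (h : Half r Set.univ Set.univ Set.univ a p f) {v : G.V} (hv : v ≠ r) :
    p v ≠ v := by
  intro hp
  have := (h v trivial hv).2.2.2
  rw [hp] at this
  exact this.elim hv (lt_irrefl _)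

lemma Half.isTree [Finite G.V] (h : Half r Set.univ Set.univ Set.univ a p f) :
    (parentTree r a).IsTree := by
  refine ⟨⟨⟨r, trivial⟩, ?_⟩, ?_⟩
  · have hroot : ∀ v, G.Reach (parentTree r a).edges v r := by
      have : IsTrans G.V (fun v w => f (a v) < f (a w)) := ⟨fun _ _ _ => lt_trans⟩
      have : Std.Irrefl (fun v w : G.V => f (a v) < f (a w)) := ⟨fun _ => lt_irrefl _⟩
      have hwf := Finite.wellFounded_of_trans_of_irrefl (fun v w : G.V => f (a v) < f (a w))
      intro v
      induction v using hwf.induction with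
      | _ v ih =>
        by_cases hv : v = r
        · subst hv; exact .refl
        · obtain ⟨-, h2, -, h4⟩ := h v trivial hv
          refine .head ⟨a v, ⟨v, hv, rfl⟩, h2⟩ ?_
          rcases h4 with h4 | h4
          · rw [h4]
          · exact ih _ h4
    exact fun v _ w _ => (hroot v).trans (hroot w).symm
  · rintro ⟨v, vs, es, ⟨-, hes, hne, hl⟩, hT⟩
    obtain ⟨e, he, hmax⟩ := es.toFinset.exists_max_image f (List.toFinset_nonempty_iff _ |>.2 hne)
    simp only [List.mem_toFinset] at he hmax
    obtain ⟨w, hwr, rfl⟩ := hT e he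
    obtain ⟨-, hw, -, -⟩ := h w trivial hwr
    have hlen : es.length = vs.length + 1 := by simpa using hl.length_eq.symm
    have hends := hl.ends_getD v (a w)
    have hmem : ∀ j < es.length, es.getD j (a w) ∈ es := fun j hj => by
      rw [List.getD_eq_getElem _ _ hj]; exact List.getElem_mem _
    set x : ℕ → G.V := fun j => (v :: (vs ++ [v])).getD j v with hx
    have hx0 : x 0 = v := rfl
    have hxn : x es.length = v := by simp [hx, hlen]
    obtain ⟨j, hj, hje⟩ := List.mem_iff_getElem.1 he
    rw [← List.getD_eq_getElem _ (a w) hj] at hje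
    obtain ⟨k, hk, hkj, hwk⟩ : ∃ k < es.length, k ≠ j ∧ w ∈ G.ends (es.getD k (a w)) := by
      have hj' := hends j hj
      rw [hje, hw] at hj'
      have hloop : x j ≠ x (j + 1) := by
        intro hxx
        have h1 : w ∈ s(x j, x (j + 1)) := hj' ▸ Sym2.mem_mk_left _ _
        have h2 : p w ∈ s(x j, x (j + 1)) := hj' ▸ Sym2.mem_mk_right _ _
        rw [← hxx, Sym2.mem_iff, or_self] at h1 h2
        exact h.parent_ne hwr (h2.trans h1.symm)
      have hwx : w = x j ∨ w = x (j + 1) :=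
        Sym2.mem_iff.1 (show w ∈ s(x j, x (j + 1)) from hj' ▸ Sym2.mem_mk_left _ _)
      rcases hwx with hwx | hwx
      · rcases Nat.eq_zero_or_pos j with rfl | hj0
        · refine ⟨es.length - 1, by omega, fun h1 => ?_, ?_⟩
          · have h1 : es.length = 0 + 1 := by omega
            exact hloop (by rw [← h1, hxn, hx0])
          · rw [hends _ (by omega), Nat.sub_add_cancel (by omega)]
            change w ∈ s(_, x es.length)
            rw [hxn, hwx, hx0]
            simp
        · refine ⟨j - 1, by omega, by omega, ?_⟩
          rw [hends _ (by omega), Nat.sub_add_cancel hj0]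
          change w ∈ s(_, x j)
          rw [hwx]; simp
      · by_cases hjn : j + 1 = es.length
        · refine ⟨0, by omega, fun h1 => ?_, ?_⟩
          · exact hloop (by rw [hjn, hxn, ← h1, hx0])
          · rw [hends _ (by omega)]
            change w ∈ s(x 0, _)
            rw [hwx, hjn, hxn, hx0]; simp
        · refine ⟨j + 1, by omega, by omega, ?_⟩
          rw [hends _ (by omega)]
          change w ∈ s(x (j + 1), _)
          rw [hwx]; simp
    obtain ⟨w', hwr', hw'⟩ := hT _ (hmem k hk)
    obtain ⟨-, hend', -, hlt⟩ := h w' trivial hwr'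
    rw [← hw', hend', Sym2.mem_iff] at hwk
    rcases hwk with rfl | rfl
    · exact hkj (getD_inj_of_nodup hes (a w) hk hj (hw'.symm.trans hje.symm))
    · exact absurd (hmax _ (hmem k hk)) (not_le.2 (hw' ▸ hlt.resolve_left hwr))

lemma Half.anc_of_link (h : Half r Set.univ Set.univ Set.univ a p f) :
    ∀ {l : List G.V} {es : List G.E} {x v : G.V}, G.IsLink (x :: l) es → es.Nodup →
      (∀ e ∈ es, e ∈ (parentTree r a).edges) → (x = r ∨ a x ∉ es) →
      (x :: l).getLast? = some v → Anc r p v x ∧ ∀ e ∈ es, ∃ w, w ≠ r ∧ Anc r p v w ∧ a w = e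
  | [], [], x, v, _, _, _, _, hv => by
    obtain rfl : x = v := by simpa using hv
    exact ⟨.refl, by simp⟩
  | y :: l, e :: es, x, v, hl, hes, hT, hx, hv => by
    obtain ⟨z, hzr, rfl⟩ := hT e (by simp)
    obtain ⟨hne, hes'⟩ := List.nodup_cons.1 hes
    obtain ⟨-, hz, -, -⟩ := h z trivial hzr
    have hxz : x ≠ z := by
      rintro rfl
      rcases hx with hx | hx
      exacts [hzr hx, hx (by simp)]
    obtain ⟨hzy, hpx⟩ : z = y ∧ p z = x := by
      have := hz.symm.trans hl.1
      rw [Sym2.eq_iff] at this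
      rcases this with ⟨h1, -⟩ | h1
      exacts [absurd h1.symm hxz, h1]
    subst hzy
    obtain ⟨h1, h2⟩ := h.anc_of_link hl.2 hes' (fun e he => hT e (by simp [he])) (.inr hne)
      (by simpa using hv)
    refine ⟨h1.tail ⟨hzr, hpx⟩, fun e he => ?_⟩
    rcases List.mem_cons.1 he with rfl | he
    exacts [⟨z, hzr, h1, rfl⟩, h2 e he]

lemma Half.anc_of_pathIn (h : Half r Set.univ Set.univ Set.univ a p f) {v : G.V} {vs : List G.V}
    {es : List G.E} (hP : (parentTree r a).PathIn r v vs es) {e : G.E} (he : e ∈ es) :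
    ∃ w, w ≠ r ∧ Anc r p v w ∧ a w = e := by
  obtain ⟨⟨-, hes, hl⟩, hhead, hlast, hT⟩ := hP
  cases vs with
  | nil => simp at hhead
  | cons x l =>
    obtain rfl : x = r := by simpa using hhead
    exact (h.anc_of_link hl hes hT (.inl rfl) hlast).2 e he

end

lemma edgeIndependent_parentTree {r : G.V} {a a' : G.V → G.E} {p p' : G.V → G.V} {f f' : G.E → ℚ}
    (h : Half r Set.univ Set.univ Set.univ a p f) (h' : Half r Set.univ Set.univ Set.univ a' p' f')
    (hd : ∀ v w w', v ≠ r → w ≠ r → w' ≠ r → Anc r p v w → Anc r p' v w' → a w ≠ a' w') :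
    G.EdgeIndependent r (parentTree r a) (parentTree r a') := by
  refine ⟨trivial, trivial, fun v _ vs es vs' es' hP hP' e he he' => ?_⟩
  obtain ⟨w, hwr, hw, rfl⟩ := h.anc_of_pathIn hP he
  obtain ⟨w', hwr', hw', hww⟩ := h'.anc_of_pathIn hP' he'
  refine hd v w w' ?_ hwr hwr' hw hw' hww.symm
  rintro rfl
  exact hwr hw.eq_root

lemma EdgeIndependent.symm {r : G.V} {T T' : Sub G} (h : G.EdgeIndependent r T T') :
    G.EdgeIndependent r T' T :=
  ⟨h.2.1, h.1, fun v hv vs es vs' es' hP hP' e he he' =>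
    h.2.2 v hv.symm vs' es' vs es hP' hP e he' he⟩

theorem IsChainDecomp.hasFourEIST [Finite G.V] [Finite G.E] [Nonempty G.E] (hG : G.NoIsolated)
    {r : G.V} {n : ℕ} {Gs : Fin n → Set G.E} (h : G.IsChainDecomp r Gs) : G.HasFourEIST r := by
  obtain ⟨s, hs, hlt⟩ := exists_numbering (n := n) r (initial Gs) initial_zero fun k hk =>
    ⟨_, Gs ⟨k, hk⟩, initial_succ ⟨k, hk⟩, h.isChain ⟨k, hk⟩⟩
  obtain ⟨t, ht, hlt'⟩ := exists_numbering (n := n) r (fun k => (initial Gs (n - k))ᶜ)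
    (by simp [h.initial_last]) fun k hk => by
      have h1 := h.compl_initial ⟨n - (k + 1), by omega⟩
      have h2 := (h.isChain ⟨n - (k + 1), by omega⟩).swap
      have h3 : n - (k + 1) + 1 = n - k := by omega
      simp only [h3] at h1 h2
      exact ⟨_, _, h1, h2⟩
  have huniv : full r (Set.univ : Set G.E) = Set.univ := by
    refine Set.eq_univ_of_forall fun v => ?_
    by_cases hv : v = r
    · exact .inl hv
    · obtain ⟨k, -, hk, -⟩ := h.exists_full hG hv
      exact full_mono (Set.subset_univ _) hk
  have hs1 := hs n le_rfl
  have ht1 := ht n le_rfl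
  simp only [Nat.sub_self, initial_zero, Set.compl_empty] at ht1 hlt'
  rw [h.initial_last] at hs1 hlt
  rw [huniv] at hlt hlt'
  obtain ⟨hs1, hs2⟩ := hs1
  obtain ⟨ht1, ht2⟩ := ht1
  rw [huniv] at hs1 hs2 ht1 ht2
  have hst : ∀ v, v ≠ r → ∃ k, s.Core r (initial Gs k) ∧ t.Core r (initial Gs k)ᶜ ∧
      v ∈ full r (initial Gs k) ∧ v ∈ full r (initial Gs k)ᶜ := by
    intro v hv
    obtain ⟨k, hk, hv1, hv2⟩ := h.exists_full hG hv
    have := ht (n - k) (by omega)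
    simp only [Nat.sub_sub_self hk] at this
    exact ⟨k, hs k hk, this, hv1, hv2⟩
  have e12 : G.EdgeIndependent r (parentTree r s.a) (parentTree r s.b) :=
    edgeIndependent_parentTree hs1 hs2 fun v w w' hv hw hw' hvw hvw' heq => by
      have h1 := (hs1.anc hvw trivial hw).2.2
      have h2 := (hs2.anc hvw' trivial hw').2.2
      have h3 := hlt v trivial hv
      rw [heq] at h1
      linarith
  have e34 : G.EdgeIndependent r (parentTree r t.a) (parentTree r t.b) :=
    edgeIndependent_parentTree ht1 ht2 fun v w w' hv hw hw' hvw hvw' heq => by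
      have h1 := (ht1.anc hvw trivial hw).2.2
      have h2 := (ht2.anc hvw' trivial hw').2.2
      have h3 := hlt' v trivial hv
      rw [heq] at h1
      linarith
  have e13 : G.EdgeIndependent r (parentTree r s.a) (parentTree r t.a) :=
    edgeIndependent_parentTree hs1 ht1 fun v w w' hv hw hw' hvw hvw' heq => by
      obtain ⟨k, hsk, htk, hv1, hv2⟩ := hst v hv
      exact (htk.lower.anc hvw' hv2 hw').2.1 (heq ▸ (hsk.lower.anc hvw hv1 hw).2.1)
  have e14 : G.EdgeIndependent r (parentTree r s.a) (parentTree r t.b) :=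
    edgeIndependent_parentTree hs1 ht2 fun v w w' hv hw hw' hvw hvw' heq => by
      obtain ⟨k, hsk, htk, hv1, hv2⟩ := hst v hv
      exact (htk.upper.anc hvw' hv2 hw').2.1 (heq ▸ (hsk.lower.anc hvw hv1 hw).2.1)
  have e23 : G.EdgeIndependent r (parentTree r s.b) (parentTree r t.a) :=
    edgeIndependent_parentTree hs2 ht1 fun v w w' hv hw hw' hvw hvw' heq => by
      obtain ⟨k, hsk, htk, hv1, hv2⟩ := hst v hv
      exact (htk.lower.anc hvw' hv2 hw').2.1 (heq ▸ (hsk.upper.anc hvw hv1 hw).2.1)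
  have e24 : G.EdgeIndependent r (parentTree r s.b) (parentTree r t.b) :=
    edgeIndependent_parentTree hs2 ht2 fun v w w' hv hw hw' hvw hvw' heq => by
      obtain ⟨k, hsk, htk, hv1, hv2⟩ := hst v hv
      exact (htk.upper.anc hvw' hv2 hw').2.1 (heq ▸ (hsk.upper.anc hvw hv1 hw).2.1)
  refine ⟨![parentTree r s.a, parentTree r s.b, parentTree r t.a, parentTree r t.b], ?_, ?_⟩
  · intro i
    fin_cases i
    exacts [⟨hs1.isTree, rfl⟩, ⟨hs2.isTree, rfl⟩, ⟨ht1.isTree, rfl⟩, ⟨ht2.isTree, rfl⟩]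
  · intro i j hij
    fin_cases i <;> fin_cases j <;> first
      | exact absurd rfl hij
      | assumption
      | (apply EdgeIndependent.symm; assumption)

end MG

theorem summary_tfae (G : MG) [Finite G.V] [Finite G.E]
    (hni : G.NoIsolated) (hV : 2 ≤ Nat.card G.V) :
    [G.FourEdgeConnected,
     ∃ r : G.V, G.HasChainDecomp r,
     ∀ r : G.V, G.HasChainDecomp r,
     ∃ r : G.V, G.HasFourEIST r,
     ∀ r : G.V, G.HasFourEIST r].TFAE := by
  have hne : Nonempty G.V := (Nat.card_pos_iff.1 (by omega)).1
  have : Nonempty G.E := ⟨(hni hne.some).choose⟩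
  tfae_have 1 → 3 := fun h r => h.hasChainDecomp r
  tfae_have 3 → 2 := fun h => ⟨hne.some, h _⟩
  tfae_have 2 → 4 := fun ⟨r, _, _, h⟩ => ⟨r, h.hasFourEIST hni⟩
  tfae_have 4 → 1 := fun ⟨_, h⟩ => h.fourEdgeConnected hV
  tfae_have 3 → 5 := fun h r => let ⟨_, _, hr⟩ := h r; hr.hasFourEIST hni
  tfae_have 5 → 4 := fun h => ⟨hne.some, h _⟩
  tfae_finish
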